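/- Let (R, m) be an analytically unramified Cohen-Macaulay local ring of dimension d ≥ 3, type t(R), infinite residue field; I an ideal with closure(I) = m and J a minimal reduction. If ē₃(I) = 0 and λ(closure(I²)/(J·closure(I))) ≥ t(R) − 1, then closure(I^{n+1}) = J^{n−1}·closure(I²) for all n ≥ 1. -/

import Mathlib

set_option synthInstance.maxHeartbeats 1000000
set_option maxHeartbeats 2000000

open IsLocalRing Polynomial Finset

variable {R : Type*}

/-- `x` is integral over the ideal `I`: it satisfies an equation
`x^n + a₁ x^{n-1} + ⋯ + aₙ = 0` with `aᵢ ∈ Iⁱ`. -/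
def IsIntegralOverIdeal [CommRing R] (I : Ideal R) (x : R) : Prop :=
  ∃ n : ℕ, 0 < n ∧ ∃ a : ℕ → R, (∀ i ∈ Finset.Icc 1 n, a i ∈ I ^ i) ∧
    x ^ n + ∑ i ∈ Finset.Icc 1 n, a i * x ^ (n - i) = 0

/-- The integral closure of an ideal (the set of integral elements is an ideal,
so the span equals it). -/
def intCl [CommRing R] (I : Ideal R) : Ideal R :=
  Ideal.span {x | IsIntegralOverIdeal I x}

/-- Length of a module, as the Krull dimension of its lattice of submodules. -/
noncomputable def mlen (R M : Type*) [CommRing R] [AddCommGroup M] [Module R M] :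
    WithBot ℕ∞ :=
  Order.krullDim (Submodule R M)

/-- The quotient module `N/(K ∩ N)` for ideals `N K`. -/
abbrev idealQuot [CommRing R] (N K : Ideal R) :=
  N ⧸ (Submodule.comap N.subtype K)

/-- Depth of `M` with respect to the ideal `J`: sup of lengths of `M`-regular
sequences contained in `J`. -/
noncomputable def rdepth (A : Type*) [CommRing A] (J : Ideal A)
    (M : Type*) [AddCommGroup M] [Module A M] : ℕ∞ :=
  sSup {n : ℕ∞ | ∃ rs : List A, (rs.length : ℕ∞) = n ∧ (∀ x ∈ rs, x ∈ J) ∧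
    RingTheory.Sequence.IsRegular M rs}

/-- A local ring is Cohen-Macaulay if its depth equals its Krull dimension. -/
def IsCMLocal (R : Type*) [CommRing R] [IsLocalRing R] : Prop :=
  (rdepth R (maximalIdeal R) R : WithBot ℕ∞) = ringKrullDim R

/-- A local ring is analytically unramified if its `m`-adic completion is reduced. -/
def AnalyticallyUnramified (R : Type*) [CommRing R] [IsLocalRing R] : Prop :=
  IsReduced (AdicCompletion (maximalIdeal R) R)

/-- An ideal is `m`-primary. -/
def IsMPrimary [CommRing R] [IsLocalRing R] (I : Ideal R) : Prop :=
  I.radical = maximalIdeal R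

/-- `J ⊆ I` is a minimal reduction: generated by `d = dim R` elements and
`I^{n+1} = J I^n` for `n ≫ 0`. -/
def IsMinimalReduction [CommRing R] (d : ℕ) (J I : Ideal R) : Prop :=
  J ≤ I ∧ (∃ s : Fin d → R, J = Ideal.span (Set.range s)) ∧
    ∃ N : ℕ, ∀ n ≥ N, I ^ (n + 1) = J * I ^ n

/-- Normal Hilbert data: `L n = λ(R/ intCl(I^{n+1}))` and for `n ≫ 0` this agrees
with the polynomial whose normalized coefficients are the `e i`. -/
def NormalHilbertData [CommRing R] (d : ℕ) (I : Ideal R) (L : ℕ → ℕ) (e : ℕ → ℤ) : Prop :=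
  (∀ n, mlen R (R ⧸ intCl (I ^ (n + 1))) = (L n : WithBot ℕ∞)) ∧
    ∃ N : ℕ, ∀ n ≥ N, (L n : ℤ) =
      ∑ i ∈ Finset.range (d + 1), (-1 : ℤ) ^ i * e i * ((n + d - i).choose (d - i))

/-- `t` is the Cohen-Macaulay type of the local ring `R` of dimension `d`:
`t = λ((Q : m)/Q)` for every ideal `Q` generated by a maximal regular sequence in `m`. -/
def CMTypeData (R : Type*) [CommRing R] [IsLocalRing R] (d t : ℕ) : Prop :=
  ∀ s : List R, s.length = d → (∀ x ∈ s, x ∈ maximalIdeal R) →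
    RingTheory.Sequence.IsRegular R s →
      mlen R (idealQuot ((Ideal.span {x | x ∈ s}).colon (maximalIdeal R))
        (Ideal.span {x | x ∈ s})) = (t : WithBot ℕ∞)

/-- The quotient module `N/(K ∩ N)` for submodules `N K` of a module. -/
abbrev submoduleQuot {A M : Type*} [CommRing A] [AddCommGroup M] [Module A M]
    (N K : Submodule A M) :=
  N ⧸ (Submodule.comap N.subtype K)

set_option linter.all false

namespace RN2

/-! ### Homogeneous forms, quasi-regular sequences -/

section forms
variable {A : Type*} [CommRing A] {D : ℕ}

/-- the ideal generated by a tuple -/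
abbrev sp (x : Fin D → A) : Ideal A := Ideal.span (Set.range x)

lemma mem_sp (x : Fin D → A) (i : Fin D) : x i ∈ sp x := Ideal.subset_span ⟨i, rfl⟩

lemma eval_mem_of_coeff (x : Fin D → A) (c : Ideal A) (n : ℕ) (P : MvPolynomial (Fin D) A)
    (hP : P.IsHomogeneous n) (hc : ∀ a, P.coeff a ∈ c) :
    MvPolynomial.eval x P ∈ c * sp x ^ n := by
  rw [MvPolynomial.eval_eq]
  refine Ideal.sum_mem _ fun a ha => Ideal.mul_mem_mul (hc a) ?_
  have hd : a.degree = n := by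
    have := hP (MvPolynomial.mem_support_iff.1 ha)
    rwa [Finsupp.degree_eq_weight_one]
  rw [← hd, Finsupp.degree_apply]
  rw [← Finset.prod_pow_eq_pow_sum]
  exact Ideal.prod_mem_prod fun i _ => Ideal.pow_mem_pow (mem_sp x i) _

lemma eval_mem_pow (x : Fin D → A) (n : ℕ) (P : MvPolynomial (Fin D) A)
    (hP : P.IsHomogeneous n) : MvPolynomial.eval x P ∈ sp x ^ n := by
  have := eval_mem_of_coeff x ⊤ n P hP (fun _ => trivial)
  simpa using this

lemma exists_form (x : Fin D → A) (n : ℕ) : ∀ (c : Ideal A) (f : A), f ∈ c * sp x ^ n →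
    ∃ P : MvPolynomial (Fin D) A, P.IsHomogeneous n ∧ (∀ a, P.coeff a ∈ c) ∧
      MvPolynomial.eval x P = f := by
  induction n with
  | zero =>
    intro c f hf
    refine ⟨MvPolynomial.C f, MvPolynomial.isHomogeneous_C _ _, fun a => ?_, by simp⟩
    rw [MvPolynomial.coeff_C]
    split_ifs
    · simpa using hf
    · exact zero_mem _
  | succ n ih =>
    intro c f hf
    rw [pow_succ, ← mul_assoc, mul_comm] at hf
    refine Submodule.mul_induction_on hf ?_ ?_
    · intro r hr s hs
      obtain ⟨P, hP, hc, rfl⟩ := ih c s hs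
      refine Submodule.span_induction (p := fun r _ => ∃ Q : MvPolynomial (Fin D) A,
        Q.IsHomogeneous (n+1) ∧ (∀ a, Q.coeff a ∈ c) ∧
        MvPolynomial.eval x Q = r * MvPolynomial.eval x P) ?_ ?_ ?_ ?_ hr
      · rintro _ ⟨i, rfl⟩
        refine ⟨MvPolynomial.X i * P, ?_, ?_, by simp⟩
        · rw [add_comm]; exact (MvPolynomial.isHomogeneous_X _ i).mul hP
        · intro a
          classical
          rw [MvPolynomial.coeff_X_mul']
          split_ifs
          · exact hc _
          · exact zero_mem _
      · exact ⟨0, MvPolynomial.isHomogeneous_zero _ _ _, by simp, by simp⟩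
      · rintro a b _ _ ⟨Q, h1, h2, h3⟩ ⟨Q', h1', h2', h3'⟩
        refine ⟨Q + Q', h1.add h1', fun e => ?_, by simp [h3, h3', add_mul]⟩
        rw [MvPolynomial.coeff_add]; exact add_mem (h2 _) (h2' _)
      · rintro a b _ ⟨Q, h1, h2, h3⟩
        refine ⟨MvPolynomial.C a * Q, ?_, fun e => ?_, by simp [h3, mul_assoc]⟩
        · simpa using (MvPolynomial.isHomogeneous_C (Fin D) a).mul h1
        · rw [MvPolynomial.coeff_C_mul]; exact c.mul_mem_left _ (h2 _)
    · rintro a b ⟨Q, h1, h2, h3⟩ ⟨Q', h1', h2', h3'⟩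
      refine ⟨Q + Q', h1.add h1', fun e => ?_, by simp [h3, h3']⟩
      rw [MvPolynomial.coeff_add]; exact add_mem (h2 _) (h2' _)

lemma exists_form' (x : Fin D → A) (n : ℕ) (f : A) (hf : f ∈ sp x ^ n) :
    ∃ P : MvPolynomial (Fin D) A, P.IsHomogeneous n ∧ MvPolynomial.eval x P = f := by
  obtain ⟨P, h, _, h'⟩ := exists_form x n ⊤ f (by simpa using hf)
  exact ⟨P, h, h'⟩

/-- quasi-regularity -/
def QReg (x : Fin D → A) : Prop :=
  ∀ (n : ℕ) (P : MvPolynomial (Fin D) A), P.IsHomogeneous n →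
    MvPolynomial.eval x P ∈ sp x ^ (n + 1) → ∀ a, P.coeff a ∈ sp x

/-- a polynomial with some coefficient outside the maximal ideal -/
def Prim [IsLocalRing A] {σ : Type*} (P : MvPolynomial σ A) : Prop :=
  ∃ a, P.coeff a ∉ maximalIdeal A

lemma prim_cancel [IsLocalRing A] [IsNoetherianRing A] (P B : MvPolynomial (Fin D) A)
    (hP : Prim P) (c : Ideal A) (h : ∀ e, (P * B).coeff e ∈ c) : ∀ e, B.coeff e ∈ c := by
  classical
  set b : Ideal A := Ideal.span (Set.range fun e => B.coeff e) with hb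
  suffices b ≤ c from fun e => this (Ideal.subset_span ⟨e, rfl⟩)
  refine Submodule.le_of_le_smul_of_le_jacobson_bot (I := maximalIdeal A)
    ((isNoetherianRing_iff_ideal_fg A).1 inferInstance _)
    (IsLocalRing.maximalIdeal_le_jacobson _) ?_
  set n : Ideal A := c ⊔ maximalIdeal A • b with hn
  rw [hb, Ideal.span_le]
  by_contra hcon
  have hcon : ∃ e, B.coeff e ∉ n := by
    by_contra h'
    push Not at h'
    exact hcon (by rintro _ ⟨e, rfl⟩; exact h' e)
  let m : MonomialOrder (Fin D) := MonomialOrder.lex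
  -- maximal elements
  obtain ⟨a, ha, hamax⟩ : ∃ a, P.coeff a ∉ maximalIdeal A ∧
      ∀ a', P.coeff a' ∉ maximalIdeal A → m.toSyn a' ≤ m.toSyn a := by
    have hne : (P.support.filter fun a => P.coeff a ∉ maximalIdeal A).Nonempty := by
      obtain ⟨a, ha⟩ := hP
      exact ⟨a, by
        simp only [Finset.mem_filter, MvPolynomial.mem_support_iff]
        exact ⟨fun h0 => ha (h0 ▸ zero_mem _), ha⟩⟩
    obtain ⟨a, ha, hmax⟩ := Finset.exists_max_image _ (fun a => m.toSyn a) hne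
    refine ⟨a, (Finset.mem_filter.1 ha).2, fun a' ha' => hmax a' ?_⟩
    simp only [Finset.mem_filter, MvPolynomial.mem_support_iff]
    exact ⟨fun h0 => ha' (h0 ▸ zero_mem _), ha'⟩
  obtain ⟨e, he, hemax⟩ : ∃ a, B.coeff a ∉ n ∧
      ∀ a', B.coeff a' ∉ n → m.toSyn a' ≤ m.toSyn a := by
    have hne : (B.support.filter fun a => B.coeff a ∉ n).Nonempty := by
      obtain ⟨a, ha⟩ := hcon
      exact ⟨a, by
        simp only [Finset.mem_filter, MvPolynomial.mem_support_iff]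
        exact ⟨fun h0 => ha (h0 ▸ zero_mem _), ha⟩⟩
    obtain ⟨a, ha, hmax⟩ := Finset.exists_max_image _ (fun a => m.toSyn a) hne
    refine ⟨a, (Finset.mem_filter.1 ha).2, fun a' ha' => hmax a' ?_⟩
    simp only [Finset.mem_filter, MvPolynomial.mem_support_iff]
    exact ⟨fun h0 => ha' (h0 ▸ zero_mem _), ha'⟩
  have hcoef := h (a + e)
  rw [MvPolynomial.coeff_mul, ← Finset.add_sum_erase _ _
    (show (a, e) ∈ antidiagonal (a + e) by simp)] at hcoef
  have hrest : ∑ x ∈ (antidiagonal (a + e)).erase (a, e), P.coeff x.1 * B.coeff x.2 ∈ n := by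
    refine Ideal.sum_mem _ ?_
    rintro ⟨a', e'⟩ hx
    rw [Finset.mem_erase, HasAntidiagonal.mem_antidiagonal] at hx
    obtain ⟨hne, hsum⟩ := hx
    simp only at hsum ⊢
    by_cases h1 : P.coeff a' ∈ maximalIdeal A
    · exact Ideal.mem_sup_right (Submodule.smul_mem_smul h1 (Ideal.subset_span ⟨e', rfl⟩))
    by_cases h2 : B.coeff e' ∈ n
    · exact n.mul_mem_left _ h2
    exfalso
    have l1 := hamax a' h1
    have l2 := hemax e' h2
    have hs : m.toSyn a' + m.toSyn e' = m.toSyn a + m.toSyn e := by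
      rw [← map_add, ← map_add, hsum]
    have e1 : m.toSyn a' = m.toSyn a := by
      refine le_antisymm l1 ?_
      by_contra hlt
      push Not at hlt
      exact absurd hs (ne_of_lt (add_lt_add_of_lt_of_le hlt l2))
    have e2 : a' = a := m.toSyn.injective e1
    subst e2
    exact hne (by rw [add_left_cancel hsum])
  have h3 : P.coeff a * B.coeff e ∈ n := by
    have h4 := sub_mem (show _ ∈ n from Ideal.mem_sup_left hcoef) hrest
    simpa using h4
  have hu : IsUnit (P.coeff a) := by simpa using ha
  exact he ((Ideal.unit_mul_mem_iff_mem _ hu).1 h3)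

lemma Prim.mul [IsLocalRing A] {P Q : MvPolynomial (Fin D) A} (hP : Prim P) (hQ : Prim Q) :
    Prim (P * Q) := by
  by_contra h
  have hz : ∀ S : MvPolynomial (Fin D) A, ¬ Prim S ↔
      MvPolynomial.map (residue A) S = 0 := by
    intro S
    simp only [Prim, not_exists, not_not]
    constructor
    · intro h; ext a; rw [MvPolynomial.coeff_map]
      simpa [residue_eq_zero_iff] using h a
    · intro h a
      have := congrArg (MvPolynomial.coeff a) h
      rw [MvPolynomial.coeff_map] at this
      simpa [residue_eq_zero_iff] using this
  rw [hz, map_mul, mul_eq_zero] at h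
  rcases h with h | h
  · exact (hz P).2 h hP
  · exact (hz Q).2 h hQ

lemma Prim.one [IsLocalRing A] : Prim (1 : MvPolynomial (Fin D) A) :=
  ⟨0, by simp⟩

lemma Prim.pow [IsLocalRing A] {P : MvPolynomial (Fin D) A} (hP : Prim P) (n : ℕ) :
    Prim (P ^ n) := by
  induction n with
  | zero => simpa using Prim.one
  | succ n ih => rw [pow_succ]; exact ih.mul hP

lemma Prim.X [IsLocalRing A] (i : Fin D) : Prim (MvPolynomial.X i : MvPolynomial (Fin D) A) :=
  ⟨Finsupp.single i 1, by simp⟩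

/-- cancellation of primitive forms in the powers of a quasi-regular ideal -/
lemma QReg.cancel [IsLocalRing A] [IsNoetherianRing A] {x : Fin D → A} (hx : QReg x)
    {a : ℕ} {P : MvPolynomial (Fin D) A} (hP : P.IsHomogeneous a) (hp : Prim P)
    (n : ℕ) (f : A) (h : MvPolynomial.eval x P * f ∈ sp x ^ (n + a)) : f ∈ sp x ^ n := by
  suffices ∀ i ≤ n, f ∈ sp x ^ i from this n le_rfl
  intro i hi
  induction i with
  | zero => simp
  | succ i ih =>
    obtain ⟨B, hB, rfl⟩ := exists_form' x i f (ih (by omega))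
    have h1 : ∀ e, (P * B).coeff e ∈ sp x := by
      refine hx (a + i) _ (hP.mul hB) ?_
      rw [map_mul]
      exact Ideal.pow_le_pow_right (by omega) h
    have := eval_mem_of_coeff x (sp x) i B hB (prim_cancel P B hp _ h1)
    rwa [← pow_succ'] at this

lemma QReg.cancel_X [IsLocalRing A] [IsNoetherianRing A] {x : Fin D → A} (hx : QReg x)
    (i : Fin D) (n : ℕ) (f : A) (h : x i * f ∈ sp x ^ (n + 1)) : f ∈ sp x ^ n :=
  hx.cancel (MvPolynomial.isHomogeneous_X _ i) (Prim.X i) n f (by simpa using h)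

end forms

end RN2

namespace RN2

/-! ### The closure filtration -/

section closure
variable {A : Type*} [CommRing A]

/-- elements of asymptotic order at least `c / b` -/
def cl (J : Ideal A) (b : ℕ) [NeZero b] (c : ℕ) : Ideal A where
  carrier := {f | ∃ k, ∀ i j, b * (i + k) ≤ c * j → f ^ j ∈ J ^ i}
  zero_mem' := by
    refine ⟨0, fun i j h => ?_⟩
    rcases Nat.eq_zero_or_pos j with rfl | hj
    · have : i = 0 := by
        have hb := NeZero.pos b
        simp at h
        rcases h with h | h
        · omega
        · exact h
      subst this; simp
    · rw [zero_pow hj.ne']; exact zero_mem _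
  add_mem' := by
    rintro f g ⟨k, hf⟩ ⟨l, hg⟩
    refine ⟨k + l + 1, fun i j h => ?_⟩
    rw [add_pow]
    refine Ideal.sum_mem _ fun p hp => Ideal.mul_mem_right _ _ ?_
    have hp : p ≤ j := by simpa [Nat.lt_succ_iff] using hp
    have hb := NeZero.pos b
    set u := c * p / b with hu
    set v := c * (j - p) / b with hv
    have h1 : f ^ p ∈ J ^ (u - k) := by
      by_cases hk : k ≤ u
      · apply hf
        rw [Nat.sub_add_cancel hk, hu]; exact Nat.mul_div_le _ _
      · rw [Nat.sub_eq_zero_of_le (by omega)]; simp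
    have h2 : g ^ (j - p) ∈ J ^ (v - l) := by
      by_cases hk : l ≤ v
      · apply hg
        rw [Nat.sub_add_cancel hk, hv]; exact Nat.mul_div_le _ _
      · rw [Nat.sub_eq_zero_of_le (by omega)]; simp
    have h3 : i ≤ (u - k) + (v - l) := by
      have e1 : c * p < b * (u + 1) := by
        rw [hu]; exact Nat.lt_mul_div_succ _ hb
      have e2 : c * (j - p) < b * (v + 1) := by
        rw [hv]; exact Nat.lt_mul_div_succ _ hb
      have e3 : c * p + c * (j - p) = c * j := by rw [← mul_add, Nat.add_sub_cancel' hp]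
      have e4 : b * (i + (k + l + 1)) < b * (u + v + 2) := by
        calc _ ≤ c * j := h
          _ = c * p + c * (j - p) := e3.symm
          _ < b * (u + 1) + b * (v + 1) := by omega
          _ = _ := by ring
      have := Nat.lt_of_mul_lt_mul_left e4
      omega
    refine Ideal.pow_le_pow_right h3 ?_
    rw [pow_add]; exact Ideal.mul_mem_mul h1 h2
  smul_mem' := by
    rintro r f ⟨k, hf⟩
    exact ⟨k, fun i j h => by
      rw [smul_eq_mul, mul_pow]; exact Ideal.mul_mem_left _ _ (hf i j h)⟩

lemma mem_cl {J : Ideal A} {b : ℕ} [NeZero b] {c : ℕ} {f : A} :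
    f ∈ cl J b c ↔ ∃ k, ∀ i j, b * (i + k) ≤ c * j → f ^ j ∈ J ^ i := Iff.rfl

/-- the integral closure filtration -/
abbrev F (J : Ideal A) (n : ℕ) : Ideal A := cl J 1 n

lemma mem_F {J : Ideal A} {n : ℕ} {f : A} :
    f ∈ F J n ↔ ∃ k, ∀ i j, i + k ≤ n * j → f ^ j ∈ J ^ i := by
  simp [F, mem_cl]

variable (J : Ideal A) (b : ℕ) [NeZero b]

lemma cl_anti : Antitone (cl J b) := by
  rintro c d h f ⟨k, hf⟩
  exact ⟨k, fun i j hij => hf i j (hij.trans (Nat.mul_le_mul_right _ h))⟩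

lemma cl_zero : cl J b 0 = ⊤ := by
  rw [Ideal.eq_top_iff_one]
  refine ⟨0, fun i j h => ?_⟩
  have hb := NeZero.pos b
  have : i = 0 := by
    simp at h
    rcases h with h | h
    · omega
    · exact h
  subst this; simp

lemma pow_le_cl (n : ℕ) : J ^ n ≤ cl J b (b * n) := by
  intro f hf
  refine ⟨0, fun i j h => ?_⟩
  have hb := NeZero.pos b
  have : i ≤ n * j := by
    rw [add_zero, mul_assoc] at h; exact Nat.le_of_mul_le_mul_left h hb
  refine Ideal.pow_le_pow_right this ?_
  rw [pow_mul]; exact Ideal.pow_mem_pow hf _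

lemma pow_le_F (n : ℕ) : J ^ n ≤ F J n := by
  simpa using pow_le_cl J 1 n

lemma cl_mul_mem {c d : ℕ} {f g : A} (hf : f ∈ cl J b c) (hg : g ∈ cl J b d) :
    f * g ∈ cl J b (c + d) := by
  obtain ⟨k, hf⟩ := hf
  obtain ⟨l, hg⟩ := hg
  refine ⟨k + l + 1, fun i j h => ?_⟩
  have hb := NeZero.pos b
  rw [mul_pow]
  set u := c * j / b with hu
  set v := d * j / b with hv
  have h1 : f ^ j ∈ J ^ (u - k) := by
    by_cases hk : k ≤ u
    · apply hf
      rw [Nat.sub_add_cancel hk, hu]; exact Nat.mul_div_le _ _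
    · rw [Nat.sub_eq_zero_of_le (by omega)]; simp
  have h2 : g ^ j ∈ J ^ (v - l) := by
    by_cases hk : l ≤ v
    · apply hg
      rw [Nat.sub_add_cancel hk, hv]; exact Nat.mul_div_le _ _
    · rw [Nat.sub_eq_zero_of_le (by omega)]; simp
  have h3 : i ≤ (u - k) + (v - l) := by
    have e1 : c * j < b * (u + 1) := by
      rw [hu]; exact Nat.lt_mul_div_succ _ hb
    have e2 : d * j < b * (v + 1) := by
      rw [hv]; exact Nat.lt_mul_div_succ _ hb
    have e4 : b * (i + (k + l + 1)) < b * (u + v + 2) := by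
      calc _ ≤ (c + d) * j := h
        _ = c * j + d * j := add_mul _ _ _
        _ < b * (u + 1) + b * (v + 1) := by omega
        _ = _ := by ring
    have := Nat.lt_of_mul_lt_mul_left e4
    omega
  refine Ideal.pow_le_pow_right h3 ?_
  rw [pow_add]; exact Ideal.mul_mem_mul h1 h2

lemma cl_mul_le (c d : ℕ) : cl J b c * cl J b d ≤ cl J b (c + d) :=
  Ideal.mul_le.2 fun _ hf _ hg => cl_mul_mem J b hf hg

lemma cl_pow_mem {c : ℕ} {f : A} (hf : f ∈ cl J b c) (s : ℕ) : f ^ s ∈ cl J b (s * c) := by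
  induction s with
  | zero => simp [cl_zero]
  | succ s ih => rw [pow_succ, add_mul, one_mul]; exact cl_mul_mem J b ih hf

/-- roots -/
lemma cl_root {c s : ℕ} (hs : 0 < s) {f : A} (hf : f ^ s ∈ cl J b (s * c)) : f ∈ cl J b c := by
  obtain ⟨k, hf⟩ := hf
  refine ⟨k + s * c, fun i j h => ?_⟩
  have hb := NeZero.pos b
  rw [← Nat.div_add_mod j s, pow_add, pow_mul]
  refine Ideal.mul_mem_right _ _ (hf i (j / s) ?_)
  have h1 := Nat.lt_mul_div_succ j hs
  have h2 : c * j ≤ c * (s * (j / s + 1)) := Nat.mul_le_mul_left _ h1.le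
  have h3 : s * c ≤ b * (s * c) := Nat.le_mul_of_pos_left _ hb
  nlinarith

lemma cl_scale {s : ℕ} [NeZero s] [NeZero (b * s)] (c : ℕ) : cl J (b * s) (c * s) = cl J b c := by
  have hs := NeZero.pos s
  ext f
  simp only [mem_cl]
  refine exists_congr fun k => forall₂_congr fun i j => ?_
  have : b * s * (i + k) ≤ c * s * j ↔ b * (i + k) ≤ c * j := by
    rw [show b * s * (i + k) = s * (b * (i + k)) by ring,
      show c * s * j = s * (c * j) by ring, Nat.mul_le_mul_left_iff hs]
  rw [this]

lemma cl_mul_eq_F (n : ℕ) : cl J b (b * n) = F J n := by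
  have hb := NeZero.pos b
  ext f
  simp only [F, mem_cl]
  refine exists_congr fun k => forall₂_congr fun i j => ?_
  have : b * (i + k) ≤ b * n * j ↔ 1 * (i + k) ≤ n * j := by
    rw [mul_assoc, Nat.mul_le_mul_left_iff hb, one_mul]
  rw [this]

/-- `f ∈ V_c` iff `f ^ b ∈ F_c`. -/
lemma mem_cl_iff_pow (c : ℕ) (f : A) : f ∈ cl J b c ↔ f ^ b ∈ F J c := by
  have hb := NeZero.pos b
  rw [← cl_mul_eq_F J b c]
  exact ⟨fun h => cl_pow_mem J b h b, fun h => cl_root J b hb h⟩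

lemma F_anti : Antitone (F J) := cl_anti J 1
lemma F_zero : F J 0 = ⊤ := cl_zero J 1
lemma F_mul_mem {c d : ℕ} {f g : A} (hf : f ∈ F J c) (hg : g ∈ F J d) : f * g ∈ F J (c + d) :=
  cl_mul_mem J 1 hf hg
lemma F_mul_le (c d : ℕ) : F J c * F J d ≤ F J (c + d) := cl_mul_le J 1 c d
lemma F_pow_mem {c : ℕ} {f : A} (hf : f ∈ F J c) (s : ℕ) : f ^ s ∈ F J (s * c) :=
  cl_pow_mem J 1 hf s
lemma F_root {c s : ℕ} (hs : 0 < s) {f : A} (hf : f ^ s ∈ F J (s * c)) : f ∈ F J c :=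
  cl_root J 1 hs hf
lemma pow_mem_F (n : ℕ) {f : A} (hf : f ∈ J ^ n) : f ∈ F J n := pow_le_F J n hf
lemma mem_F_one {f : A} (hf : f ∈ J) : f ∈ F J 1 := pow_mem_F J 1 (by simpa using hf)

lemma pow_mul_F_le (i n : ℕ) : J ^ i * F J n ≤ F J (i + n) :=
  (Ideal.mul_mono_left (pow_le_F J i)).trans (F_mul_le J i n)

/-- cancellation of primitive forms in the closure filtration -/
lemma cl_cancel [IsLocalRing A] [IsNoetherianRing A] {D : ℕ} {x : Fin D → A} (hx : QReg x)
    {a : ℕ} {P : MvPolynomial (Fin D) A} (hP : P.IsHomogeneous a) (hp : Prim P)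
    (c : ℕ) (f : A) (h : MvPolynomial.eval x P * f ∈ cl (sp x) b (c + a * b)) :
    f ∈ cl (sp x) b c := by
  obtain ⟨k, h⟩ := h
  refine ⟨k, fun i j hij => ?_⟩
  refine hx.cancel (hP.pow j) (hp.pow j) i (f ^ j) ?_
  rw [map_pow, ← mul_pow]
  apply h
  have : b * (i + a * j + k) = b * (i + k) + (a * b) * j := by ring
  rw [this, add_mul]; omega

lemma F_cancel [IsLocalRing A] [IsNoetherianRing A] {D : ℕ} {x : Fin D → A} (hx : QReg x)
    {a : ℕ} {P : MvPolynomial (Fin D) A} (hP : P.IsHomogeneous a) (hp : Prim P)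
    (c : ℕ) (f : A) (h : MvPolynomial.eval x P * f ∈ F (sp x) (c + a)) :
    f ∈ F (sp x) c := cl_cancel 1 hx hP hp c f (by simpa using h)

lemma F_cancel_X [IsLocalRing A] [IsNoetherianRing A] {D : ℕ} {x : Fin D → A} (hx : QReg x)
    (i : Fin D) (p : ℕ) (c : ℕ) (f : A) (h : x i ^ p * f ∈ F (sp x) (c + p)) :
    f ∈ F (sp x) c :=
  F_cancel hx (P := MvPolynomial.X i ^ p) (a := p)
    (by simpa using (MvPolynomial.isHomogeneous_X A i).pow p) ((Prim.X i).pow p) c f (by simpa using h)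

/-- uniform tolerance for a finitely generated ideal -/
lemma F_unif [IsNoetherianRing A] (n : ℕ) :
    ∃ k, ∀ i j, i + k ≤ n * j → F J n ^ j ≤ J ^ i := by
  obtain ⟨s, g, hg⟩ := Submodule.fg_iff_exists_fin_generating_family.1
    ((isNoetherianRing_iff_ideal_fg A).1 inferInstance (F J n))
  have hg' : F J n = sp g := hg.symm
  have : ∀ l, ∃ k, ∀ i j, i + k ≤ n * j → g l ^ j ∈ J ^ i := fun l =>
    mem_F.1 (hg'.symm ▸ mem_sp g l)
  choose k hk using this
  refine ⟨∑ l, k l, fun i j hij f hf => ?_⟩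
  rw [hg'] at hf
  obtain ⟨P, hP, rfl⟩ := exists_form' g j f hf
  rw [MvPolynomial.eval_eq']
  refine Ideal.sum_mem _ fun a ha => Ideal.mul_mem_left _ _ ?_
  have hd : ∑ l, a l = j := by
    have := hP (MvPolynomial.mem_support_iff.1 ha)
    have h' : a.degree = j := by rwa [Finsupp.degree_eq_weight_one]
    rwa [Finsupp.degree_eq_sum] at h'
  have h1 : ∀ l, g l ^ a l ∈ J ^ (n * a l - k l) := by
    intro l
    by_cases h : k l ≤ n * a l
    · exact hk l _ _ (by omega)
    · rw [Nat.sub_eq_zero_of_le (by omega)]; simp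
  have h2 := Ideal.prod_mem_prod (s := Finset.univ) (fun l _ => h1 l)
  rw [Finset.prod_pow_eq_pow_sum] at h2
  refine Ideal.pow_le_pow_right ?_ h2
  have h3 : n * j = ∑ l, n * a l := by rw [← hd, Finset.mul_sum]
  have h4 : ∑ l, n * a l ≤ ∑ l, (n * a l - k l) + ∑ l, k l := by
    rw [← Finset.sum_add_distrib]
    exact Finset.sum_le_sum fun l _ => by omega
  omega

lemma mem_sup_span_pow (I : Ideal A) (f : A) (m : ℕ) : ∀ g ∈ (I ⊔ Ideal.span {f}) ^ m,
    ∃ c : ℕ → A, (∀ i ≤ m, c i ∈ I ^ (m - i)) ∧ g = ∑ i ∈ Finset.range (m + 1), c i * f ^ i := by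
  induction m with
  | zero => intro g _; exact ⟨fun _ => g, by simp, by simp⟩
  | succ m ih =>
    intro g hg
    rw [pow_succ'] at hg
    refine Submodule.mul_induction_on hg ?_ ?_
    · intro r hr s hs
      obtain ⟨c, hc, rfl⟩ := ih s hs
      obtain ⟨u, hu, v, hv, rfl⟩ := Submodule.mem_sup.1 hr
      obtain ⟨w, rfl⟩ := Ideal.mem_span_singleton'.1 hv
      refine ⟨fun i => (if i ≤ m then u * c i else 0) + (if i = 0 then 0 else w * c (i - 1)), ?_, ?_⟩
      · intro i hi
        refine add_mem ?_ ?_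
        · split_ifs with h
          · rw [Nat.succ_sub h, pow_succ']; exact Ideal.mul_mem_mul hu (hc i h)
          · exact zero_mem _
        · split_ifs with h
          · exact zero_mem _
          · have := hc (i - 1) (by omega)
            rw [show m - (i - 1) = m + 1 - i by omega] at this
            exact Ideal.mul_mem_left _ _ this
      · simp only [add_mul, Finset.sum_add_distrib]
        rw [Finset.sum_range_succ (n := m + 1), Finset.sum_range_succ' (n := m + 1)]
        simp only [Nat.add_eq_zero_iff, one_ne_zero, and_false, if_false, Nat.add_sub_cancel]
        simp only [Nat.not_succ_le_self, if_false, if_true, zero_mul, add_zero]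
        rw [Finset.mul_sum, Finset.mul_sum]
        congr 1
        · refine Finset.sum_congr rfl fun i hi => ?_
          rw [if_pos (by simpa [Nat.lt_succ_iff] using hi)]; ring
        · refine Finset.sum_congr rfl fun i hi => ?_
          ring
    · rintro a b ⟨c, hc, rfl⟩ ⟨d, hd, rfl⟩
      refine ⟨fun i => c i + d i, fun i hi => add_mem (hc i hi) (hd i hi), ?_⟩
      rw [← Finset.sum_add_distrib]
      exact Finset.sum_congr rfl fun i _ => by ring

/-- elements of `F_n` are integral over `J ^ n`. -/
lemma F_integral [IsNoetherianRing A] {n : ℕ} {f : A} (hf : f ∈ F J n) :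
    ∃ s, ∃ c : ℕ → A, (∀ i < s, c i ∈ J ^ (n * (s - i))) ∧
      f ^ s = ∑ i ∈ Finset.range s, c i * f ^ i := by
  rcases Nat.eq_zero_or_pos n with rfl | hn
  · exact ⟨1, fun _ => f, by simp, by simp⟩
  obtain ⟨k, hk⟩ := mem_F.1 hf
  set K := J ^ n ⊔ Ideal.span {f} with hK
  have hKle : ∀ m, K ^ m ≤ J ^ (n * m - k) := by
    intro m g hg
    obtain ⟨c, hc, rfl⟩ := mem_sup_span_pow _ _ _ g hg
    refine Ideal.sum_mem _ fun i hi => ?_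
    have hi : i ≤ m := by simpa [Nat.lt_succ_iff] using hi
    have h1 : f ^ i ∈ J ^ (n * i - k) := by
      by_cases h : k ≤ n * i
      · exact hk _ _ (by omega)
      · rw [Nat.sub_eq_zero_of_le (by omega)]; simp
    have h2 := hc i hi
    rw [← pow_mul] at h2
    refine Ideal.pow_le_pow_right ?_ (pow_add J _ _ ▸ Ideal.mul_mem_mul h2 h1)
    have : n * m = n * (m - i) + n * i := by rw [← mul_add, Nat.sub_add_cancel hi]
    omega
  let F1 : (J ^ n).Filtration A :=
    { N := fun m => K ^ m
      mono := fun m => Ideal.pow_le_pow_right (Nat.le_succ m)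
      smul_le := fun m => by
        rw [smul_eq_mul, pow_succ']
        exact Ideal.mul_mono_left le_sup_left }
  let F2 : (J ^ n).Filtration A :=
    { N := fun m => J ^ (n * m - k)
      mono := fun m => Ideal.pow_le_pow_right (by rw [mul_add]; omega)
      smul_le := fun m => by
        rw [smul_eq_mul, ← pow_add]
        exact Ideal.pow_le_pow_right (by rw [mul_add]; omega) }
  have hF2 : F2.Stable := by
    refine ⟨k, fun m hm => ?_⟩
    change (J ^ n) * J ^ (n * m - k) = J ^ (n * (m + 1) - k)
    rw [← pow_add]
    congr 1
    have : k ≤ n * m := hm.trans (Nat.le_mul_of_pos_left _ hn)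
    rw [mul_add]; omega
  obtain ⟨m, hm⟩ := hF2.of_le (F := F2) (F' := F1) (fun m => hKle m)
  have h1 : J ^ n * K ^ m = K ^ (m + 1) := hm m le_rfl
  have h2 : f ^ (m + 1) ∈ J ^ n * K ^ m := by
    rw [h1]
    exact Ideal.pow_mem_pow (le_sup_right (a := J ^ n) (Ideal.mem_span_singleton_self f)) _
  refine ⟨m + 1, ?_⟩
  suffices ∀ g ∈ J ^ n * K ^ m, ∃ c : ℕ → A, (∀ i < m + 1, c i ∈ J ^ (n * (m + 1 - i))) ∧
      g = ∑ i ∈ Finset.range (m + 1), c i * f ^ i from this _ h2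
  intro g hg
  refine Submodule.mul_induction_on hg ?_ ?_
  · intro r hr s hs
    obtain ⟨c, hc, rfl⟩ := mem_sup_span_pow _ _ _ s hs
    refine ⟨fun i => r * c i, fun i hi => ?_, ?_⟩
    · have := Ideal.mul_mem_mul hr (hc i (by omega))
      rw [← pow_mul, ← pow_add] at this
      rwa [show n * (m + 1 - i) = n + n * (m - i) by
        rw [show m + 1 - i = (m - i) + 1 by omega]; ring]
    · rw [Finset.mul_sum]; exact Finset.sum_congr rfl fun i _ => by ring
  · rintro a b ⟨c, hc, rfl⟩ ⟨d, hd, rfl⟩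
    refine ⟨fun i => c i + d i, fun i hi => add_mem (hc i hi) (hd i hi), ?_⟩
    rw [← Finset.sum_add_distrib]
    exact Finset.sum_congr rfl fun i _ => by ring

/-- converse, with a primitive leading form -/
lemma mem_F_of_eqn [IsLocalRing A] [IsNoetherianRing A] {D : ℕ} {x : Fin D → A} (hx : QReg x)
    {a : ℕ} {P : MvPolynomial (Fin D) A} (hP : P.IsHomogeneous a) (hp : Prim P)
    {n s : ℕ} (hs0 : 0 < s) {f : A} (c : ℕ → A) (hc : ∀ i < s, c i ∈ sp x ^ (a + n * (s - i)))
    (h : MvPolynomial.eval x P * f ^ s = ∑ i ∈ Finset.range s, c i * f ^ i) : f ∈ F (sp x) n := by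
  set θ := MvPolynomial.eval x P with hθ
  have key : ∀ j, ∃ c : ℕ → A, (∀ i < s, c i ∈ sp x ^ (a * j + n * (s + j - i - 1))) ∧
      θ ^ j * f ^ (s + j - 1) = ∑ i ∈ Finset.range s, c i * f ^ i ∨ s = 0 := by
    intro j
    by_cases hs : s = 0
    · exact ⟨c, Or.inr hs⟩
    induction j with
    | zero =>
      refine ⟨fun i => if i = s - 1 then 1 else 0, Or.inl ⟨fun i hi => ?_, ?_⟩⟩
      · beta_reduce
        split_ifs with h
        · subst h; rw [show a * 0 + n * (s + 0 - (s - 1) - 1) = 0 by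
            rw [show s + 0 - (s-1) - 1 = 0 by omega]; simp]; simp
        · exact zero_mem _
      · have : s - 1 ∈ Finset.range s := by simp; omega
        simp [Finset.sum_ite_eq', Nat.pos_of_ne_zero hs]
    | succ j ih =>
      obtain ⟨d, hd | hd⟩ := ih
      swap
      · exact absurd hd hs
      obtain ⟨hd, he⟩ := hd
      obtain ⟨s, rfl⟩ : ∃ t, s = t + 1 := ⟨s - 1, by omega⟩
      refine ⟨fun i => θ * (if i = 0 then 0 else d (i - 1)) + d s * c i, Or.inl ⟨fun i hi => ?_, ?_⟩⟩
      · beta_reduce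
        refine add_mem ?_ ?_
        · split_ifs with h
          · simp
          · have h1 : θ ∈ sp x ^ a := eval_mem_pow x a P hP
            have h2 := hd (i - 1) (by omega)
            have h3 := Ideal.mul_mem_mul h1 h2
            rw [← pow_add] at h3
            convert h3 using 2
            rw [show s + 1 + j - (i - 1) - 1 = s + 1 + (j + 1) - i - 1 by omega]; ring
        · have h1 := Ideal.mul_mem_mul (hd s (by omega)) (hc i hi)
          rw [← pow_add] at h1
          convert h1 using 2
          rw [show s + 1 + (j + 1) - i - 1 = (s + 1 + j - s - 1) + (s + 1 - i) by omega]; ring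
      · have e1 : θ ^ (j + 1) * f ^ (s + 1 + (j + 1) - 1) = θ * f * (θ ^ j * f ^ (s + 1 + j - 1)) := by
          rw [show s + 1 + (j + 1) - 1 = (s + 1 + j - 1) + 1 by omega]; ring
        rw [e1, he, Finset.sum_range_succ, mul_add]
        simp only [add_mul, Finset.sum_add_distrib]
        have e2 : θ * f * (d s * f ^ s) = ∑ i ∈ Finset.range (s + 1), d s * c i * f ^ i := by
          calc θ * f * (d s * f ^ s) = d s * (θ * f ^ (s + 1)) := by ring
            _ = _ := by rw [h, Finset.mul_sum]; exact Finset.sum_congr rfl fun i _ => by ring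
        rw [e2]
        congr 1
        rw [Finset.sum_range_succ', Finset.mul_sum]
        simp only [Nat.add_eq_zero_iff, one_ne_zero, and_false, if_false, Nat.add_sub_cancel, if_true,
          mul_zero, zero_mul, add_zero]
        exact Finset.sum_congr rfl fun i _ => by ring
  refine mem_F.2 ⟨n * s, fun i j hij => ?_⟩
  by_cases hjs : j < s
  · have : n * j ≤ n * s := Nat.mul_le_mul_left _ hjs.le
    obtain rfl : i = 0 := by omega
    simp
  obtain ⟨d, hd | hd⟩ := key (j + 1 - s)
  swap
  · omega
  obtain ⟨hd, he⟩ := hd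
  rw [show s + (j + 1 - s) - 1 = j by omega] at he
  have h1 : θ ^ (j + 1 - s) * f ^ j ∈ sp x ^ (n * (j + 1 - s) + a * (j + 1 - s)) := by
    rw [he]
    refine Ideal.sum_mem _ fun i hi => Ideal.mul_mem_right _ _ ?_
    have hi' : i < s := by simpa using hi
    refine Ideal.pow_le_pow_right ?_ (hd i hi')
    have : n * (j + 1 - s) ≤ n * (s + (j + 1 - s) - i - 1) := Nat.mul_le_mul_left _ (by omega)
    omega
  rw [hθ, ← map_pow] at h1
  have h2 := hx.cancel (hP.pow (j + 1 - s)) (hp.pow _) (n * (j + 1 - s)) (f ^ j) h1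
  refine Ideal.pow_le_pow_right ?_ h2
  have : n * j ≤ n * (j + 1 - s) + n * s := by
    rw [← mul_add]; exact Nat.mul_le_mul_left _ (by omega)
  omega

end closure

end RN2

namespace RN2

section lengths
variable {A : Type*} [CommRing A]

/-- length of `A / I` -/
noncomputable abbrev ln (I : Ideal A) : ℕ∞ := Module.length A (A ⧸ I)

/-- the colon ideal `I : x` -/
def cdiv (I : Ideal A) (x : A) : Ideal A := Submodule.comap (LinearMap.mulLeft A x) I

lemma mem_cdiv {I : Ideal A} {x f : A} : f ∈ cdiv I x ↔ x * f ∈ I := Iff.rfl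

lemma ln_anti {I K : Ideal A} (h : I ≤ K) : ln K ≤ ln I :=
  Module.length_le_of_surjective (Submodule.mapQ I K LinearMap.id h) (by
    intro y
    obtain ⟨y, rfl⟩ := Submodule.Quotient.mk_surjective _ y
    exact ⟨Submodule.Quotient.mk y, rfl⟩)

lemma ln_top : ln (⊤ : Ideal A) = 0 := by
  rw [Module.length_eq_zero_iff]; exact Ideal.Quotient.subsingleton_iff.2 rfl

lemma ln_colon (I : Ideal A) (x : A) : ln I = ln (I ⊔ Ideal.span {x}) + ln (cdiv I x) := by
  have hle : cdiv I x ≤ Submodule.comap (LinearMap.mulLeft A x) I := fun f hf => hf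
  have h := Module.length_eq_add_of_exact
    (Submodule.mapQ (cdiv I x) I (LinearMap.mulLeft A x) hle)
    (Submodule.mapQ I (I ⊔ Ideal.span {x}) LinearMap.id le_sup_left) ?_ ?_ ?_
  · rw [ln, h, add_comm]
  · rw [← LinearMap.ker_eq_bot, eq_bot_iff]
    intro y hy
    obtain ⟨y, rfl⟩ := Submodule.Quotient.mk_surjective _ y
    rw [LinearMap.mem_ker, Submodule.mapQ_apply, Submodule.Quotient.mk_eq_zero] at hy
    rw [Submodule.mem_bot, Submodule.Quotient.mk_eq_zero]; exact hy
  · intro y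
    obtain ⟨y, rfl⟩ := Submodule.Quotient.mk_surjective _ y
    exact ⟨Submodule.Quotient.mk y, rfl⟩
  · intro y
    obtain ⟨y, rfl⟩ := Submodule.Quotient.mk_surjective _ y
    rw [Submodule.mapQ_apply, Submodule.Quotient.mk_eq_zero]
    constructor
    · intro h
      obtain ⟨u, hu, v, hv, e⟩ := Submodule.mem_sup.1 h
      obtain ⟨w, rfl⟩ := Ideal.mem_span_singleton'.1 hv
      refine ⟨Submodule.Quotient.mk w, ?_⟩
      rw [Submodule.mapQ_apply, Submodule.Quotient.eq]
      have e' : y = u + w * x := by simpa using e.symm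
      rw [e', LinearMap.mulLeft_apply, show x * w - (u + w * x) = - u by ring]
      exact neg_mem hu
    · rintro ⟨w, hw⟩
      obtain ⟨w, rfl⟩ := Submodule.Quotient.mk_surjective _ w
      rw [Submodule.mapQ_apply, Submodule.Quotient.eq, LinearMap.mulLeft_apply] at hw
      have : y = -(x * w - y) + w * x := by ring
      simp only [LinearMap.id_apply]
      rw [this]
      exact Submodule.add_mem_sup (neg_mem hw) (Ideal.mem_span_singleton'.2 ⟨w, rfl⟩)

lemma ln_eq_of_le {I K : Ideal A} (h : I ≤ K) (h' : ln I ≤ ln K) (hf : ln I ≠ ⊤) : I = K := by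
  refine le_antisymm h fun f hf' => ?_
  have h1 := ln_colon I f
  have h2 : ln K ≤ ln (I ⊔ Ideal.span {f}) :=
    ln_anti (sup_le h ((Ideal.span_singleton_le_iff_mem _).2 hf'))
  have h3 : ln (cdiv I f) = 0 := by
    by_contra h0
    have h5 : ln (I ⊔ Ideal.span {f}) ≠ ⊤ := fun h => by simp [h] at h1; exact hf h1
    have h4 : ln (I ⊔ Ideal.span {f}) < ln (I ⊔ Ideal.span {f}) + ln (cdiv I f) :=
      by
      rw [← ENat.coe_toNat h5]
      exact (ENat.lt_add_one_iff (by simp)).2 le_rfl |>.trans_le (add_le_add_right (ENat.one_le_iff_ne_zero.2 h0) _)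
    rw [← h1] at h4
    exact absurd (h'.trans h2) (not_le.2 h4)
  rw [Module.length_eq_zero_iff] at h3
  have := Ideal.Quotient.subsingleton_iff.1 h3
  have h1 : (1 : A) ∈ cdiv I f := by rw [this]; trivial
  simpa [mem_cdiv] using h1

lemma ln_comap {B : Type*} [CommRing B] (φ : A →+* B) (hφ : Function.Surjective φ) (I : Ideal B) :
    ln (I.comap φ) = ln I := by
  letI := φ.toAlgebra
  have h1 : Module.length A (B ⧸ I) = Module.length B (B ⧸ I) :=
    Module.length_eq_of_surjective (S := A) (R := B) hφ
  rw [ln, ln, ← h1]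
  refine LinearEquiv.length_eq ?_
  refine LinearEquiv.ofBijective
    ({ toFun := Ideal.quotientMap I φ le_rfl, map_add' := map_add _, map_smul' := ?_ } :
      (A ⧸ I.comap φ) →ₗ[A] (B ⧸ I)) ⟨Ideal.quotientMap_injective,
      Ideal.quotientMap_surjective (H := le_rfl) hφ⟩
  intro r y
  obtain ⟨y, rfl⟩ := Ideal.Quotient.mk_surjective y
  rw [← Ideal.Quotient.mk_eq_mk, ← Submodule.Quotient.mk_smul]
  simp only [Ideal.Quotient.mk_eq_mk, Ideal.quotientMap_mk, smul_eq_mul, map_mul, RingHom.id_apply]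
  rfl

/-- `r` is regular modulo `I` -/
def Reg (r : A) (I : Ideal A) : Prop := ∀ f, r * f ∈ I → f ∈ I

lemma Reg.pow {r : A} {I : Ideal A} (h : Reg r I) (n : ℕ) : Reg (r ^ n) I := by
  induction n with
  | zero => intro f hf; simpa using hf
  | succ n ih => intro f hf; exact ih f (h _ (by rwa [← mul_assoc, ← pow_succ']))

lemma Reg.sup_pow {x y : A} {I : Ideal A} (h : Reg x (I ⊔ Ideal.span {y})) (hy : Reg y I) (b : ℕ) :
    Reg x (I ⊔ Ideal.span {y ^ b}) := by
  induction b with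
  | zero =>
    intro f _
    have : Ideal.span {y ^ 0} = (⊤ : Ideal A) := by simp
    rw [this]; simp
  | succ b ih =>
    intro f hf
    have h0 : I ⊔ Ideal.span {y ^ (b + 1)} ≤ I ⊔ Ideal.span {y} :=
      sup_le_sup_left ((Ideal.span_singleton_le_span_singleton).2 (dvd_pow_self y (by omega))) _
    obtain ⟨u, hu, v, hv, rfl⟩ := Submodule.mem_sup.1 (h f (h0 hf))
    obtain ⟨w, rfl⟩ := Ideal.mem_span_singleton'.1 hv
    obtain ⟨u', hu', v', hv', e⟩ := Submodule.mem_sup.1 hf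
    obtain ⟨w', rfl⟩ := Ideal.mem_span_singleton'.1 hv'
    have h1 : y * (x * w - w' * y ^ b) ∈ I := by
      have : y * (x * w - w' * y ^ b) = u' - x * u := by
        have : u' = x * (u + w * y) - w' * y ^ (b + 1) := by rw [← e]; ring
        rw [this]; ring
      rw [this]; exact sub_mem hu' (Ideal.mul_mem_left _ _ hu)
    have h2 := hy _ h1
    have h3 : x * w ∈ I ⊔ Ideal.span {y ^ b} := by
      have : x * w = (x * w - w' * y ^ b) + w' * y ^ b := by ring
      rw [this]
      exact Submodule.add_mem_sup h2 (Ideal.mem_span_singleton'.2 ⟨w', rfl⟩)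
    obtain ⟨u2, hu2, v2, hv2, e2⟩ := Submodule.mem_sup.1 (ih w h3)
    obtain ⟨w2, rfl⟩ := Ideal.mem_span_singleton'.1 hv2
    have : u + w * y = (u + y * u2) + w2 * y ^ (b + 1) := by rw [← e2]; ring
    rw [this]
    exact Submodule.add_mem_sup (add_mem hu (Ideal.mul_mem_left _ _ hu2))
      (Ideal.mem_span_singleton'.2 ⟨w2, rfl⟩)

lemma Reg.cancel_pow {z : A} {I : Ideal A} (hz : Reg z I) (a q : ℕ) {f : A}
    (h : z ^ q * f ∈ I ⊔ Ideal.span {z ^ (a + q)}) : f ∈ I ⊔ Ideal.span {z ^ a} := by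
  obtain ⟨u, hu, v, hv, e⟩ := Submodule.mem_sup.1 h
  obtain ⟨w, rfl⟩ := Ideal.mem_span_singleton'.1 hv
  have h1 : z ^ q * (f - w * z ^ a) ∈ I := by
    have : z ^ q * (f - w * z ^ a) = u := by
      rw [mul_sub, ← e]; ring
    rwa [this]
  have h2 := hz.pow q _ h1
  have : f = (f - w * z ^ a) + w * z ^ a := by ring
  rw [this]
  exact Submodule.add_mem_sup h2 (Ideal.mem_span_singleton'.2 ⟨w, rfl⟩)

end lengths

end RN2

namespace RN2

section qreg
variable {A : Type*} [CommRing A] {D : ℕ}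

lemma QReg.eq_zero [IsLocalRing A] [IsNoetherianRing A] {x : Fin D → A} (hx : QReg x)
    (hm : ∀ i, x i ∈ maximalIdeal A) (i : Fin D) {f : A} (h : x i * f = 0) : f = 0 := by
  have hJ : sp x ≤ maximalIdeal A := Ideal.span_le.2 (by rintro _ ⟨i, rfl⟩; exact hm i)
  have h1 : f ∈ ⨅ n, sp x ^ n := by
    rw [Ideal.mem_iInf]
    intro n
    exact hx.cancel_X i n f (by rw [h]; simp)
  rw [Ideal.iInf_pow_eq_bot_of_isLocalRing (sp x) (fun h => by
    rw [h, top_le_iff] at hJ; exact (maximalIdeal.isMaximal A).ne_top hJ)] at h1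
  simpa using h1

lemma map_sp {B : Type*} [CommRing B] (φ : A →+* B) (x : Fin D → A) :
    (sp x).map φ = sp (fun j => φ (x j)) := by
  rw [sp, Ideal.map_span, ← Set.range_comp]; rfl

lemma exists_lift_form {B : Type*} [CommRing B] (φ : A →+* B) (hφ : Function.Surjective φ) {n : ℕ}
    (P : MvPolynomial (Fin D) B) (hP : P.IsHomogeneous n) :
    ∃ Q : MvPolynomial (Fin D) A, Q.IsHomogeneous n ∧ MvPolynomial.map φ Q = P := by
  classical
  choose g hg using hφ
  refine ⟨∑ a ∈ P.support, MvPolynomial.monomial a (g (P.coeff a)), ?_, ?_⟩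
  · refine MvPolynomial.IsHomogeneous.sum _ _ _ fun a ha => ?_
    refine MvPolynomial.isHomogeneous_monomial _ ?_
    have := hP (MvPolynomial.mem_support_iff.1 ha)
    rwa [Finsupp.degree_eq_weight_one]
  · rw [map_sum]
    conv_rhs => rw [MvPolynomial.as_sum P]
    exact Finset.sum_congr rfl fun a _ => by rw [MvPolynomial.map_monomial, hg]

lemma QReg.quot [IsLocalRing A] [IsNoetherianRing A] {x : Fin (D + 1) → A} (hx : QReg x)
    (i : Fin (D + 1)) {B : Type*} [CommRing B] (φ : A →+* B) (hφ : Function.Surjective φ)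
    (hk : RingHom.ker φ = Ideal.span {x i}) : QReg (fun j => φ (x (i.succAbove j))) := by
  classical
  intro n P hP he
  obtain ⟨Q, hQ, rfl⟩ := exists_lift_form φ hφ P hP
  set z : Fin D → A := fun j => x (i.succAbove j) with hz
  have hzx : sp z ≤ sp x := Ideal.span_mono (by rintro _ ⟨j, rfl⟩; exact ⟨_, rfl⟩)
  have e1 : MvPolynomial.eval (fun j => φ (z j)) (MvPolynomial.map φ Q) = φ (MvPolynomial.eval z Q) := by
    rw [MvPolynomial.eval_map, MvPolynomial.eval₂_comp]; rfl
  change MvPolynomial.eval (fun j => φ (z j)) (MvPolynomial.map φ Q) ∈ sp (fun j => φ (z j)) ^ (n+1) at he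
  rw [e1, ← map_sp, ← Ideal.map_pow] at he
  obtain ⟨j, hj, hj'⟩ := (Ideal.mem_map_iff_of_surjective φ hφ).1 he
  have h1 : MvPolynomial.eval z Q - j ∈ Ideal.span {x i} := by
    rw [← hk, RingHom.mem_ker, map_sub, hj', sub_self]
  obtain ⟨h, hh⟩ := Ideal.mem_span_singleton'.1 h1
  have hjx : j ∈ sp x ^ (n + 1) := Ideal.pow_right_mono hzx _ hj
  have hzQ : MvPolynomial.eval x (MvPolynomial.rename i.succAbove Q) = MvPolynomial.eval z Q := by
    rw [MvPolynomial.eval_rename]; rfl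
  have hQ' : (MvPolynomial.rename i.succAbove Q).IsHomogeneous n := hQ.rename_isHomogeneous
  have inj : Function.Injective i.succAbove := Fin.succAbove_right_injective
  have key : ∀ a, Q.coeff a ∈ sp x := by
    intro a
    rcases n with _ | n
    · have := hx 0 _ hQ' (by
        rw [hzQ, show MvPolynomial.eval z Q = j + h * x i by rw [hh]; ring]
        refine add_mem hjx ?_
        simpa using Ideal.mul_mem_left _ h (mem_sp x i)) (a.mapDomain i.succAbove)
      rwa [MvPolynomial.coeff_rename_mapDomain _ inj] at this
    · have h2 : x i * h ∈ sp x ^ (n + 1) := by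
        rw [mul_comm, hh]
        exact sub_mem (hzQ ▸ eval_mem_pow x _ _ hQ') (Ideal.pow_le_pow_right (by omega) hjx)
      obtain ⟨H, hH, rfl⟩ := exists_form' x n h (hx.cancel_X i n h h2)
      have h3 := hx (n + 1) (MvPolynomial.rename i.succAbove Q - MvPolynomial.X i * H)
        (hQ'.sub (by rw [mul_comm]; exact hH.mul (MvPolynomial.isHomogeneous_X _ i))) (by
          rw [map_sub, hzQ, map_mul, MvPolynomial.eval_X, mul_comm, hh]
          simpa using hjx) (a.mapDomain i.succAbove)
      rw [MvPolynomial.coeff_sub, MvPolynomial.coeff_rename_mapDomain _ inj, mul_comm,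
        MvPolynomial.coeff_mul_X', if_neg, sub_zero] at h3
      · exact h3
      · rw [Finsupp.mem_support_iff, not_not]
        exact Finsupp.mapDomain_notin_range _ _ (by simp [Fin.range_succAbove])
  intro a
  rw [MvPolynomial.coeff_map]
  have h5 := Ideal.mem_map_of_mem φ (key a)
  refine (Ideal.map_le_iff_le_comap.2 ?_ : (sp x).map φ ≤ _) h5
  refine Ideal.span_le.2 ?_
  rintro _ ⟨j, rfl⟩
  rcases Fin.eq_self_or_eq_succAbove i j with rfl | ⟨l, rfl⟩
  · have : φ (x j) = 0 := by
      rw [← RingHom.mem_ker, hk]; exact Ideal.mem_span_singleton_self _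
    simp [this]
  · exact mem_sp (fun j => φ (x (i.succAbove j))) l

/-- local structure on quotients -/
lemma isLocalRing_quot [IsLocalRing A] (x : A) (hx : x ∈ maximalIdeal A) :
    IsLocalRing (A ⧸ Ideal.span {x}) := by
  have : Nontrivial (A ⧸ Ideal.span {x}) := Ideal.Quotient.nontrivial_iff.2 fun h => by
    have := (Ideal.span_singleton_le_iff_mem _).2 hx
    rw [h, top_le_iff] at this
    exact (maximalIdeal.isMaximal A).ne_top this
  exact IsLocalRing.of_surjective' (Ideal.Quotient.mk _) Ideal.Quotient.mk_surjective

lemma map_maximalIdeal {B : Type*} [CommRing B] [IsLocalRing A] [IsLocalRing B] (φ : A →+* B)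
    (hφ : Function.Surjective φ) : (maximalIdeal B).comap φ = maximalIdeal A := by
  have := Ideal.comap_isMaximal_of_surjective φ hφ (K := maximalIdeal B)
  exact IsLocalRing.eq_maximalIdeal this

/-- regularity modulo one other generator -/
lemma QReg.reg_one [IsLocalRing A] [IsNoetherianRing A] {x : Fin D → A} (hx : QReg x)
    (hm : ∀ i, x i ∈ maximalIdeal A) {i j : Fin D} (hij : i ≠ j) : Reg (x i) (Ideal.span {x j}) := by
  obtain ⟨D, rfl⟩ : ∃ E, D = E + 1 := ⟨D - 1, by have := i.2; omega⟩
  let B := A ⧸ Ideal.span {x j}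
  haveI : IsLocalRing B := isLocalRing_quot _ (hm j)
  have hq := hx.quot j (Ideal.Quotient.mk (Ideal.span {x j})) Ideal.Quotient.mk_surjective
    Ideal.mk_ker
  obtain ⟨l, rfl⟩ := Fin.exists_succAbove_eq hij
  intro f hf
  rw [← Ideal.Quotient.eq_zero_iff_mem] at hf ⊢
  rw [map_mul] at hf
  exact hq.eq_zero (A := B) (fun i => by
    have := map_maximalIdeal (Ideal.Quotient.mk (Ideal.span {x j})) Ideal.Quotient.mk_surjective
    have h := hm (j.succAbove i)
    rwa [← this] at h) l hf

lemma mem_sup_span_of_map {B : Type*} [CommRing B] (φ : A →+* B) (hφ : Function.Surjective φ)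
    {I K : Ideal A} (hk : RingHom.ker φ = K) {f : A} (h : φ f ∈ I.map φ) : f ∈ K ⊔ I := by
  rw [Ideal.mem_map_iff_of_surjective φ hφ] at h
  obtain ⟨g, hg, e⟩ := h
  have : f = (f - g) + g := by ring
  rw [this]
  refine Submodule.add_mem_sup ?_ hg
  rw [← hk, RingHom.mem_ker, map_sub, e, sub_self]

lemma QReg.reg_two [IsLocalRing A] [IsNoetherianRing A] {x : Fin D → A} (hx : QReg x)
    (hm : ∀ i, x i ∈ maximalIdeal A) {i j l : Fin D} (hij : i ≠ j) (hil : i ≠ l) (hlj : l ≠ j) :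
    Reg (x i) (Ideal.span {x j} ⊔ Ideal.span {x l}) := by
  obtain ⟨D, rfl⟩ : ∃ E, D = E + 1 := ⟨D - 1, by have := i.2; omega⟩
  let B := A ⧸ Ideal.span {x j}
  haveI : IsLocalRing B := isLocalRing_quot _ (hm j)
  have hq := hx.quot j (Ideal.Quotient.mk (Ideal.span {x j})) Ideal.Quotient.mk_surjective
    Ideal.mk_ker
  obtain ⟨i, rfl⟩ := Fin.exists_succAbove_eq hij
  obtain ⟨l, rfl⟩ := Fin.exists_succAbove_eq hlj
  have hr := hq.reg_one (A := B) (fun i => by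
    have := map_maximalIdeal (Ideal.Quotient.mk (Ideal.span {x j})) Ideal.Quotient.mk_surjective
    have h := hm (j.succAbove i)
    rwa [← this] at h) (i := i) (j := l) (fun h => hil (by rw [h]))
  intro f hf
  refine mem_sup_span_of_map (Ideal.Quotient.mk (Ideal.span {x j})) Ideal.Quotient.mk_surjective
    Ideal.mk_ker ?_
  rw [Ideal.map_span, Set.image_singleton]
  refine hr _ ?_
  rw [← map_mul]
  have := Ideal.mem_map_of_mem (Ideal.Quotient.mk (Ideal.span {x j})) hf
  rw [Ideal.map_sup, Ideal.map_quotient_self, bot_sup_eq, Ideal.map_span, Set.image_singleton] at this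
  exact this

end qreg

lemma ln_pow (D : ℕ) : ∀ (A : Type*) [CommRing A] [IsLocalRing A] [IsNoetherianRing A]
    (x : Fin D → A) (_ : QReg x) (_ : ∀ i, x i ∈ maximalIdeal A) (n : ℕ),
    ln (sp x ^ (n + 1)) = ((n + D).choose D : ℕ) * ln (sp x) := by
  induction D with
  | zero =>
    intro A _ _ _ x hx hm n
    have : sp x = ⊥ := by simp [sp]
    rw [this, pow_succ, Ideal.mul_bot, Nat.choose_zero_right]; simp
  | succ D ih =>
    intro A _ _ _ x hx hm n
    induction n with
    | zero => simp
    | succ n ihn =>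
      set l := Fin.last D
      let B := A ⧸ Ideal.span {x l}
      haveI : IsLocalRing B := isLocalRing_quot _ (hm l)
      let φ : A →+* B := Ideal.Quotient.mk (Ideal.span {x l})
      have hφ : Function.Surjective φ := Ideal.Quotient.mk_surjective
      have hk : RingHom.ker φ = Ideal.span {x l} := Ideal.mk_ker
      have hq := hx.quot l φ hφ hk
      have h1 := ih B _ hq (fun i => by
        have := map_maximalIdeal φ hφ
        have h := hm (l.succAbove i)
        rwa [← this] at h)
      have h0 : (sp x).map φ = sp (fun j => φ (x (l.succAbove j))) := by
        rw [map_sp]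
        refine le_antisymm (Ideal.span_le.2 ?_) (Ideal.span_mono ?_)
        · rintro _ ⟨j, rfl⟩
          rcases Fin.eq_self_or_eq_succAbove l j with rfl | ⟨l, rfl⟩
          · have : φ (x l) = 0 := by
              rw [← RingHom.mem_ker, hk]; exact Ideal.mem_span_singleton_self _
            simp [this]
          · exact mem_sp (fun j => φ (x (Fin.succAbove _ j))) l
        · rintro _ ⟨j, rfl⟩; exact ⟨_, rfl⟩
      have h2 : ∀ m, ln (sp x ^ (m + 1) ⊔ Ideal.span {x l}) = ((m + D).choose D : ℕ) * ln (sp x) := by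
        have h3 : ∀ m, ln (sp x ^ (m + 1) ⊔ Ideal.span {x l}) =
            ln (sp (fun j => φ (x (l.succAbove j))) ^ (m + 1)) := by
          intro m
          rw [← ln_comap φ hφ, ← h0, ← Ideal.map_pow, Ideal.comap_map_of_surjective' φ hφ, hk]
        intro m
        have h4 := h3 0
        rw [zero_add, pow_one, pow_one, sup_eq_left.2] at h4
        · rw [h3, h1, h4]
        · rw [Ideal.span_singleton_le_iff_mem]; exact mem_sp x l
      have h5 : cdiv (sp x ^ (n + 1 + 1)) (x l) = sp x ^ (n + 1) := by
        ext f
        rw [mem_cdiv]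
        refine ⟨hx.cancel_X l (n + 1) f, fun h => ?_⟩
        rw [pow_succ']; exact Ideal.mul_mem_mul (mem_sp x l) h
      rw [ln_colon _ (x l), h5, h2, ihn, ← add_mul]
      congr 1
      norm_cast
      rw [show n + 1 + (D + 1) = (n + 1 + D) + 1 by ring, Nat.choose_succ_succ,
        show n + (D + 1) = n + 1 + D by ring]

end RN2

namespace RN2

section zed
variable {A : Type*} [CommRing A] {D : ℕ}

/-- the closure filtration is cofinal with linear shift -/
def FIN (J : Ideal A) : Prop := ∃ k0, ∀ n, F J (n + k0) ≤ J ^ n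

lemma div_aux (I : Ideal A) {p q : Fin D} (hpq : p ≠ q) (k j m : ℕ) (c : ℕ → A) (hc : c 0 = 1)
    (P : ℕ → MvPolynomial (Fin D) A)
    (H : ∀ l, l + j ≤ m → ∀ e, (∑ i ∈ Finset.range (j + 1),
      MvPolynomial.monomial (Finsupp.single q (k * (j - i)) + Finsupp.single p (k * i)) (c i) *
        P (l + i)).coeff e ∈ I) :
    ∀ r l, l + r = m → ∀ e : Fin D →₀ ℕ, e p < k * (m + 1 - j - l) → (P l).coeff e ∈ I := by
  classical
  intro r
  induction r using Nat.strong_induction_on with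
  | _ r ih =>
    intro l hl e he
    by_cases hlj : l + j ≤ m
    swap
    · rw [show m + 1 - j - l = 0 by omega] at he; omega
    have h1 := H l hlj (e + Finsupp.single q (k * j))
    rw [MvPolynomial.coeff_sum, Finset.sum_range_succ'] at h1
    have h2 : (MvPolynomial.coeff (e + Finsupp.single q (k * j))
        (MvPolynomial.monomial (Finsupp.single q (k * (j - 0)) + Finsupp.single p (k * 0)) (c 0) *
          P (l + 0))) = (P l).coeff e := by
      rw [add_comm e, hc]
      simp [MvPolynomial.coeff_monomial_mul]
    rw [h2] at h1
    refine (Submodule.add_mem_iff_right _ (Ideal.sum_mem _ fun i hi => ?_)).1 h1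
    rw [MvPolynomial.coeff_monomial_mul']
    split_ifs with hle
    swap
    · exact zero_mem _
    refine Ideal.mul_mem_left _ _ ?_
    have hi : i < j := by simpa using hi
    refine ih (m - (l + (i + 1))) (by omega) (l + (i + 1)) (by omega) _ ?_
    have h3 := hle p
    simp only [Finsupp.add_apply, Finsupp.single_eq_same, Finsupp.single_eq_of_ne hpq,
      Finsupp.tsub_apply, zero_add, add_zero] at h3 ⊢
    by_cases hb : l + (i + 1) + j ≤ m + 1
    · have : k * (m + 1 - j - l) = k * (m + 1 - j - (l + (i + 1))) + k * (i + 1) := by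
        rw [← mul_add]; congr 1; omega
      omega
    · exfalso
      have : k * (m + 1 - j - l) ≤ k * (i + 1) := Nat.mul_le_mul_left _ (by omega)
      omega

lemma improve {x : Fin D → A} (hx : QReg x) {p q : Fin D} (hpq : p ≠ q) (k j m N : ℕ) (hj : j ≤ m)
    (u : ℕ → A) (c : ℕ → A) (hc : c 0 = 1) (hcj : IsUnit (c j))
    (hu : ∀ l ≤ m, u l ∈ sp x ^ N)
    (H : ∀ l, l + j ≤ m → ∑ i ∈ Finset.range (j + 1),
      c i * (x q ^ (k * (j - i)) * x p ^ (k * i)) * u (l + i) ∈ sp x ^ (N + k * j + 1))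
    (hN : N + 2 * (k * j) < k * (m + 2)) : ∀ l ≤ m, u l ∈ sp x ^ (N + 1) := by
  classical
  have : ∀ l, ∃ P : MvPolynomial (Fin D) A, P.IsHomogeneous N ∧ (l ≤ m → MvPolynomial.eval x P = u l) := by
    intro l
    by_cases hl : l ≤ m
    · obtain ⟨P, h1, h2⟩ := exists_form' x N _ (hu l hl)
      exact ⟨P, h1, fun _ => h2⟩
    · exact ⟨0, MvPolynomial.isHomogeneous_zero _ _ _, fun h => absurd h hl⟩
  choose P hP hPu using this
  have H1 : ∀ l, l + j ≤ m → ∀ e, (∑ i ∈ Finset.range (j + 1),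
      MvPolynomial.monomial (Finsupp.single q (k * (j - i)) + Finsupp.single p (k * i)) (c i) *
        P (l + i)).coeff e ∈ sp x := by
    intro l hl
    refine hx (N + k * j) _ ?_ ?_
    · refine MvPolynomial.IsHomogeneous.sum _ _ _ fun i hi => ?_
      have hi : i ≤ j := by simpa [Nat.lt_succ_iff] using hi
      have h1 : (MvPolynomial.monomial (Finsupp.single q (k * (j - i)) + Finsupp.single p (k * i)) (c i)).IsHomogeneous (k * j) := by
        refine MvPolynomial.isHomogeneous_monomial _ ?_
        rw [map_add, Finsupp.degree_single, Finsupp.degree_single, ← mul_add, Nat.sub_add_cancel hi]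
      have h2 := h1.mul (hP (l + i))
      rwa [add_comm (k * j) N] at h2
    · rw [map_sum]
      convert H l hl using 2 with i hi
      have hi : i ≤ j := by simpa [Nat.lt_succ_iff] using hi
      rw [map_mul, hPu _ (by omega), MvPolynomial.eval_monomial, Finsupp.prod_add_index' (by simp) (by intros; rw [pow_add]),
        Finsupp.prod_single_index (by simp), Finsupp.prod_single_index (by simp)]
  have D1 := div_aux (sp x) hpq k j m c hc P H1
  obtain ⟨v, hv⟩ := hcj
  have D2 := div_aux (sp x) hpq.symm k j m (fun i => ↑v⁻¹ * c (j - i)) (by simp [← hv])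
    (fun l => P (m - l)) (by
      intro l hl e
      have h1 := Ideal.mul_mem_left _ (↑v⁻¹ : A) (H1 (m - l - j) (by omega) e)
      convert h1 using 1
      rw [← MvPolynomial.coeff_C_mul, Finset.mul_sum, ← Finset.sum_range_reflect]
      congr 1
      refine Finset.sum_congr rfl fun i hi => ?_
      have hi : i ≤ j := by simpa [Nat.lt_succ_iff] using hi
      rw [show j + 1 - 1 - i = j - i by omega, show j - (j - i) = i by omega,
        show m - (l + (j - i)) = m - l - j + i by omega, ← mul_assoc, MvPolynomial.C_mul_monomial,
        add_comm (Finsupp.single p _)])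
  intro l hl
  rw [← hPu l hl, pow_succ']
  refine eval_mem_of_coeff x _ N (P l) (hP l) fun e => ?_
  by_cases he : (P l).coeff e = 0
  · rw [he]; exact zero_mem _
  have hdeg : e p + e q ≤ N := by
    have h1 := hP l he
    have h' : e.degree = N := by rwa [Finsupp.degree_eq_weight_one]
    rw [Finsupp.degree_eq_sum] at h'
    rw [← h']
    calc e p + e q = ∑ i ∈ ({p, q} : Finset (Fin D)), e i := by rw [Finset.sum_pair hpq]
      _ ≤ _ := Finset.sum_le_sum_of_subset (by simp)
  by_cases h1 : e p < k * (m + 1 - j - l)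
  · exact D1 (m - l) l (by omega) e h1
  · by_cases h2 : e q < k * (m + 1 - j - (m - l))
    · have := D2 l (m - l) (by omega) e h2
      simpa [show m - (m - l) = l by omega] using this
    · exfalso
      push Not at h1 h2
      have h3 : k * (m + 2) ≤ k * (m + 1 - j - l) + k * (m + 1 - j - (m - l)) + 2 * (k * j) := by
        rw [← mul_add, show 2 * (k * j) = k * (2 * j) by ring, ← mul_add]
        exact Nat.mul_le_mul_left _ (by omega)
      omega

lemma z0_step {x : Fin D → A} (hx : QReg x) {p q : Fin D} (hpq : p ≠ q) {k0 : ℕ}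
    (hfin : ∀ n, F (sp x) (n + k0) ≤ sp x ^ n) (k j m M : ℕ) (hj : j ≤ m) (a b : A)
    (he : a * x q ^ k - b * x p ^ k ∈ F (sp x) (2 * k))
    (hM : ∀ l ≤ m - j, a ^ (m - j - l) * b ^ l ∈ sp x ^ M) :
    ∀ N, N + k0 ≤ M + k * j → N + 2 * (k * j) ≤ k * (m + 2) →
      ∀ l ≤ m, a ^ (m - l) * b ^ l ∈ sp x ^ N := by
  intro N
  induction N with
  | zero => intro _ _ l _; simp
  | succ N ih =>
    intro h1 h2
    refine improve hx hpq k j m N hj (fun l => a ^ (m - l) * b ^ l)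
      (fun i => (-1) ^ i * (j.choose i : A)) (by simp) (by simpa using (isUnit_one (M := A)).neg.pow j) (ih (by omega) (by omega)) ?_ (by omega)
    intro l hl
    have h3 : (a * x q ^ k - b * x p ^ k) ^ j ∈ sp x ^ (2 * (k * j) - k0) := by
      rcases le_total k0 (2 * (k * j)) with h | h
      · refine hfin _ ?_
        rw [Nat.sub_add_cancel h, show 2 * (k * j) = j * (2 * k) by ring]
        exact F_pow_mem _ he j
      · rw [Nat.sub_eq_zero_of_le h]; simp
    have h4 := Ideal.mul_mem_mul h3 (hM l (by omega))
    rw [← pow_add] at h4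
    have h5 := Ideal.pow_le_pow_right (show N + k * j + 1 ≤ 2 * (k * j) - k0 + M by omega) h4
    convert h5 using 1
    rw [sub_eq_neg_add, (Commute.all _ _).add_pow, Finset.sum_mul]
    refine Finset.sum_congr rfl fun i hi => ?_
    have hi : i ≤ j := by simpa [Nat.lt_succ_iff] using hi
    have e1 : a ^ (m - (l + i)) = a ^ (j - i) * a ^ (m - j - l) := by
      rw [← pow_add]; congr 1; omega
    rw [e1, neg_pow, pow_mul, pow_mul]
    simp only [mul_pow, pow_add]
    ring

/-- the degree zero syzygy statement -/
lemma Z0 {x : Fin D → A} (hx : QReg x) {p q : Fin D} (hpq : p ≠ q) (hfin : FIN (sp x)) (k : ℕ) (a b : A)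
    (he : a * x q ^ k - b * x p ^ k ∈ F (sp x) (2 * k)) : a ∈ F (sp x) k := by
  obtain ⟨k0, hfin⟩ := hfin
  have key : ∀ j n N, N + n * k0 + 2 * (k * j) ≤ k * j * n → ∀ l ≤ j * n,
      a ^ (j * n - l) * b ^ l ∈ sp x ^ N := by
    intro j n
    induction n with
    | zero =>
      intro N hN
      have : N = 0 := by simp at hN; omega
      subst this
      simp
    | succ n ih =>
      intro N hN
      have e1 : k * j * (n + 1) = k * j * n + k * j := by ring
      have e2 : (n + 1) * k0 = n * k0 + k0 := by ring
      have e3 : k * (j * (n + 1) + 2) = k * j * n + k * j + 2 * k := by ring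
      have e4 : j * (n + 1) = j * n + j := by ring
      refine z0_step hx hpq hfin k j (j * (n + 1)) (k * j * n - n * k0 - 2 * (k * j)) (by omega) a b he ?_ N
        (by omega) (by omega)
      intro l hl
      rw [show j * (n + 1) - j = j * n by omega] at hl ⊢
      by_cases hc : n * k0 + 2 * (k * j) ≤ k * j * n
      · exact ih _ (by omega) l hl
      · rw [show k * j * n - n * k0 - 2 * (k * j) = 0 by omega]; simp
  have key2 : ∀ s, a ^ s ∈ F (sp x) (s * k - 1) := by
    intro s
    rcases Nat.eq_zero_or_pos (s * k) with h0 | h0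
    · rw [h0, Nat.zero_sub, F_zero]; trivial
    refine F_root (s := k0 + 1) _ (Nat.succ_pos _) (mem_F.2 ⟨2 * (k * (s * (k0 + 1))), fun i n hi => ?_⟩)
    rw [← pow_mul, ← pow_mul]
    have := key (s * (k0 + 1)) n i (by
      obtain ⟨w, hw⟩ : ∃ w, s * k = w + 1 := ⟨s * k - 1, by omega⟩
      rw [hw] at hi
      have e1 : k * (s * (k0 + 1)) * n = (k0 + 1) * (w + 1 - 1) * n + n * k0 + n := by
        rw [show k * (s * (k0 + 1)) * n = (s * k) * (k0 + 1) * n by ring, hw]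
        simp; ring
      omega) 0 (Nat.zero_le _)
    simpa [mul_assoc] using this
  refine mem_F.2 ⟨k0 + 1, fun i s hi => hfin i (F_anti _ ?_ (key2 s))⟩
  rw [mul_comm] at hi
  omega

end zed
end RN2

namespace RN2

section cutconstruct
variable (A : Type*) [CommRing A] [IsLocalRing A] [IsNoetherianRing A] (e : ℕ)

/-- extension of the maximal ideal to the polynomial ring -/
noncomputable def mE : Ideal (MvPolynomial (Fin e) A) := (maximalIdeal A).map MvPolynomial.C

variable {A e}
lemma mem_mE (p : MvPolynomial (Fin e) A) : p ∈ mE A e ↔ ¬ Prim p := by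
  unfold mE Prim
  rw [MvPolynomial.mem_map_C_iff]; push Not; rfl

instance mE_prime : (mE A e).IsPrime := by
  rw [Ideal.isPrime_iff]
  constructor
  · rw [Ne, Ideal.eq_top_iff_one, mem_mE, not_not]; exact Prim.one
  · intro p q h
    by_contra! hc
    simp only [mem_mE, not_not] at hc h
    exact h (hc.1.mul hc.2)

variable (A e)
/-- the Nagata type extension -/
abbrev SS := Localization.AtPrime (mE A e)

variable {A e}
/-- the polynomial ring inside the Nagata extension -/
noncomputable def io : MvPolynomial (Fin e) A →+* SS A e := algebraMap _ _
/-- base ring inside the Nagata extension -/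
noncomputable def co : A →+* SS A e := algebraMap _ _

lemma io_C (a : A) : io (e := e) (MvPolynomial.C a) = co a := by
  unfold io co
  rw [IsScalarTower.algebraMap_apply A (MvPolynomial (Fin e) A) (SS A e)]
  rfl

lemma co_eq : (co : A →+* SS A e) = io.comp MvPolynomial.C := by
  ext a; exact (io_C a).symm

lemma io_unit {P : MvPolynomial (Fin e) A} (hP : Prim P) : IsUnit (io P) :=
  IsLocalization.map_units (SS A e) (⟨P, fun h => (mem_mE P).1 h hP⟩ : (mE A e).primeCompl)

lemma io_surj (s : SS A e) : ∃ P p, Prim P ∧ io P * s = io p := by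
  obtain ⟨⟨p, P⟩, h⟩ := IsLocalization.surj (mE A e).primeCompl s
  refine ⟨P, p, ?_, by rw [mul_comm]; exact h⟩
  by_contra hc
  exact P.2 ((mem_mE _).2 hc)

lemma io_mem_map (a : Ideal A) (p : MvPolynomial (Fin e) A) :
    io p ∈ a.map co ↔ ∀ i, p.coeff i ∈ a := by
  rw [co_eq, ← Ideal.map_map]
  unfold io
  rw [IsLocalization.algebraMap_mem_map_algebraMap_iff (mE A e).primeCompl]
  simp only [MvPolynomial.mem_map_C_iff]
  constructor
  · rintro ⟨P, hP, h⟩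
    refine prim_cancel P p ?_ a h
    by_contra hc
    exact hP ((mem_mE _).2 hc)
  · intro h
    exact ⟨1, Submonoid.one_mem _, by simpa using h⟩

lemma co_mem_map (a : Ideal A) (r : A) : co (e := e) r ∈ a.map (co (e := e)) ↔ r ∈ a := by
  classical
  rw [← io_C, io_mem_map]
  constructor
  · intro h; simpa using h 0
  · intro h i; rw [MvPolynomial.coeff_C]; split_ifs
    · exact h
    · exact zero_mem _

lemma max_SS : maximalIdeal (SS A e) = (maximalIdeal A).map co := by
  have := Localization.AtPrime.map_eq_maximalIdeal (I := mE A e)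
  rw [← this, co_eq, ← Ideal.map_map]; rfl

lemma mem_unit_mul {B : Type*} [CommRing B] (I : Ideal B) {u b : B} (hu : IsUnit u) :
    u * b ∈ I ↔ b ∈ I := by
  exact Ideal.unit_mul_mem_iff_mem I hu

lemma ln_co (a : Ideal A) : ln (a.map (co (e := e))) = ln a := by
  haveI : IsLocalHom (algebraMap A (SS A e)) := by
    constructor
    intro r hr
    by_contra h
    have h1 : r ∈ maximalIdeal A := h
    have h2 : co (e := e) r ∈ maximalIdeal (SS A e) := by
      rw [max_SS]; exact Ideal.mem_map_of_mem _ h1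
    exact h2 hr
  haveI : Module.Flat A (SS A e) := Module.Flat.trans A (MvPolynomial (Fin e) A) (SS A e)
  have h := IsLocalRing.length_baseChange A (SS A e) (A ⧸ a)
  have h1 : Module.length (SS A e) (SS A e ⧸ (maximalIdeal A).map (algebraMap A (SS A e))) = 1 := by
    rw [Module.length_eq_one_iff]
    have : (maximalIdeal A).map (algebraMap A (SS A e)) = maximalIdeal _ := max_SS.symm
    rw [this]
    rw [isSimpleModule_iff_isCoatom]
    exact (maximalIdeal.isMaximal (SS A e)).out
  rw [h1, mul_one] at h
  exact (LinearEquiv.length_eq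
    (Algebra.TensorProduct.quotIdealMapEquivTensorQuot (SS A e) a).toLinearEquiv).trans h

lemma map_colon (J : Ideal A) (f : SS A e) :
    (∀ g ∈ maximalIdeal (SS A e), f * g ∈ J.map co) ↔
      f ∈ (J.colon (maximalIdeal A : Set A)).map co := by
  obtain ⟨P, p, hP, h⟩ := io_surj f
  rw [← mem_unit_mul _ (io_unit hP), h, io_mem_map]
  constructor
  · intro hf i
    rw [Submodule.mem_colon]
    intro a ha
    have h1 := hf (co a) (by rw [max_SS]; exact Ideal.mem_map_of_mem _ ha)
    rw [← mem_unit_mul _ (io_unit hP), ← mul_assoc, h, ← io_C, ← map_mul, io_mem_map] at h1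
    have := h1 i
    rwa [mul_comm, MvPolynomial.coeff_C_mul, mul_comm] at this
  · intro hf g hg
    rw [max_SS] at hg
    rw [← mem_unit_mul _ (io_unit hP), ← mul_assoc, h]
    refine Submodule.span_induction (p := fun g _ => io p * g ∈ J.map co) ?_ ?_ ?_ ?_ hg
    · rintro _ ⟨a, ha, rfl⟩
      rw [← io_C, ← map_mul, io_mem_map]
      intro i
      rw [mul_comm, MvPolynomial.coeff_C_mul, mul_comm]
      exact Submodule.mem_colon.1 (hf i) a ha
    · simp
    · intro x y _ _ hx hy; rw [mul_add]; exact add_mem hx hy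
    · intro a x _ hx; rw [smul_eq_mul, mul_left_comm]; exact Ideal.mul_mem_left _ _ hx

lemma descent {ι : Type*} (a : ι → Ideal A) (v u : ι → A) (r : SS A e)
    (h : ∀ i, co (v i) - r * co (u i) ∈ (a i).map co) : ∃ r : A, ∀ i, v i - r * u i ∈ a i := by
  obtain ⟨P, p, hP, hr⟩ := io_surj r
  have hP' := hP
  obtain ⟨k, hk⟩ := hP
  have hu : IsUnit (P.coeff k) := by simpa using hk
  obtain ⟨w, hw⟩ := hu
  refine ⟨↑w⁻¹ * p.coeff k, fun i => ?_⟩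
  have h1 := h i
  rw [← mem_unit_mul _ (io_unit hP'), mul_sub, ← mul_assoc, hr, ← io_C, ← io_C, ← map_mul, ← map_mul,
    ← map_sub, io_mem_map] at h1
  have h2 := h1 k
  rw [MvPolynomial.coeff_sub, mul_comm P, mul_comm p, MvPolynomial.coeff_C_mul, MvPolynomial.coeff_C_mul, ← hw] at h2
  have h3 := Ideal.mul_mem_left _ (↑w⁻¹ : A) h2
  convert h3 using 1
  rw [mul_sub, mul_comm (v i), ← mul_assoc, Units.inv_mul]
  ring

lemma F_map_le {B C : Type*} [CommRing B] [CommRing C] (φ : B →+* C) (J : Ideal B) (n : ℕ) :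
    (F J n).map φ ≤ F (J.map φ) n := by
  rw [Ideal.map_le_iff_le_comap]
  intro f hf
  obtain ⟨k, hk⟩ := mem_F.1 hf
  refine mem_F.2 ⟨k, fun i j hij => ?_⟩
  rw [← map_pow, ← Ideal.map_pow]
  exact Ideal.mem_map_of_mem _ (hk i j hij)

lemma F_co_aux (J : Ideal A) (n : ℕ) (s : ℕ) : ∀ p : MvPolynomial (Fin e) A, p.support.card = s →
    io p ∈ F (J.map co) n → ∀ i, p.coeff i ∈ F J n := by
  classical
  induction s with
  | zero =>
    intro p hp _ i
    have : p = 0 := by simpa using hp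
    simp [this]
  | succ s ih =>
    intro p hp hf
    set d := MonomialOrder.lex.degree p with hd
    have hp0 : p ≠ 0 := by rintro rfl; simp at hp
    have hlc : p.coeff d ∈ F J n := by
      obtain ⟨k, hk⟩ := mem_F.1 hf
      refine mem_F.2 ⟨k, fun i j hij => ?_⟩
      have h1 := hk i j hij
      rw [← map_pow, ← Ideal.map_pow, io_mem_map] at h1
      have h2 := h1 (j • d)
      rwa [hd, MonomialOrder.coeff_pow_nsmul_degree] at h2
    have hds : d ∈ p.support := MonomialOrder.degree_mem_support hp0
    set p' := p - MvPolynomial.monomial d (p.coeff d) with hp'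
    have hco : ∀ i, p'.coeff i = if i = d then 0 else p.coeff i := by
      intro i
      rw [hp', MvPolynomial.coeff_sub, MvPolynomial.coeff_monomial]
      by_cases h : i = d
      · simp [h]
      · simp [h, Ne.symm h]
    have hsup : p'.support = p.support.erase d := by
      ext i
      simp only [MvPolynomial.mem_support_iff, Finset.mem_erase, hco]
      by_cases h : i = d <;> simp [h]
    have h3 := ih p' (by rw [hsup, Finset.card_erase_of_mem hds, hp]; simp) (by
      rw [hp', map_sub]
      refine sub_mem hf (F_map_le _ _ _ ((io_mem_map _ _).2 fun i => ?_))
      rw [MvPolynomial.coeff_monomial]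
      split_ifs
      · exact hlc
      · exact zero_mem _)
    intro i
    by_cases h : i = d
    · rw [h]; exact hlc
    · have := h3 i
      rwa [hco, if_neg h] at this

lemma F_co (J : Ideal A) (n : ℕ) : F (J.map (co (e := e))) n = (F J n).map co := by
  refine le_antisymm (fun f hf => ?_) (F_map_le _ _ _)
  obtain ⟨P, p, hP, h⟩ := io_surj f
  rw [← mem_unit_mul _ (io_unit hP), h] at hf ⊢
  rw [io_mem_map]
  exact F_co_aux J n _ p rfl hf

end cutconstruct
end RN2

namespace RN2

section qregS
variable {A : Type*} [CommRing A] [IsLocalRing A] [IsNoetherianRing A] {e D : ℕ}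

lemma map_sp' {B : Type*} [CommRing B] (φ : A →+* B) (y : Fin D → A) :
    (sp y).map φ = sp (fun i => φ (y i)) := by
  rw [Ideal.map_span, ← Set.range_comp]; rfl

/-- coefficient extraction of a form over a polynomial ring -/
lemma eval_coeff (y : Fin D → A) (P : MvPolynomial (Fin D) (MvPolynomial (Fin e) A)) (k : Fin e →₀ ℕ) :
    (MvPolynomial.eval (fun i => MvPolynomial.C (y i)) P).coeff k =
      MvPolynomial.eval y (∑ a ∈ P.support, MvPolynomial.monomial a ((P.coeff a).coeff k)) := by
  rw [MvPolynomial.eval_eq, map_sum, MvPolynomial.coeff_sum]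
  refine Finset.sum_congr rfl fun a _ => ?_
  rw [MvPolynomial.eval_monomial, Finsupp.prod]
  simp_rw [← map_pow]
  rw [← map_prod, mul_comm, MvPolynomial.coeff_C_mul, mul_comm]

lemma QReg.co {y : Fin D → A} (hy : QReg y) : QReg (fun i => co (e := e) (y i)) := by
  classical
  intro n P hP hev
  -- clear denominators
  have : ∀ s : Finset (Fin D →₀ ℕ), ∃ Q : MvPolynomial (Fin e) A, Prim Q ∧
      ∀ a ∈ s, ∃ p, io Q * P.coeff a = io p := by
    intro s
    induction s using Finset.induction_on with
    | empty => exact ⟨1, Prim.one, by simp⟩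
    | insert a s ha ih =>
      obtain ⟨Q, hQ, h⟩ := ih
      obtain ⟨Q', p', hQ', h'⟩ := io_surj (P.coeff a)
      refine ⟨Q * Q', hQ.mul hQ', ?_⟩
      intro b hb
      rcases Finset.mem_insert.1 hb with rfl | hb
      · exact ⟨Q * p', by rw [map_mul, map_mul, mul_assoc, h']⟩
      · obtain ⟨p, hp⟩ := h b hb
        exact ⟨Q' * p, by rw [map_mul, map_mul, mul_right_comm, hp, mul_comm]⟩
  obtain ⟨Q, hQ, h⟩ := this P.support
  have h' : ∀ a, ∃ p, io Q * P.coeff a = io p ∧ (a ∉ P.support → p = 0) := by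
    intro a
    by_cases ha : a ∈ P.support
    · obtain ⟨p, hp⟩ := h a ha
      exact ⟨p, hp, fun h => absurd ha h⟩
    · exact ⟨0, by rw [MvPolynomial.notMem_support_iff.1 ha]; simp, fun _ => rfl⟩
  choose p hp hp0 using h'
  set P' : MvPolynomial (Fin D) (MvPolynomial (Fin e) A) :=
    ∑ a ∈ P.support, MvPolynomial.monomial a (p a) with hP'
  have hco : ∀ a, P'.coeff a = p a := by
    intro a
    rw [hP', MvPolynomial.coeff_sum]
    simp only [MvPolynomial.coeff_monomial, Finset.sum_ite_eq']
    split_ifs with ha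
    · rfl
    · exact (hp0 a ha).symm
  have hmap : MvPolynomial.map io P' = MvPolynomial.C (io Q) * P := by
    ext a
    rw [MvPolynomial.coeff_map, hco, MvPolynomial.coeff_C_mul, hp]
  have hhom : ∀ a, p a ≠ 0 → a.degree = n := by
    intro a ha
    have : P.coeff a ≠ 0 := fun h0 => ha (hp0 a (by simpa using h0))
    have := hP this
    rwa [Finsupp.degree_eq_weight_one]
  have h1 : io (MvPolynomial.eval (fun i => MvPolynomial.C (y i)) P') ∈ (sp y ^ (n + 1)).map RN2.co := by
    have e1 : io (MvPolynomial.eval (fun i => MvPolynomial.C (y i)) P') =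
        io Q * MvPolynomial.eval (fun i => RN2.co (e := e) (y i)) P := by
      rw [← MvPolynomial.eval_C (f := fun i => RN2.co (e := e) (y i)) (io Q), ← map_mul, ← hmap,
        MvPolynomial.eval_map, MvPolynomial.eval₂_eq, MvPolynomial.eval_eq, map_sum]
      refine Finset.sum_congr rfl fun a _ => ?_
      rw [map_mul, map_prod]
      simp_rw [map_pow, io_C]
    rw [e1, Ideal.map_pow, map_sp']
    exact Ideal.mul_mem_left _ _ hev
  rw [io_mem_map] at h1
  have h2 : ∀ a k, (p a).coeff k ∈ sp y := by
    intro a k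
    have h3 := h1 k
    rw [eval_coeff] at h3
    have h4 := hy n _ (by
      refine MvPolynomial.IsHomogeneous.sum _ _ _ fun b _ => ?_
      by_cases hb : p b = 0
      · rw [hco, hb]; simp [MvPolynomial.isHomogeneous_zero]
      · exact MvPolynomial.isHomogeneous_monomial _ (hhom b hb)) h3 a
    rw [MvPolynomial.coeff_sum] at h4
    simp only [MvPolynomial.coeff_monomial, Finset.sum_ite_eq'] at h4
    split_ifs at h4 with ha
    · rwa [hco] at h4
    · have : p a = 0 := by rw [← hco]; simpa using ha
      simp [this]
  intro a
  rw [← mem_unit_mul _ (io_unit hQ), hp, ← map_sp', io_mem_map]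
  exact h2 a

end qregS

section subst
variable {A : Type*} [CommRing A] {D : ℕ}

lemma coeff_mem_iff {σ : Type*} (I : Ideal A) (P : MvPolynomial σ A) :
    (∀ a, P.coeff a ∈ I) ↔ MvPolynomial.map (Ideal.Quotient.mk I) P = 0 := by
  rw [MvPolynomial.ext_iff]
  simp [MvPolynomial.coeff_map, Ideal.Quotient.eq_zero_iff_mem]

/-- invertible linear substitutions preserve quasi-regularity -/
lemma QReg.subst {x z : Fin D → A} (hx : QReg x) (L M : Fin D → MvPolynomial (Fin D) A)
    (hL : ∀ i, (L i).IsHomogeneous 1) (hxz : ∀ i, z i = MvPolynomial.eval x (L i))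
    (hML : ∀ i, MvPolynomial.bind₁ M (L i) = MvPolynomial.X i)
    (hsp : sp x = sp z) : QReg z := by
  intro n P hP hev
  have e1 : MvPolynomial.eval z P = MvPolynomial.eval x (MvPolynomial.bind₁ L P) := by
    have := MvPolynomial.ringHom_ext (f := MvPolynomial.eval z)
      (g := (MvPolynomial.eval x).comp (MvPolynomial.bind₁ L : _ →ₐ[A] MvPolynomial (Fin D) A).toRingHom)
      (by simp) (by intro i; simp [hxz])
    exact congrArg (fun φ : MvPolynomial (Fin D) A →+* A => φ P) this
  have h2 : (MvPolynomial.bind₁ L P).IsHomogeneous n := by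
    have := hP.aeval L hL
    simpa using this
  have h3 := hx n _ h2 (by rw [← e1, hsp]; exact hev)
  rw [← hsp, coeff_mem_iff]
  rw [coeff_mem_iff] at h3
  have h4 : MvPolynomial.bind₁ M (MvPolynomial.bind₁ L P) = P := by
    rw [MvPolynomial.bind₁_bind₁]
    simp_rw [hML]
    simp
  rw [← h4, MvPolynomial.map_bind₁, h3, map_zero]

end subst
end RN2

namespace RN2

section hom
variable {U : Type*} [CommRing U]

/-- value of the homogenization of a univariate polynomial -/
noncomputable def hm (w u : U) (q : ℕ) (p : U[X]) : U := MvPolynomial.eval ![w, u] (p.homogenize q)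

lemma hm_eq (w u : U) (q : ℕ) (p : U[X]) :
    hm w u q p = ∑ l ∈ HasAntidiagonal.antidiagonal q, p.coeff l.1 * w ^ l.1 * u ^ l.2 := by
  unfold hm Polynomial.homogenize
  rw [map_sum]
  refine Finset.sum_congr rfl fun l _ => ?_
  rw [MvPolynomial.eval_monomial, Finsupp.prod_fintype _ _ (by simp)]
  simp [mul_assoc]

lemma hm_mul (w u : U) {a b : ℕ} {p q : U[X]} (hp : p.natDegree ≤ a) (hq : q.natDegree ≤ b) :
    hm w u (a + b) (p * q) = hm w u a p * hm w u b q := by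
  unfold hm
  rw [Polynomial.homogenize_mul p q hp hq, map_mul]

lemma hm_one (w u : U) (a : ℕ) : hm w u a 1 = u ^ a := by
  unfold hm; rw [Polynomial.homogenize_one]; simp

lemma hm_pow (w u : U) {a : ℕ} {p : U[X]} (hp : p.natDegree ≤ a) (j : ℕ) :
    hm w u (j * a) (p ^ j) = hm w u a p ^ j := by
  induction j with
  | zero => simp [hm_one]
  | succ j ih =>
    rw [pow_succ, pow_succ, add_mul, one_mul, hm_mul w u ?_ hp, ih]
    exact Polynomial.natDegree_pow_le_of_le j hp

lemma hm_add (w u : U) (a : ℕ) (p q : U[X]) : hm w u a (p + q) = hm w u a p + hm w u a q := by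
  unfold hm; rw [Polynomial.homogenize_add, map_add]

lemma hm_mem (w u : U) (q : ℕ) (p : U[X]) (c j : Ideal U) (hw : w ∈ j) (hu : u ∈ j)
    (hp : ∀ l, p.coeff l ∈ c) : hm w u q p ∈ c * j ^ q := by
  rw [hm_eq]
  refine Ideal.sum_mem _ fun l hl => ?_
  rw [mul_assoc]
  refine Ideal.mul_mem_mul (hp _) ?_
  rw [← HasAntidiagonal.mem_antidiagonal.1 hl, pow_add]
  exact Ideal.mul_mem_mul (Ideal.pow_mem_pow hw _) (Ideal.pow_mem_pow hu _)

lemma hm_congr (w u t : U) {q : ℕ} {p : U[X]} (hp : p.natDegree ≤ q) :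
    u ^ q * p.eval t - hm w u q p ∈ Ideal.span {w - t * u} := by
  rw [hm_eq, Polynomial.eval_eq_sum_range' (Nat.lt_succ_of_le hp),
    Finset.Nat.sum_antidiagonal_eq_sum_range_succ_mk, Finset.mul_sum, ← Finset.sum_sub_distrib]
  refine Ideal.sum_mem _ fun l hl => ?_
  have hl : l ≤ q := by simpa [Nat.lt_succ_iff] using hl
  have e1 : u ^ q * (p.coeff l * t ^ l) - p.coeff l * w ^ l * u ^ (q - l) =
      - (p.coeff l * u ^ (q - l)) * (w ^ l - (t * u) ^ l) := by
    have : u ^ q = u ^ (q - l) * u ^ l := by rw [← pow_add, Nat.sub_add_cancel hl]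
    rw [this, mul_pow]; ring
  simp only at *
  rw [e1]
  exact Ideal.mul_mem_left _ _ (Ideal.mem_span_singleton.2 (sub_dvd_pow_sub_pow _ _ _))

end hom

section star
variable {A : Type*} [CommRing A] [IsLocalRing A] [IsNoetherianRing A] {D : ℕ}

/-- generic linear combination -/
noncomputable def xE (y : Fin (D + 1) → A) : MvPolynomial (Fin D) A :=
  MvPolynomial.C (y (Fin.last D)) + ∑ i, MvPolynomial.X i * MvPolynomial.C (y i.castSucc)

/-- its remaining part when one variable is removed -/
noncomputable def wE (y : Fin (D + 1) → A) (i : Fin D) : MvPolynomial (Fin D) A :=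
  MvPolynomial.C (y (Fin.last D)) +
    ∑ l ∈ Finset.univ.erase i, MvPolynomial.X l * MvPolynomial.C (y l.castSucc)

lemma xE_eq (y : Fin (D + 1) → A) (i : Fin D) :
    xE y = wE y i + MvPolynomial.X i * MvPolynomial.C (y i.castSucc) := by
  unfold xE wE
  rw [← Finset.sum_erase_add _ _ (Finset.mem_univ i), add_assoc]

/-- isolate one variable -/
noncomputable def kap (i : Fin D) : MvPolynomial (Fin D) A →+* (MvPolynomial (Fin D) A)[X] :=
  MvPolynomial.eval₂Hom (Polynomial.C.comp MvPolynomial.C)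
    (fun l => if l = i then Polynomial.X else Polynomial.C (MvPolynomial.X l))

lemma kap_C (i : Fin D) (a : A) : kap i (MvPolynomial.C a) = Polynomial.C (MvPolynomial.C a) := by
  simp [kap]

lemma eval_kap (i : Fin D) (p : MvPolynomial (Fin D) A) : (kap i p).eval (MvPolynomial.X i) = p := by
  have := MvPolynomial.ringHom_ext
    (f := (Polynomial.evalRingHom (MvPolynomial.X i)).comp (kap (A := A) i)) (g := RingHom.id _)
    (by intro r; simp [kap]) (by intro l; by_cases h : l = i <;> simp [kap, h])
  exact congrArg (fun φ : MvPolynomial (Fin D) A →+* _ => φ p) this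

lemma kap_w (y : Fin (D + 1) → A) (i : Fin D) : kap i (wE y i) = Polynomial.C (wE y i) := by
  unfold wE
  rw [map_add, kap_C, map_sum, map_add, map_sum]
  congr 1
  refine Finset.sum_congr rfl fun l hl => ?_
  have : l ≠ i := (Finset.mem_erase.1 hl).1
  rw [map_mul, kap_C]
  simp [kap, this]

lemma kap_x (y : Fin (D + 1) → A) (i : Fin D) : kap i (xE y) =
    Polynomial.C (wE y i) + Polynomial.X * Polynomial.C (MvPolynomial.C (y i.castSucc)) := by
  rw [xE_eq y i, map_add, kap_w, map_mul, kap_C]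
  simp [kap]

lemma kap_coeff_prim (i : Fin D) {s : MvPolynomial (Fin D) A} (hs : Prim s) : ∃ l, Prim ((kap i s).coeff l) := by
  by_contra! h
  refine (mem_mE s).1 ?_ hs
  rw [← eval_kap i s, Polynomial.eval_eq_sum_range]
  exact Ideal.sum_mem _ fun l _ => Ideal.mul_mem_right _ _ ((mem_mE _).2 (h l))

/-- the form whose value is the homogenized denominator -/
noncomputable def Th (i : Fin D) (q : ℕ) (s : MvPolynomial (Fin D) A) :
    MvPolynomial (Fin (D + 1)) (MvPolynomial (Fin D) A) :=
  ∑ l ∈ HasAntidiagonal.antidiagonal q, MvPolynomial.C ((kap i s).coeff l.1) *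
    (-(MvPolynomial.X (Fin.last D) +
      ∑ k ∈ Finset.univ.erase i, MvPolynomial.C (MvPolynomial.X k) * MvPolynomial.X k.castSucc) :
      MvPolynomial (Fin (D + 1)) (MvPolynomial (Fin D) A)) ^ l.1 *
    MvPolynomial.X i.castSucc ^ l.2

lemma Th_hom (i : Fin D) (q : ℕ) (s : MvPolynomial (Fin D) A) : (Th i q s).IsHomogeneous q := by
  unfold Th
  refine MvPolynomial.IsHomogeneous.sum _ _ _ fun l hl => ?_
  have h1 : (-(MvPolynomial.X (Fin.last D) +
      ∑ k ∈ Finset.univ.erase i, MvPolynomial.C (MvPolynomial.X k) * MvPolynomial.X k.castSucc) :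
      MvPolynomial (Fin (D + 1)) (MvPolynomial (Fin D) A)).IsHomogeneous 1 := by
    refine MvPolynomial.IsHomogeneous.neg ?_
    refine (MvPolynomial.isHomogeneous_X _ _).add (MvPolynomial.IsHomogeneous.sum _ _ _ fun k _ => ?_)
    exact (MvPolynomial.isHomogeneous_X _ _).C_mul _
  have h2 := (((MvPolynomial.isHomogeneous_C (Fin (D + 1)) ((kap i s).coeff l.1)).mul (h1.pow l.1)).mul
    ((MvPolynomial.isHomogeneous_X (MvPolynomial (Fin D) A) i.castSucc).pow l.2))
  simp only [zero_add, one_mul] at h2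
  rwa [HasAntidiagonal.mem_antidiagonal.1 hl] at h2

lemma Th_eval (y : Fin (D + 1) → A) (i : Fin D) (q : ℕ) (s : MvPolynomial (Fin D) A) :
    MvPolynomial.eval (fun k => MvPolynomial.C (y k)) (Th i q s) =
      hm (-(wE y i)) (MvPolynomial.C (y i.castSucc)) q (kap i s) := by
  rw [hm_eq, Th, map_sum]
  refine Finset.sum_congr rfl fun l _ => ?_
  simp only [map_mul, map_pow, MvPolynomial.eval_C, MvPolynomial.eval_X, map_neg, map_add, map_sum, wE]

lemma Th_prim (i : Fin D) {q : ℕ} {s : MvPolynomial (Fin D) A} (hs : Prim s) (hq : (kap i s).natDegree ≤ q) :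
    Prim (MvPolynomial.map io (Th i q s)) := by
  classical
  by_contra h
  obtain ⟨l, hl⟩ := kap_coeff_prim i hs
  have hlq : l ≤ q := by
    by_contra hc
    rw [Polynomial.coeff_eq_zero_of_natDegree_lt (by omega)] at hl
    obtain ⟨a, ha⟩ := hl
    simp at ha
  -- specialise
  let K := ResidueField (SS A D)
  let ψ : MvPolynomial (Fin (D + 1)) (SS A D) →+* K[X] :=
    MvPolynomial.eval₂Hom (Polynomial.C.comp (residue _))
      (Fin.snoc (α := fun _ => K[X]) (fun k => if k = i then 1 else 0) (-Polynomial.X))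
  have h0 : ψ (MvPolynomial.map io (Th i q s)) = 0 := by
    have h1 : MvPolynomial.map io (Th i q s) ∈ (maximalIdeal (SS A D)).map MvPolynomial.C := by
      rw [MvPolynomial.mem_map_C_iff]
      unfold Prim at h; push Not at h; exact h
    have h2 : (maximalIdeal (SS A D)).map MvPolynomial.C ≤ RingHom.ker ψ := by
      rw [Ideal.map_le_iff_le_comap]
      intro a ha
      rw [Ideal.mem_comap, RingHom.mem_ker]
      simp only [ψ, MvPolynomial.eval₂Hom_C, RingHom.comp_apply]
      rw [(residue_eq_zero_iff a).2 ha, map_zero]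
    exact h2 h1
  have h3 : ψ (MvPolynomial.map io (Th i q s)) =
      ∑ l ∈ HasAntidiagonal.antidiagonal q, Polynomial.C (residue _ (io ((kap i s).coeff l.1))) * Polynomial.X ^ l.1 := by
    unfold Th
    rw [map_sum, map_sum]
    refine Finset.sum_congr rfl fun l _ => ?_
    have hz : ∑ k ∈ Finset.univ.erase i, (Polynomial.C.comp (residue (SS A D))) (io (MvPolynomial.X k)) *
        (if k = i then (1 : K[X]) else 0) = 0 := by
      refine Finset.sum_eq_zero fun k hk => ?_
      rw [if_neg (Finset.mem_erase.1 hk).1, mul_zero]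
    simp only [ψ, map_mul, map_pow, map_neg, map_add, map_sum, MvPolynomial.map_C, MvPolynomial.map_X,
      MvPolynomial.coe_eval₂Hom, MvPolynomial.eval₂_C, MvPolynomial.eval₂_X, Fin.snoc_last, Fin.snoc_castSucc, hz]
    simp
  rw [h3] at h0
  have h4 := congrArg (fun p : K[X] => p.coeff l) h0
  simp only [Polynomial.finset_sum_coeff, Polynomial.coeff_C_mul, Polynomial.coeff_X_pow, Polynomial.coeff_zero] at h4
  rw [Finset.sum_eq_single (l, q - l)] at h4
  · simp only [if_true, mul_one] at h4
    rw [residue_eq_zero_iff] at h4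
    exact h4 (io_unit hl)
  · rintro ⟨a, b⟩ hab hne
    have : l ≠ a := by
      rintro rfl
      have := HasAntidiagonal.mem_antidiagonal.1 hab
      simp only at this
      exact hne (by rw [show b = q - l by omega])
    simp [this]
  · intro hn
    exact absurd (HasAntidiagonal.mem_antidiagonal.2 (by simp only; omega)) hn

end star
end RN2

namespace RN2

/-- the main property of a generic element -/
def Star {S : Type*} [CommRing S] {D : ℕ} (z : Fin (D + 1) → S) : Prop :=
  ∀ n f, (∃ k, ∀ i j, i + k ≤ n * j → f ^ j ∈ sp z ^ i ⊔ Ideal.span {z (Fin.last D)}) →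
    ∀ i : Fin D, ∃ q, z i.castSucc ^ q * f ∈ F (sp z) (n + q) ⊔ Ideal.span {z (Fin.last D)}

section star
variable {A : Type*} [CommRing A] [IsLocalRing A] [IsNoetherianRing A] {D : ℕ}

/-- generic system of generators -/
noncomputable def zS (y : Fin (D + 1) → A) : Fin (D + 1) → SS A D :=
  Fin.snoc (α := fun _ => SS A D) (fun i => co (y i.castSucc)) (io (xE y))

lemma zS_last (y : Fin (D + 1) → A) : zS y (Fin.last D) = io (xE y) := by simp [zS]
lemma zS_cast (y : Fin (D + 1) → A) (i : Fin D) : zS y i.castSucc = co (y i.castSucc) := by simp [zS]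

lemma io_xE (y : Fin (D + 1) → A) : io (xE y) = co (y (Fin.last D)) +
    ∑ i, io (MvPolynomial.X i) * co (y i.castSucc) := by
  unfold xE
  rw [map_add, map_sum, io_C]
  simp_rw [map_mul, io_C]

lemma sp_zS (y : Fin (D + 1) → A) : sp (zS y) = (sp y).map co := by
  rw [map_sp']
  apply le_antisymm
  · refine Ideal.span_le.2 ?_
    rintro _ ⟨k, rfl⟩
    induction k using Fin.lastCases with
    | last =>
      rw [zS_last, io_xE]
      refine add_mem (mem_sp (fun i => co (y i)) _) (Ideal.sum_mem _ fun i _ => Ideal.mul_mem_left _ _ ?_)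
      exact mem_sp (fun i => co (y i)) _
    | cast i => rw [zS_cast]; exact mem_sp (fun i => co (y i)) _
  · have hc : ∀ i : Fin D, co (y i.castSucc) ∈ sp (zS y) := fun i => by
      rw [← zS_cast]; exact mem_sp _ _
    refine Ideal.span_le.2 ?_
    rintro _ ⟨k, rfl⟩
    induction k using Fin.lastCases with
    | last =>
      have h1 := mem_sp (zS y) (Fin.last D)
      rw [zS_last, io_xE] at h1
      refine (Submodule.add_mem_iff_left _ (Ideal.sum_mem _ fun i _ => Ideal.mul_mem_left _ _ ?_)).1 h1
      exact hc i
    | cast i => exact hc i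

lemma qreg_zS {y : Fin (D + 1) → A} (hy : QReg y) : QReg (zS y) := by
  have h1 : QReg (fun i => RN2.co (e := D) (y i)) := hy.co
  let lin (c : SS A D) : Fin (D + 1) → MvPolynomial (Fin (D + 1)) (SS A D) :=
    Fin.snoc (α := fun _ => MvPolynomial (Fin (D + 1)) (SS A D)) (fun i => MvPolynomial.X i.castSucc)
      (MvPolynomial.X (Fin.last D) +
        ∑ i : Fin D, MvPolynomial.C (c * io (MvPolynomial.X i)) * MvPolynomial.X i.castSucc)
  refine h1.subst (lin 1) (lin (-1)) ?_ ?_ ?_ ?_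
  · intro k
    induction k using Fin.lastCases with
    | last =>
      simp only [lin, Fin.snoc_last]
      refine (MvPolynomial.isHomogeneous_X _ _).add (MvPolynomial.IsHomogeneous.sum _ _ _ fun k _ => ?_)
      exact (MvPolynomial.isHomogeneous_X _ _).C_mul _
    | cast i => simp only [lin, Fin.snoc_castSucc]; exact MvPolynomial.isHomogeneous_X _ _
  · intro k
    induction k using Fin.lastCases with
    | last => simp only [lin, Fin.snoc_last, zS_last, io_xE]; simp
    | cast i => simp [lin, zS_cast]
  · intro k
    induction k using Fin.lastCases with
    | last => 
      simp only [lin, Fin.snoc_last, map_add, map_sum, map_mul, MvPolynomial.bind₁_X_right, MvPolynomial.bind₁_C_right,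
        Fin.snoc_castSucc]
      simp only [map_neg, map_one]
      rw [add_assoc, ← Finset.sum_add_distrib, Finset.sum_eq_zero, add_zero]
      intro x _
      ring
    | cast i => simp [lin]
  · rw [← map_sp', sp_zS]

lemma star_zS {y : Fin (D + 1) → A} (hy : QReg y) : Star (zS y) := by
  intro n f hf i
  rw [sp_zS, zS_last] at hf
  rw [sp_zS, zS_last]
  rw [zS_cast]
  set J := sp y with hJ
  have hJS : J.map (co (e := D)) = sp (fun k => co (e := D) (y k)) := map_sp' _ _
  obtain ⟨P, p, hP, hp⟩ := io_surj f
  suffices H : ∃ q, co (y i.castSucc) ^ q * io p ∈ F (J.map co) (n + q) ⊔ Ideal.span {io (xE y)} by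
    obtain ⟨q, hq⟩ := H
    refine ⟨q, ?_⟩
    rw [← hp, mul_left_comm, mem_unit_mul _ (io_unit hP)] at hq
    exact hq
  obtain ⟨k, hk⟩ := hf
  set u : MvPolynomial (Fin D) A := MvPolynomial.C (y i.castSucc) with hu
  set w := wE y i with hw
  set JE := J.map (MvPolynomial.C (σ := Fin D)) with hJE
  have huJ : u ∈ JE := Ideal.mem_map_of_mem _ (mem_sp y _)
  have hwJ : -w ∈ JE := by
    refine neg_mem (add_mem (Ideal.mem_map_of_mem _ (mem_sp y _)) (Ideal.sum_mem _ fun l _ => ?_))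
    exact Ideal.mul_mem_left _ _ (Ideal.mem_map_of_mem _ (mem_sp y _))
  have hio : ∀ (g : MvPolynomial (Fin D) A) m, g ∈ JE ^ m → io g ∈ (J.map co) ^ m := by
    intro g m hg
    have := Ideal.mem_map_of_mem io hg
    rwa [Ideal.map_pow, hJE, Ideal.map_map, ← co_eq] at this
  set qp := (kap i p).natDegree with hqp
  set Pp := hm (-w) u qp (kap i p) with hPp
  have hPpJ : Pp ∈ JE ^ qp := by
    have := hm_mem (-w) u qp (kap i p) ⊤ JE hwJ huJ (fun _ => trivial)
    simpa using this
  have key : ∀ i' j, i' + k ≤ n * j → io Pp ^ j ∈ (J.map co) ^ (i' + j * qp) := by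
    intro i' j hij
    have h1 := hk i' j hij
    have h2 : io (p ^ j) ∈ Ideal.map co J ^ i' ⊔ Ideal.span {io (xE y)} := by
      rw [map_pow, ← hp, mul_pow]
      exact Ideal.mul_mem_left _ _ h1
    -- descend to the polynomial ring
    have h3 : io (p ^ j) ∈ (JE ^ i' ⊔ Ideal.span {xE y}).map io := by
      rw [Ideal.map_sup, Ideal.map_pow, hJE, Ideal.map_map, ← co_eq, show Ideal.map io (Ideal.span {xE y}) = Ideal.span {io (xE y)} by
          rw [Ideal.map_span, Set.image_singleton]]
      exact h2
    unfold io at h3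
    rw [IsLocalization.algebraMap_mem_map_algebraMap_iff (mE A D).primeCompl] at h3
    obtain ⟨s, hs, h3⟩ := h3
    have hsp : Prim s := by
      by_contra hc; exact hs ((mem_mE _).2 hc)
    obtain ⟨h, hh, g', hg', h4⟩ := Submodule.mem_sup.1 h3
    obtain ⟨g, rfl⟩ := Ideal.mem_span_singleton.1 hg'
    set qs := (kap i s).natDegree with hqs
    -- apply kap and homogenize
    have h5 : kap i s * kap i p ^ j = kap i h + kap i (xE y) * kap i g := by
      rw [← map_pow, ← map_mul, ← h4, map_add, map_mul]
    set a := (kap i g).natDegree + 1 with ha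
    set Q := qs + j * qp with hQ
    have h6 := congrArg (hm (-w) u (1 + (Q + a))) h5
    have e1 : hm (-w) u (1 + (Q + a)) (kap i s * kap i p ^ j) = u ^ (1 + a) * (hm (-w) u qs (kap i s) * Pp ^ j) := by
      rw [show 1 + (Q + a) = (1 + a) + Q by omega, ← one_mul (kap i s * kap i p ^ j), hm_mul, hm_one, hQ, hm_mul, hm_pow]
      · exact le_rfl
      · exact le_rfl
      · exact Polynomial.natDegree_pow_le_of_le j le_rfl
      · simp
      · refine Polynomial.natDegree_mul_le.trans (add_le_add le_rfl (Polynomial.natDegree_pow_le_of_le j le_rfl))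
    have e2 : hm (-w) u (1 + (Q + a)) (kap i (xE y) * kap i g) = 0 := by
      rw [hm_mul, kap_x]
      · have e0 : hm (-w) u 1 (Polynomial.C w + Polynomial.X * Polynomial.C u) = 0 := by
          have ha1 : HasAntidiagonal.antidiagonal 1 = {((0 : ℕ), (1 : ℕ)), (1, 0)} := by decide
          rw [hm_eq, ha1, Finset.sum_pair (by simp)]
          simp only [Polynomial.coeff_add, Polynomial.coeff_mul_C, Polynomial.coeff_C, Polynomial.coeff_X]
          simp
          ring
        rw [e0, zero_mul]
      · rw [kap_x]
        refine (Polynomial.natDegree_add_le _ _).trans ?_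
        simp only [Polynomial.natDegree_C]
        refine max_le (Nat.zero_le _) (Polynomial.natDegree_mul_C_le _ _ |>.trans Polynomial.natDegree_X_le)
      · omega
    have e3 : hm (-w) u (1 + (Q + a)) (kap i h) ∈ JE ^ (i' + (1 + (Q + a))) := by
      rw [pow_add]
      refine hm_mem _ _ _ _ _ _ hwJ huJ ?_
      have : kap i h ∈ (JE ^ i').map Polynomial.C := by
        have h7 := Ideal.mem_map_of_mem (kap i) hh
        have h8 : (kap i).comp MvPolynomial.C = Polynomial.C.comp (MvPolynomial.C (R := A) (σ := Fin D)) := by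
          ext1 r; exact kap_C i r
        rwa [hJE, Ideal.map_pow, Ideal.map_map, h8, ← Ideal.map_map, ← Ideal.map_pow] at h7
      exact Ideal.mem_map_C_iff.1 this
    rw [e1, hm_add, e2, add_zero] at h6
    rw [← h6] at e3
    have e4 := hio _ _ e3
    rw [hJS] at e4 ⊢
    rw [map_mul, map_mul, map_pow, map_pow, hu, io_C] at e4
    have hyS : QReg (fun k => RN2.co (e := D) (y k)) := hy.co
    have e5 := hyS.cancel (P := MvPolynomial.X i.castSucc ^ (1 + a)) (a := 1 + a)
      (by simpa using (MvPolynomial.isHomogeneous_X (SS A D) i.castSucc).pow (1 + a))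
      ((Prim.X i.castSucc).pow _) (i' + Q) _ (by
        rw [show i' + Q + (1 + a) = i' + (1 + (Q + a)) by omega]
        simpa using e4)
    refine hyS.cancel (P := MvPolynomial.map io (Th i qs s)) (a := qs) ((Th_hom i qs s).map io)
      (Th_prim i hsp le_rfl) _ _ ?_
    rw [show i' + j * qp + qs = i' + Q by omega]
    convert e5 using 2
    rw [← hu, ← Th_eval, MvPolynomial.eval_map, MvPolynomial.eval₂_eq, MvPolynomial.eval_eq, map_sum]
    refine Finset.sum_congr rfl fun a _ => ?_
    rw [map_mul, map_prod]
    simp_rw [map_pow, io_C]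
  refine ⟨qp, ?_⟩
  have hPF : io Pp ∈ F (J.map co) (n + qp) := by
    refine mem_F.2 ⟨k, fun i'' j hij => ?_⟩
    rcases le_total (j * qp) i'' with hc | hc
    · have := key (i'' - j * qp) j (by rw [add_mul] at hij; rw [mul_comm qp j] at hij; omega)
      rwa [Nat.sub_add_cancel hc] at this
    · have h1 := Ideal.pow_mem_pow (hio _ _ hPpJ) j
      rw [← pow_mul, mul_comm] at h1
      exact Ideal.pow_le_pow_right hc h1
  have hc := hm_congr (-w) u (MvPolynomial.X i) (le_refl (kap i p).natDegree)
  rw [eval_kap] at hc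
  have hc' : u ^ qp * p - Pp ∈ Ideal.span {xE y} := by
    rw [xE_eq y i]
    refine (Ideal.span_singleton_le_span_singleton.2 ?_) hc
    exact ⟨-1, by ring⟩
  have h9 := Ideal.mem_map_of_mem io hc'
  rw [Ideal.map_span, Set.image_singleton, map_sub, map_mul, map_pow, hu, io_C] at h9
  have : co (y i.castSucc) ^ qp * io p = io Pp + (co (y i.castSucc) ^ qp * io p - io Pp) := by ring
  rw [this]
  exact Submodule.add_mem_sup hPF h9

end star
end RN2

namespace RN2

/-- basic frame -/
structure Fr {A : Type*} [CommRing A] [IsLocalRing A] {D : ℕ} (x : Fin D → A) : Prop where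
  qreg : QReg x
  mem : ∀ i, x i ∈ maximalIdeal A
  fin : FIN (sp x)
  max : maximalIdeal A ≤ F (sp x) 1

def Zc {A : Type*} [CommRing A] {D : ℕ} (x : Fin D → A) (p q : Fin D) (n : ℕ) : Prop :=
  ∀ k a b, a * x q ^ k - b * x p ^ k ∈ F (sp x) (2 * k + n) →
    ∃ r, a - r * x p ^ k ∈ F (sp x) (n + k) ∧ b - r * x q ^ k ∈ F (sp x) (n + k)

structure Good {A : Type*} [CommRing A] {D : ℕ} (x : Fin D → A) (p q : Fin D) : Prop where
  z : ∀ n, 1 ≤ n → Zc x p q n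
  red : ∀ n, 2 ≤ n → F (sp x) (n + 1) ≤ sp x * F (sp x) n

lemma Fr.Z0 {A : Type*} [CommRing A] [IsLocalRing A] [IsNoetherianRing A] {D : ℕ} {x : Fin D → A} (h : Fr x)
    {p q : Fin D} (hpq : p ≠ q) : Zc x p q 0 := by
  intro k a b hab
  refine ⟨0, ?_, ?_⟩
  · simpa using RN2.Z0 h.qreg hpq h.fin k a b hab
  · have : b * x p ^ k - a * x q ^ k ∈ F (sp x) (2 * k) := by
      have := neg_mem hab; rwa [neg_sub] at this
    simpa using RN2.Z0 h.qreg hpq.symm h.fin k b a this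

lemma F_stable {A : Type*} [CommRing A] [IsNoetherianRing A] {J : Ideal A} (h : FIN J) :
    ∃ n0, ∀ n, n0 ≤ n → F J (n + 1) = J * F J n := by
  obtain ⟨k0, hk⟩ := h
  let G : J.Filtration A :=
    { N := fun n => F J (n + k0)
      mono := fun n => F_anti J (by omega)
      smul_le := fun n => by
        have := pow_mul_F_le J 1 (n + k0)
        rw [pow_one] at this
        rw [smul_eq_mul]
        exact this.trans (F_anti J (by omega)) }
  have hG : G.Stable := by
    refine Ideal.Filtration.Stable.of_le (Ideal.stableFiltration_stable J ⊤) ?_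
    intro n
    show F J (n + k0) ≤ J ^ n • ⊤
    rw [smul_eq_mul, Ideal.mul_top]
    exact hk n
  obtain ⟨n0, hn0⟩ := hG
  refine ⟨n0 + k0, fun n hn => ?_⟩
  have := hn0 (n - k0) (by omega)
  have e : (n - k0) + k0 = n := by omega
  have e' : (n - k0) + 1 + k0 = n + 1 := by omega
  simp only [G, smul_eq_mul, e, e'] at this
  exact this.symm

lemma F_stable' {A : Type*} [CommRing A] [IsNoetherianRing A] {J : Ideal A} (h : FIN J) :
    ∃ n0, ∀ n, F J (n + n0) = J ^ n * F J n0 := by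
  obtain ⟨n0, h⟩ := F_stable h
  refine ⟨n0, fun n => ?_⟩
  induction n with
  | zero => simp
  | succ n ih => rw [show n + 1 + n0 = (n + n0) + 1 by omega, h _ (by omega), ih, pow_succ', mul_assoc]

/-- pigeonhole on monomials -/
lemma pow_mul_mem {A : Type*} [CommRing A] {D : ℕ} (y : Fin D → A) (q : ℕ) (hD : 0 < D) (f : A) (V : ℕ → Ideal A)
    (hV : ∀ n m, sp y ^ n * V m ≤ V (n + m)) (n : ℕ)
    (h : ∀ i, y i ^ q * f ∈ V (n + q)) (Q : ℕ) (hQ : D * q ≤ Q) (a : A) (ha : a ∈ sp y ^ Q) : a * f ∈ V (n + Q) := by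
  obtain ⟨P, hP, rfl⟩ := exists_form' y Q a ha
  rw [MvPolynomial.eval_eq', Finset.sum_mul]
  refine Ideal.sum_mem _ fun a ha => ?_
  have hdeg := hP (MvPolynomial.mem_support_iff.1 ha)
  have h' : a.degree = Q := by rwa [Finsupp.degree_eq_weight_one]
  rw [Finsupp.degree_eq_sum] at h'
  have : ∃ i, q ≤ a i := by
    by_contra hc
    push Not at hc
    haveI : Nonempty (Fin D) := ⟨⟨0, hD⟩⟩
    have : ∑ i, a i < ∑ i : Fin D, q := Finset.sum_lt_sum_of_nonempty Finset.univ_nonempty (fun i _ => hc i)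
    simp at this
    omega
  obtain ⟨i, hi⟩ := this
  rw [mul_assoc]
  refine Ideal.mul_mem_left _ _ ?_
  have hs : (∏ j, y j ^ (a j)) = y i ^ q * (y i ^ (a i - q) * ∏ j ∈ Finset.univ.erase i, y j ^ a j) := by
    rw [← mul_assoc, ← pow_add, Nat.add_sub_cancel' hi, Finset.mul_prod_erase _ (fun j => y j ^ a j) (Finset.mem_univ i)]
  rw [hs, mul_right_comm, mul_comm]
  have hle := hV (Q - q) (n + q)
  have hq : q ≤ Q := by nlinarith
  rw [show Q - q + (n + q) = n + Q by omega] at hle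
  refine hle (Ideal.mul_mem_mul ?_ (h i))
  have hsum : (a i - q) + ∑ j ∈ Finset.univ.erase i, a j = Q - q := by
    have := Finset.add_sum_erase Finset.univ (fun j => a j) (Finset.mem_univ i)
    omega
  rw [← hsum, pow_add]
  refine Ideal.mul_mem_mul (Ideal.pow_mem_pow (mem_sp _ _) _) ?_
  rw [← Finset.prod_pow_eq_pow_sum]
  exact Ideal.prod_mem_prod fun j _ => Ideal.pow_mem_pow (mem_sp _ _) _

section cut
variable {S : Type*} [CommRing S] [IsLocalRing S] [IsNoetherianRing S] {D : ℕ} {z : Fin (D + 1) → S}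
  {B : Type*} [CommRing B] [IsLocalRing B] [IsNoetherianRing B] (φ : S →+* B)

/-- the cut system -/
def cut (z : Fin (D + 1) → S) (φ : S →+* B) : Fin D → B := fun i => φ (z i.castSucc)

lemma sp_cut (hk : RingHom.ker φ = Ideal.span {z (Fin.last D)}) : (sp z).map φ = sp (cut z φ) := by
  rw [map_sp']
  have h0 : φ (z (Fin.last D)) = 0 := by
    rw [← RingHom.mem_ker, hk]; exact Ideal.mem_span_singleton_self _
  apply le_antisymm
  · refine Ideal.span_le.2 ?_
    rintro _ ⟨k, rfl⟩
    induction k using Fin.lastCases with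
    | last => simp only [h0]; exact zero_mem _
    | cast i => exact mem_sp (cut z φ) i
  · refine Ideal.span_le.2 ?_
    rintro _ ⟨k, rfl⟩
    exact mem_sp (fun i => φ (z i)) k.castSucc

lemma F_cut_le (hk : RingHom.ker φ = Ideal.span {z (Fin.last D)}) {n : ℕ} {f : S} (hf : f ∈ F (sp z) n) :
    φ f ∈ F (sp (cut z φ)) n := by
  rw [← sp_cut φ hk]
  exact F_map_le φ _ n (Ideal.mem_map_of_mem φ hf)

lemma star_cut (hφ : Function.Surjective φ) (hk : RingHom.ker φ = Ideal.span {z (Fin.last D)})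
    (hs : Star z) {n : ℕ} {f : S} (hf : φ f ∈ F (sp (cut z φ)) n) :
    ∃ q0, ∀ q, q0 ≤ q → ∀ i : Fin D, ∃ a ∈ F (sp z) (n + q), ∃ b, z i.castSucc ^ q * f = a + z (Fin.last D) * b := by
  rw [← sp_cut φ hk] at hf
  obtain ⟨k, hf⟩ := mem_F.1 hf
  have h1 := hs n f ⟨k, fun i j hij => by
    have h2 := hf i j hij
    rw [← map_pow, ← Ideal.map_pow] at h2
    have := mem_sup_span_of_map φ hφ hk h2
    rwa [sup_comm]⟩
  choose q hq using h1
  refine ⟨∑ i, q i, fun Q hQ i => ?_⟩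
  have hi : q i ≤ Q := (Finset.single_le_sum (f := q) (fun _ _ => Nat.zero_le _) (Finset.mem_univ i)).trans hQ
  obtain ⟨a, ha, b', hb', hab⟩ := Submodule.mem_sup.1 (hq i)
  obtain ⟨b, rfl⟩ := Ideal.mem_span_singleton.1 hb'
  refine ⟨z i.castSucc ^ (Q - q i) * a, ?_, z i.castSucc ^ (Q - q i) * b, ?_⟩
  · have := pow_mul_F_le (sp z) (Q - q i) (n + q i) (Ideal.mul_mem_mul (Ideal.pow_mem_pow (mem_sp z i.castSucc) _) ha)
    rwa [show Q - q i + (n + q i) = n + Q by omega] at this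
  · have e : Q = (Q - q i) + q i := by omega
    conv_lhs => rw [e]
    rw [pow_add, mul_assoc, ← hab]; ring

lemma fr_cut (hD : 0 < D) (hφ : Function.Surjective φ) (hk : RingHom.ker φ = Ideal.span {z (Fin.last D)})
    (hs : Star z) (hz : Fr z) : Fr (cut z φ) := by
  have hq : QReg (cut z φ) := by
    have := hz.qreg.quot (Fin.last D) φ hφ hk
    simp only [Fin.succAbove_last] at this
    exact this
  have hmm : ∀ f, φ f ∈ maximalIdeal B ↔ f ∈ maximalIdeal S := fun f => by
    rw [← map_maximalIdeal φ hφ, Ideal.mem_comap]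
  refine ⟨hq, fun i => (hmm _).2 (hz.mem _), ?_, ?_⟩
  · obtain ⟨k0, hk0⟩ := hz.fin
    refine ⟨k0, fun n g hg => ?_⟩
    obtain ⟨f, rfl⟩ := hφ g
    obtain ⟨q, h⟩ := star_cut φ hφ hk hs hg
    obtain ⟨a, ha, b, hab⟩ := h q le_rfl ⟨0, hD⟩
    have h1 : cut z φ ⟨0, hD⟩ ^ q * φ f ∈ sp (cut z φ) ^ (n + q) := by
      have h2 := congrArg φ hab
      have h0 : φ (z (Fin.last D)) = 0 := by
        rw [← RingHom.mem_ker, hk]; exact Ideal.mem_span_singleton_self _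
      rw [map_add, map_mul, map_mul, map_pow, h0, zero_mul, add_zero] at h2
      show φ (z _) ^ q * φ f ∈ _
      rw [h2, ← sp_cut φ hk, ← Ideal.map_pow]
      refine Ideal.mem_map_of_mem _ (hk0 _ ?_)
      rwa [show n + q + k0 = n + k0 + q by omega]
    refine hq.cancel (P := MvPolynomial.X ⟨0, hD⟩ ^ q) (a := q) ?_ ((Prim.X _).pow _) n _ (by simpa using h1)
    simpa using (MvPolynomial.isHomogeneous_X B (⟨0, hD⟩ : Fin D)).pow q
  · intro g hg
    obtain ⟨f, rfl⟩ := hφ g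
    exact F_cut_le φ hk (hz.max ((hmm f).1 hg))

lemma large_cut (hD : 0 < D) (hφ : Function.Surjective φ) (hk : RingHom.ker φ = Ideal.span {z (Fin.last D)})
    (hs : Star z) (hz : Fr z) : ∃ n1, ∀ n, n1 ≤ n → F (sp (cut z φ)) n ≤ (F (sp z) n).map φ := by
  obtain ⟨n0, h0⟩ := F_stable' (fr_cut φ hD hφ hk hs hz).fin
  set V : ℕ → Ideal B := fun n => (F (sp z) n).map φ with hV
  have hVm : ∀ n m, sp (cut z φ) ^ n * V m ≤ V (n + m) := by
    intro n m
    rw [← sp_cut φ hk, ← Ideal.map_pow, hV]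
    simp only
    rw [← Ideal.map_mul]
    exact Ideal.map_mono (pow_mul_F_le _ _ _)
  have hzl : φ (z (Fin.last D)) = 0 := by
    rw [← RingHom.mem_ker, hk]; exact Ideal.mem_span_singleton_self _
  have key : ∀ g ∈ F (sp (cut z φ)) n0, ∃ q0, ∀ q, q0 ≤ q → ∀ i, cut z φ i ^ q * g ∈ V (n0 + q) := by
    intro g hg
    obtain ⟨f, rfl⟩ := hφ g
    obtain ⟨q, h⟩ := star_cut φ hφ hk hs hg
    refine ⟨q, fun Q hQ i => ?_⟩
    obtain ⟨a, ha, b, hab⟩ := h Q hQ i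
    have h2 := congrArg φ hab
    rw [map_add, map_mul, map_mul, map_pow, hzl, zero_mul, add_zero] at h2
    show φ (z _) ^ Q * φ f ∈ _
    rw [h2]
    exact Ideal.mem_map_of_mem _ ha
  have key2 : ∀ g ∈ F (sp (cut z φ)) n0, ∃ Q0, ∀ Q, Q0 ≤ Q → ∀ a ∈ sp (cut z φ) ^ Q, a * g ∈ V (n0 + Q) := by
    intro g hg
    obtain ⟨q0, h⟩ := key g hg
    exact ⟨D * q0, fun Q hQ a ha => pow_mul_mem (cut z φ) q0 hD g V hVm n0 (h q0 le_rfl) Q hQ a ha⟩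
  obtain ⟨T, hT⟩ := (isNoetherianRing_iff_ideal_fg B).1 inferInstance (F (sp (cut z φ)) n0)
  have hTm : ∀ t ∈ T, t ∈ F (sp (cut z φ)) n0 := fun t ht => by rw [← hT]; exact Ideal.subset_span ht
  choose! Q0 hQ0 using key2
  refine ⟨n0 + ∑ t ∈ T, Q0 t, fun n hn => ?_⟩
  have e : n = (n - n0) + n0 := by omega
  have e' : n0 + (n - n0) = n := by omega
  conv_lhs => rw [e, h0, ← hT]
  rw [Ideal.mul_le]
  intro a ha b hb
  refine Submodule.span_induction (p := fun b _ => a * b ∈ (F (sp z) n).map φ) ?_ ?_ ?_ ?_ hb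
  · intro t ht
    have h3 : Q0 t ≤ ∑ t ∈ T, Q0 t := Finset.single_le_sum (f := Q0) (fun _ _ => Nat.zero_le _) ht
    have := hQ0 t (hTm t ht) (n - n0) (by omega) a ha
    rwa [e'] at this
  · simp
  · intro u v _ _ hu hv; rw [mul_add]; exact add_mem hu hv
  · intro r u _ hu; rw [smul_eq_mul, mul_left_comm]; exact Ideal.mul_mem_left _ _ hu

end cut
end RN2

namespace RN2

section cut
variable {S : Type*} [CommRing S] [IsLocalRing S] [IsNoetherianRing S] {D : ℕ} {z : Fin (D + 1) → S}
  {B : Type*} [CommRing B] [IsLocalRing B] [IsNoetherianRing B] (φ : S →+* B)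

lemma exists_of_map (hφ : Function.Surjective φ) (hk : RingHom.ker φ = Ideal.span {z (Fin.last D)})
    {I : Ideal S} {f : S} (h : φ f ∈ I.map φ) : ∃ a ∈ I, ∃ b, f = a + z (Fin.last D) * b := by
  have := mem_sup_span_of_map φ hφ hk h
  rw [sup_comm] at this
  obtain ⟨a, ha, b', hb', hab⟩ := Submodule.mem_sup.1 this
  obtain ⟨b, rfl⟩ := Ideal.mem_span_singleton.1 hb'
  exact ⟨a, ha, b, hab.symm⟩

lemma lift1 (hφ : Function.Surjective φ) (hk : RingHom.ker φ = Ideal.span {z (Fin.last D)})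
    (hs : Star z) (hz : Fr z) {p q : Fin D} {n : ℕ} (hZ : Zc z p.castSucc q.castSucc n) :
    F (sp (cut z φ)) (n + 1) ≤ (F (sp z) (n + 1)).map φ := by
  intro g hg
  obtain ⟨f, rfl⟩ := hφ g
  obtain ⟨k, h⟩ := star_cut φ hφ hk hs hg
  obtain ⟨a, ha, b, hab⟩ := h k le_rfl p
  obtain ⟨a', ha', b', hab'⟩ := h k le_rfl q
  set xp := z p.castSucc
  set xq := z q.castSucc
  set x := z (Fin.last D) with hx
  have hpk : ∀ (i : Fin (D+1)) (m : ℕ) (c : S), c ∈ F (sp z) m → z i ^ k * c ∈ F (sp z) (m + k) := fun i m c hc => by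
    have := pow_mul_F_le (sp z) k m (Ideal.mul_mem_mul (Ideal.pow_mem_pow (mem_sp z i) k) hc)
    rwa [add_comm k m] at this
  have h1 : x ^ 1 * (b * xq ^ k - b' * xp ^ k) ∈ F (sp z) (2 * k + n + 1) := by
    have e : x ^ 1 * (b * xq ^ k - b' * xp ^ k) = xp ^ k * a' - xq ^ k * a := by linear_combination xp ^ k * hab' - xq ^ k * hab
    rw [e, show 2 * k + n + 1 = n + 1 + k + k by ring]
    exact sub_mem (hpk _ _ _ ha') (hpk _ _ _ ha)
  obtain ⟨r, hr, -⟩ := hZ k b b' (F_cancel_X hz.qreg _ 1 _ _ h1)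
  have h2 : xp ^ k * (f - x * r) ∈ F (sp z) (n + 1 + k) := by
    have e : xp ^ k * (f - x * r) = a + x * (b - r * xp ^ k) := by linear_combination hab
    rw [e]
    refine add_mem ha ?_
    have := pow_mul_F_le (sp z) 1 (n + k) (Ideal.mul_mem_mul (Ideal.pow_mem_pow (mem_sp z (Fin.last D)) 1) hr)
    rw [pow_one] at this
    rwa [show 1 + (n + k) = n + 1 + k by ring] at this
  have h3 := F_cancel_X hz.qreg _ _ _ _ h2
  have h0 : φ x = 0 := by
    rw [← RingHom.mem_ker, hk]; exact Ideal.mem_span_singleton_self _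
  have h4 := Ideal.mem_map_of_mem φ h3
  rwa [map_sub, map_mul, h0, zero_mul, sub_zero] at h4

lemma lift2 (hD : 0 < D) (hφ : Function.Surjective φ) (hk : RingHom.ker φ = Ideal.span {z (Fin.last D)})
    (hs : Star z) (hz : Fr z) {p q : Fin D} {n : ℕ} (hZ : Zc z p.castSucc q.castSucc n)
    (hB : Zc (cut z φ) p q (n + 1)) : Zc z p.castSucc q.castSucc (n + 1) := by
  obtain ⟨K, hK⟩ := large_cut φ hD hφ hk hs hz
  have key : ∀ k, K ≤ k → ∀ a b, a * z q.castSucc ^ k - b * z p.castSucc ^ k ∈ F (sp z) (2 * k + (n + 1)) →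
    ∃ r, a - r * z p.castSucc ^ k ∈ F (sp z) (n + 1 + k) ∧ b - r * z q.castSucc ^ k ∈ F (sp z) (n + 1 + k) := by
    intro k hkK a b hab
    set xp := z p.castSucc with hxp
    set xq := z q.castSucc with hxq
    set x := z (Fin.last D) with hx
    have hpk : ∀ (i : Fin (D+1)) (m k : ℕ) (c : S), c ∈ F (sp z) m → z i ^ k * c ∈ F (sp z) (m + k) := fun i m k c hc => by
      have := pow_mul_F_le (sp z) k m (Ideal.mul_mem_mul (Ideal.pow_mem_pow (mem_sp z i) k) hc)
      rwa [add_comm k m] at this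
    have h1 := F_cut_le φ hk hab
    rw [map_sub, map_mul, map_mul, map_pow, map_pow] at h1
    obtain ⟨r', hr1, hr2⟩ := hB k (φ a) (φ b) h1
    obtain ⟨r, rfl⟩ := hφ r'
    have hr1' := hK _ (by omega) hr1
    have hr2' := hK _ (by omega) hr2
    change φ a - φ r * φ (z p.castSucc) ^ k ∈ _ at hr1'
    change φ b - φ r * φ (z q.castSucc) ^ k ∈ _ at hr2'
    rw [← map_pow, ← map_mul, ← map_sub] at hr1' hr2'
    obtain ⟨α, hα, c, hc⟩ := exists_of_map φ hφ hk hr1'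
    obtain ⟨β, hβ, c', hc'⟩ := exists_of_map φ hφ hk hr2'
    have h2 : x ^ 1 * (c * xq ^ k - c' * xp ^ k) ∈ F (sp z) (2 * k + n + 1) := by
      have e : x ^ 1 * (c * xq ^ k - c' * xp ^ k) = (a * xq ^ k - b * xp ^ k) - (xq ^ k * α - xp ^ k * β) := by
        linear_combination xp ^ k * hc' - xq ^ k * hc
      rw [e]
      refine sub_mem hab ?_
      rw [show 2 * k + n + 1 = n + 1 + k + k by ring]
      exact sub_mem (hpk _ _ _ _ hα) (hpk _ _ _ _ hβ)
    obtain ⟨s, hs1, hs2⟩ := hZ k c c' (F_cancel_X hz.qreg _ 1 _ _ h2)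
    refine ⟨r + x * s, ?_, ?_⟩
    · have e : a - (r + x * s) * xp ^ k = α + x ^ 1 * (c - s * xp ^ k) := by linear_combination hc
      rw [e]
      refine add_mem hα ?_
      have := hpk (Fin.last D) _ 1 _ hs1
      rwa [show n + k + 1 = n + 1 + k by ring] at this
    · have e : b - (r + x * s) * xq ^ k = β + x ^ 1 * (c' - s * xq ^ k) := by linear_combination hc'
      rw [e]
      refine add_mem hβ ?_
      have := hpk (Fin.last D) _ 1 _ hs2
      rwa [show n + k + 1 = n + 1 + k by ring] at this
  intro k a b hab
  set xp := z p.castSucc with hxp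
  set xq := z q.castSucc with hxq
  obtain ⟨r, hr1, hr2⟩ := key (k + K) (by omega) (a * xp ^ K) (b * xq ^ K) (by
    have e : a * xp ^ K * xq ^ (k + K) - b * xq ^ K * xp ^ (k + K) = (xp * xq) ^ K * (a * xq ^ k - b * xp ^ k) := by ring
    rw [e]
    have h1 : (xp * xq) ^ K ∈ sp z ^ (2 * K) := by
      rw [pow_mul]
      refine Ideal.pow_mem_pow ?_ K
      rw [pow_two]
      exact Ideal.mul_mem_mul (mem_sp z _) (mem_sp z _)
    have := pow_mul_F_le (sp z) _ _ (Ideal.mul_mem_mul h1 hab)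
    rwa [show 2 * K + (2 * k + (n + 1)) = 2 * (k + K) + (n + 1) by ring] at this)
  refine ⟨r, F_cancel_X hz.qreg p.castSucc K _ _ ?_, F_cancel_X hz.qreg q.castSucc K _ _ ?_⟩
  · have e : z p.castSucc ^ K * (a - r * xp ^ k) = a * xp ^ K - r * xp ^ (k + K) := by rw [← hxp]; ring
    rw [e, show n + 1 + k + K = n + 1 + (k + K) by ring]
    exact hr1
  · have e : z q.castSucc ^ K * (b - r * xq ^ k) = b * xq ^ K - r * xq ^ (k + K) := by rw [← hxq]; ring
    rw [e, show n + 1 + k + K = n + 1 + (k + K) by ring]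
    exact hr2

lemma good_lift (hD : 0 < D) (hφ : Function.Surjective φ) (hk : RingHom.ker φ = Ideal.span {z (Fin.last D)})
    (hs : Star z) (hz : Fr z) {p q : Fin D} (hpq : p ≠ q) (hB : Good (cut z φ) p q) :
    Good z p.castSucc q.castSucc := by
  have hZ : ∀ n, Zc z p.castSucc q.castSucc n := by
    intro n
    induction n with
    | zero => exact hz.Z0 (fun h => hpq (Fin.castSucc_injective _ h))
    | succ n ih => exact lift2 φ hD hφ hk hs hz ih (hB.z _ (by omega))
  refine ⟨fun n _ => hZ n, fun n hn f hf => ?_⟩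
  have h1 := hB.red n hn (F_cut_le φ hk hf)
  obtain ⟨m, rfl⟩ : ∃ m, n = m + 1 := ⟨n - 1, by omega⟩
  have h2 := Ideal.mul_mono_right (I := sp (cut z φ)) (lift1 φ hφ hk hs hz (hZ m)) h1
  rw [← sp_cut φ hk, ← Ideal.map_mul] at h2
  obtain ⟨a, ha, b, rfl⟩ := exists_of_map φ hφ hk h2
  refine add_mem ha ?_
  have h3 : a ∈ F (sp z) (m + 1 + 1) := by
    have := pow_mul_F_le (sp z) 1 (m + 1)
    rw [pow_one, add_comm 1] at this
    exact this ha
  have h4 : z (Fin.last D) ^ 1 * b ∈ F (sp z) (m + 1 + 1) := by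
    rw [pow_one]
    have := sub_mem hf h3
    rwa [add_sub_cancel_left] at this
  exact Ideal.mul_mem_mul (mem_sp z _) (F_cancel_X hz.qreg _ 1 _ _ h4)

end cut

/-- Hilbert polynomial data -/
def Hilb {A : Type*} [CommRing A] {D : ℕ} (x : Fin D → A) : Prop :=
  ∃ e : ℕ → ℤ, e 3 = 0 ∧ ∃ N : ℕ, ∀ n, N ≤ n → ∃ L : ℕ, ln (F (sp x) (n + 1)) = L ∧
    (L : ℤ) = ∑ i ∈ Finset.range (D + 1), (-1 : ℤ) ^ i * e i * ((n + D - i).choose (D - i) : ℕ)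

/-- type condition -/
def TT {A : Type*} [CommRing A] [IsLocalRing A] {D : ℕ} (x : Fin D → A) : Prop :=
  ln (F (sp x) 2 ⊔ sp x) ≤ ln ((sp x).colon (maximalIdeal A : Set A)) + 1

section cut
variable {S : Type*} [CommRing S] [IsLocalRing S] [IsNoetherianRing S] {D : ℕ} {z : Fin (D + 1) → S}
  {B : Type*} [CommRing B] [IsLocalRing B] [IsNoetherianRing B] (φ : S →+* B)

lemma cdiv_F (hz : Fr z) (i : Fin (D + 1)) (n : ℕ) : cdiv (F (sp z) (n + 1)) (z i) = F (sp z) n := by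
  ext f
  rw [mem_cdiv]
  constructor
  · intro h; exact F_cancel_X hz.qreg i 1 n f (by rwa [pow_one])
  · intro h
    have := pow_mul_F_le (sp z) 1 n (Ideal.mul_mem_mul (Ideal.pow_mem_pow (mem_sp z i) 1) h)
    rwa [pow_one, add_comm 1] at this

lemma comap_map_eq (hφ : Function.Surjective φ) (hk : RingHom.ker φ = Ideal.span {z (Fin.last D)}) (I : Ideal S) :
    (I.map φ).comap φ = I ⊔ Ideal.span {z (Fin.last D)} := by
  rw [Ideal.comap_map_of_surjective _ hφ, ← RingHom.ker_eq_comap_bot, hk]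

lemma choose_diff (n D i : ℕ) (hi : i ≤ D) : (n + 1 + (D + 1) - i).choose (D + 1 - i) =
    (n + (D + 1) - i).choose (D + 1 - i) + (n + 1 + D - i).choose (D - i) := by
  rw [show n + 1 + (D + 1) - i = (n + 1 + D - i) + 1 by omega, show D + 1 - i = (D - i) + 1 by omega, Nat.choose_succ_succ,
    show n + (D + 1) - i = n + 1 + D - i by omega, add_comm]

lemma hilb_cut (hD : 0 < D) (hφ : Function.Surjective φ) (hk : RingHom.ker φ = Ideal.span {z (Fin.last D)})
    (hs : Star z) (hz : Fr z) (h : Hilb z) : Hilb (cut z φ) := by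
  obtain ⟨e, he, N, hN⟩ := h
  obtain ⟨n1, hn1⟩ := large_cut φ hD hφ hk hs hz
  refine ⟨e, he, N + n1 + 1, fun n hn => ?_⟩
  obtain ⟨m, rfl⟩ : ∃ m, n = m + 1 := ⟨n - 1, by omega⟩
  obtain ⟨L, hL, hL'⟩ := hN (m + 1) (by omega)
  obtain ⟨L1, hL1, hL1'⟩ := hN m (by omega)
  have h1 := ln_colon (F (sp z) (m + 1 + 1)) (z (Fin.last D))
  rw [cdiv_F hz, hL, hL1] at h1
  have h2 : ln (F (sp (cut z φ)) (m + 1 + 1)) = ln (F (sp z) (m + 1 + 1) ⊔ Ideal.span {z (Fin.last D)}) := by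
    rw [← comap_map_eq φ hφ hk, ln_comap φ hφ]
    congr 1
    refine le_antisymm (hn1 _ (by omega)) ?_
    rw [← sp_cut φ hk]
    exact F_map_le φ _ _
  rw [← h2] at h1
  have h3 : ln (F (sp (cut z φ)) (m + 1 + 1)) ≠ ⊤ := by
    intro hc; rw [hc, top_add] at h1; exact ENat.coe_ne_top _ h1
  obtain ⟨L2, hL2⟩ := ENat.ne_top_iff_exists.1 h3
  refine ⟨L2, hL2.symm, ?_⟩
  rw [← hL2] at h1
  have h4 : (L : ℤ) = L2 + L1 := by exact_mod_cast h1
  have h5 : (L2 : ℤ) = L - L1 := by omega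
  rw [h5, hL', hL1', ← Finset.sum_sub_distrib, Finset.sum_range_succ]
  simp only [Nat.sub_self, Nat.choose_zero_right]
  rw [sub_self, add_zero]
  refine Finset.sum_congr rfl fun i hi => ?_
  rw [Finset.mem_range] at hi
  rw [choose_diff m D i (by omega)]
  push_cast
  ring

lemma TT_cut (hφ : Function.Surjective φ) (hk : RingHom.ker φ = Ideal.span {z (Fin.last D)})
    (h : TT z) : TT (cut z φ) := by
  have hmm : ∀ f, φ f ∈ maximalIdeal B ↔ f ∈ maximalIdeal S := fun f => by
    rw [← map_maximalIdeal φ hφ, Ideal.mem_comap]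
  have hJ : ∀ f, φ f ∈ sp (cut z φ) ↔ f ∈ sp z := by
    intro f
    rw [← sp_cut φ hk, ← Ideal.mem_comap, comap_map_eq φ hφ hk, sup_eq_left.2]
    rw [Ideal.span_singleton_le_iff_mem]; exact mem_sp z _
  unfold TT at *
  have h1 : ((sp (cut z φ)).colon (maximalIdeal B : Set B)).comap φ = (sp z).colon (maximalIdeal S : Set S) := by
    ext f
    rw [Ideal.mem_comap, Submodule.mem_colon, Submodule.mem_colon]
    constructor
    · intro h g hg
      have := h (φ g) ((hmm g).2 hg)
      rw [smul_eq_mul, ← map_mul, hJ] at this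
      exact this
    · intro h g hg
      obtain ⟨g, rfl⟩ := hφ g
      have := h g ((hmm g).1 hg)
      rw [smul_eq_mul, ← map_mul, hJ]
      exact this
  rw [← ln_comap φ hφ, ← ln_comap φ hφ ((sp (cut z φ)).colon (maximalIdeal B : Set B)), h1]
  refine le_trans (ln_anti ?_) h
  refine sup_le (fun f hf => ?_) (fun f hf => ?_)
  · exact Ideal.mem_sup_left (F_cut_le φ hk hf)
  · exact Ideal.mem_sup_right ((hJ f).2 hf)
end cut

section ext
variable {A : Type*} [CommRing A] [IsLocalRing A] [IsNoetherianRing A] {D : ℕ} {y : Fin (D + 1) → A}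

lemma F_zS (n : ℕ) : F (sp (zS y)) n = (F (sp y) n).map co := by
  rw [sp_zS, F_co]

lemma fr_zS (h : Fr y) : Fr (zS y) := by
  have hm : (maximalIdeal A).map co = maximalIdeal (SS A D) := max_SS.symm
  refine ⟨qreg_zS h.qreg, fun i => ?_, ?_, ?_⟩
  · have h1 : sp (zS y) ≤ maximalIdeal (SS A D) := by
      rw [sp_zS, ← hm]
      exact Ideal.map_mono (Ideal.span_le.2 (by rintro _ ⟨i, rfl⟩; exact h.mem i))
    exact h1 (mem_sp _ _)
  · obtain ⟨k0, hk⟩ := h.fin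
    refine ⟨k0, fun n => ?_⟩
    rw [F_zS, sp_zS, ← Ideal.map_pow]
    exact Ideal.map_mono (hk n)
  · rw [F_zS, ← hm]
    exact Ideal.map_mono h.max

lemma hilb_zS (h : Hilb y) : Hilb (zS y) := by
  obtain ⟨e, he, N, hN⟩ := h
  refine ⟨e, he, N, fun n hn => ?_⟩
  rw [F_zS, ln_co]
  exact hN n hn

lemma TT_zS (h : TT y) : TT (zS y) := by
  unfold TT at *
  have h1 : (sp (zS y)).colon (maximalIdeal (SS A D) : Set (SS A D)) = ((sp y).colon (maximalIdeal A : Set A)).map co := by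
    ext f
    rw [← map_colon, Submodule.mem_colon, sp_zS]
    rfl
  rw [h1, F_zS, sp_zS, ← Ideal.map_sup, ln_co, ln_co]
  exact h

lemma good_desc {p q : Fin D} (h : Good (zS y) p.castSucc q.castSucc) : Good y p.castSucc q.castSucc := by
  refine ⟨fun n hn k a b hab => ?_, fun n hn f hf => ?_⟩
  · have h1 : co (e := D) (a * y q.castSucc ^ k - b * y p.castSucc ^ k) ∈ F (sp (zS y)) (2 * k + n) := by
      rw [F_zS]; exact Ideal.mem_map_of_mem _ hab
    rw [map_sub, map_mul, map_mul, map_pow, map_pow, ← zS_cast, ← zS_cast] at h1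
    obtain ⟨r, hr1, hr2⟩ := h.z n hn k _ _ h1
    rw [F_zS, zS_cast, ← map_pow] at hr1 hr2
    obtain ⟨r', hr'⟩ := descent (ι := Fin 2) (fun _ => F (sp y) (n + k)) ![a, b] ![y p.castSucc ^ k, y q.castSucc ^ k] r
      (by intro i; fin_cases i; exacts [hr1, hr2])
    exact ⟨r', hr' 0, hr' 1⟩
  · have h1 : co (e := D) f ∈ F (sp (zS y)) (n + 1) := by
      rw [F_zS]; exact Ideal.mem_map_of_mem _ hf
    have h2 := h.red n hn h1
    rw [F_zS, sp_zS, ← Ideal.map_mul] at h2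
    exact (co_mem_map _ _).1 h2
end ext
end RN2

namespace RN2

section dim2
variable {B : Type*} [CommRing B] [IsLocalRing B] [IsNoetherianRing B] {y : Fin 2 → B}

lemma mem_two {B : Type*} [CommRing B] {a b f : B} : f ∈ Ideal.span {a} ⊔ Ideal.span {b} ↔ ∃ c d, f = a * c + b * d := by
  constructor
  · intro h
    obtain ⟨s, hs, t, ht, rfl⟩ := Submodule.mem_sup.1 h
    obtain ⟨c, rfl⟩ := Ideal.mem_span_singleton.1 hs
    obtain ⟨d, rfl⟩ := Ideal.mem_span_singleton.1 ht
    exact ⟨c, d, rfl⟩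
  · rintro ⟨c, d, rfl⟩
    exact Submodule.add_mem_sup (Ideal.mul_mem_right _ _ (Ideal.mem_span_singleton_self _))
      (Ideal.mul_mem_right _ _ (Ideal.mem_span_singleton_self _))

lemma mem_supspan {B : Type*} [CommRing B] {I : Ideal B} {b f : B} : f ∈ I ⊔ Ideal.span {b} ↔ ∃ c ∈ I, ∃ d, f = c + b * d := by
  constructor
  · intro h
    obtain ⟨s, hs, t, ht, rfl⟩ := Submodule.mem_sup.1 h
    obtain ⟨d, rfl⟩ := Ideal.mem_span_singleton.1 ht
    exact ⟨s, hs, d, rfl⟩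
  · rintro ⟨c, hc, d, rfl⟩
    exact Submodule.add_mem_sup hc (Ideal.mul_mem_right _ _ (Ideal.mem_span_singleton_self _))

lemma mem_sp2 {f : B} : f ∈ sp y ↔ ∃ c d, f = y 0 * c + y 1 * d := by
  rw [← mem_two, ← Ideal.span_union]
  have : Set.range y = {y 0} ∪ {y 1} := by
    ext t; simp [Fin.exists_fin_two, eq_comm]; tauto
  rw [sp, this]

/-- multiplication by a power of a generator -/
lemma mulF {B : Type*} [CommRing B] {D : ℕ} (y : Fin D → B) (i : Fin D) (k : ℕ) {m : ℕ} {c : B} (hc : c ∈ F (sp y) m) : y i ^ k * c ∈ F (sp y) (m + k) := by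
  have := pow_mul_F_le (sp y) k m (Ideal.mul_mem_mul (Ideal.pow_mem_pow (mem_sp y i) k) hc)
  rwa [add_comm k m] at this

lemma reg01 (h : Fr y) (a b : ℕ) (i j : Fin 2) (hij : i ≠ j) : Reg (y i ^ a) (Ideal.span {y j ^ b}) := by
  have h1 : Reg (y i) (⊥ ⊔ Ideal.span {y j}) := by
    rw [bot_sup_eq]; exact h.qreg.reg_one h.mem hij
  have h2 : Reg (y j) (⊥ : Ideal B) := by
    intro f hf
    exact h.qreg.eq_zero h.mem j hf
  have := (h1.sup_pow h2 b).pow a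
  rwa [bot_sup_eq] at this

lemma pow_eq_zero' (h : Fr y) (i : Fin 2) (a : ℕ) {f : B} (hf : y i ^ a * f = 0) : f = 0 := by
  induction a with
  | zero => simpa using hf
  | succ a ih =>
    apply ih
    rw [pow_succ', mul_assoc] at hf
    exact h.qreg.eq_zero h.mem i hf

/-- the auxiliary ideal -/
def Qd (y : Fin 2 → B) : Ideal B where
  carrier := {f | ∃ p0, ∀ p, p0 ≤ p → y 0 ^ p * f ∈ F (sp y) (p + 2) ⊔ Ideal.span {y 1}}
  zero_mem' := ⟨0, fun p _ => by rw [mul_zero]; exact zero_mem _⟩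
  add_mem' := by
    rintro f g ⟨p, hp⟩ ⟨q, hq⟩
    refine ⟨p + q, fun r hr => ?_⟩
    rw [mul_add]
    exact add_mem (hp r (by omega)) (hq r (by omega))
  smul_mem' := by
    rintro c f ⟨p, hp⟩
    refine ⟨p, fun r hr => ?_⟩
    rw [smul_eq_mul, mul_left_comm]
    exact Ideal.mul_mem_left _ _ (hp r hr)

lemma mem_Qd {f : B} : f ∈ Qd y ↔ ∃ p0, ∀ p, p0 ≤ p → y 0 ^ p * f ∈ F (sp y) (p + 2) ⊔ Ideal.span {y 1} := Iff.rfl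

lemma mem_Qd_of {f : B} {p : ℕ} (h : y 0 ^ p * f ∈ F (sp y) (p + 2) ⊔ Ideal.span {y 1}) : f ∈ Qd y := by
  refine mem_Qd.2 ⟨p, fun r hr => ?_⟩
  obtain ⟨s, rfl⟩ := Nat.exists_eq_add_of_le hr
  obtain ⟨c, hc, d, hcd⟩ := mem_supspan.1 h
  refine mem_supspan.2 ⟨y 0 ^ s * c, ?_, y 0 ^ s * d, ?_⟩
  · have := mulF y 0 s hc
    rwa [show p + 2 + s = p + s + 2 by ring] at this
  · rw [pow_add, mul_right_comm, hcd]; ring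

lemma dim2_case1 (hf : Fr y) (hA : ∀ a b, F (sp y) (a + b + 1) ≤ Ideal.span {y 0 ^ a} ⊔ Ideal.span {y 1 ^ b})
    (hQ : Qd y ≤ F (sp y) 2 ⊔ Ideal.span {y 1}) : Good y 0 1 := by
  have red : ∀ n, 2 ≤ n → F (sp y) (n + 1) ≤ sp y * F (sp y) n := by
    intro n hn f hfn
    obtain ⟨m, rfl⟩ : ∃ m, n = m + 2 := ⟨n - 2, by omega⟩
    obtain ⟨c, d, rfl⟩ := mem_two.1 (hA (m + 1) 1 hfn)
    rw [pow_one] at *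
    have h1 : c ∈ Qd y := by
      refine mem_Qd_of (p := m + 1) (mem_supspan.2 ⟨_, hfn, -d, ?_⟩)
      ring
    obtain ⟨c2, hc2, d', rfl⟩ := mem_supspan.1 (hQ h1)
    have e : y 0 ^ (m + 1) * (c2 + y 1 * d') + y 1 * d = y 0 * (y 0 ^ m * c2) + y 1 * (y 0 ^ (m + 1) * d' + d) := by ring
    rw [e] at hfn ⊢
    have h2 : y 0 ^ m * c2 ∈ F (sp y) (m + 2) := by
      have := mulF y 0 m hc2; rwa [add_comm 2 m] at this
    refine add_mem (Ideal.mul_mem_mul (mem_sp _ _) h2) (Ideal.mul_mem_mul (mem_sp _ _) ?_)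
    refine F_cancel_X hf.qreg 1 1 _ _ ?_
    rw [pow_one]
    have h3 := mulF y 0 1 h2
    rw [pow_one] at h3
    have := sub_mem hfn h3
    rwa [add_sub_cancel_left] at this
  have split : ∀ s α β, α + β = s → ∀ f ∈ F (sp y) (α + β + 1), ∃ g ∈ F (sp y) (β + 1), ∃ h ∈ F (sp y) (α + 1),
      f = y 0 ^ α * g + y 1 ^ β * h := by
    intro s
    induction s with
    | zero =>
      intro α β hs f hf
      obtain rfl : α = 0 := by omega
      obtain rfl : β = 0 := by omega
      exact ⟨f, hf, 0, zero_mem _, by simp⟩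
    | succ s ih =>
      intro α β hs f hf
      rcases Nat.eq_zero_or_pos α with rfl | hα
      · exact ⟨f, by simpa using hf, 0, zero_mem _, by simp⟩
      rcases Nat.eq_zero_or_pos β with rfl | hβ
      · exact ⟨0, zero_mem _, f, by simpa using hf, by simp⟩
      obtain ⟨α, rfl⟩ : ∃ m, α = m + 1 := ⟨α - 1, by omega⟩
      obtain ⟨β, rfl⟩ : ∃ m, β = m + 1 := ⟨β - 1, by omega⟩
      have h1 := red (α + 1 + (β + 1)) (by omega) hf
      have h2 : ∃ a ∈ F (sp y) (α + 1 + (β + 1)), ∃ b ∈ F (sp y) (α + 1 + (β + 1)), f = y 0 * a + y 1 * b := by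
        refine Submodule.mul_induction_on h1 ?_ ?_
        · intro r hr t ht
          obtain ⟨c, d, rfl⟩ := mem_sp2.1 hr
          exact ⟨c * t, Ideal.mul_mem_left _ _ ht, d * t, Ideal.mul_mem_left _ _ ht, by ring⟩
        · rintro _ _ ⟨a, ha, b, hb, rfl⟩ ⟨a', ha', b', hb', rfl⟩
          exact ⟨a + a', add_mem ha ha', b + b', add_mem hb hb', by ring⟩
      obtain ⟨a, ha, b, hb, rfl⟩ := h2
      obtain ⟨g1, hg1, h1', hh1, rfl⟩ := ih α (β + 1) (by omega) a (by rwa [show α + (β + 1) + 1 = α + 1 + (β + 1) by ring])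
      obtain ⟨g2, hg2, h2', hh2, rfl⟩ := ih (α + 1) β (by omega) b (by rwa [show α + 1 + β + 1 = α + 1 + (β + 1) by ring])
      refine ⟨g1 + y 1 * g2, add_mem hg1 ?_, y 0 * h1' + h2', add_mem ?_ hh2, by ring⟩
      · have := mulF y 1 1 hg2; rwa [pow_one] at this
      · have := mulF y 0 1 hh1; rwa [pow_one] at this
  refine ⟨fun n hn k a b hab => ?_, red⟩
  obtain ⟨m, rfl⟩ : ∃ m, n = m + 1 := ⟨n - 1, by omega⟩
  obtain ⟨h, hh, g, hg, e⟩ := split _ k (k + m) rfl _ (by rwa [show k + (k + m) + 1 = 2 * k + (m + 1) by ring])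
  have hg' := mulF y 1 m hg
  rw [show k + 1 + m = m + 1 + k by ring] at hg'
  rw [show k + m + 1 = m + 1 + k by ring] at hh
  have e2 : y 1 ^ k * (a - y 1 ^ m * g) ∈ Ideal.span {y 0 ^ k} := by
    refine Ideal.mem_span_singleton.2 ⟨b + h, ?_⟩
    rw [pow_add] at e
    linear_combination e
  obtain ⟨r, hr⟩ := Ideal.mem_span_singleton.1 (reg01 hf k k 1 0 (by decide) _ e2)
  refine ⟨r, ?_, ?_⟩
  · have : a - r * y 0 ^ k = y 1 ^ m * g := by linear_combination hr
    rwa [this]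
  · have h0 : y 0 ^ k * (b + h - r * y 1 ^ k) = 0 := by
      rw [pow_add] at e
      linear_combination -e + y 1 ^ k * hr
    have h1 := pow_eq_zero' hf 0 k h0
    have : b - r * y 1 ^ k = -h := by linear_combination h1
    rw [this]
    exact neg_mem hh

lemma Qd_mul (hf : Fr y) (hA : ∀ a b, F (sp y) (a + b + 1) ≤ Ideal.span {y 0 ^ a} ⊔ Ideal.span {y 1 ^ b}) :
    Qd y ≤ (sp y).colon (maximalIdeal B : Set B) := by
  intro f hfQ
  rw [Submodule.mem_colon]
  intro g hg
  obtain ⟨p, hp⟩ := mem_Qd.1 hfQ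
  obtain ⟨c, hc, d, hcd⟩ := mem_supspan.1 (hp p le_rfl)
  have h1 : c * g ∈ F (sp y) (p + 1 + 1 + 1) := by
    have := F_mul_mem (sp y) hc (hf.max hg)
    rwa [show p + 2 + 1 = p + 1 + 1 + 1 by ring] at this
  obtain ⟨s, t, hst⟩ := mem_two.1 (hA (p + 1) 1 h1)
  rw [pow_one] at hst
  have h2 : y 0 ^ p * (f * g) ∈ Ideal.span {y 1} ⊔ Ideal.span {y 0 ^ (1 + p)} := by
    refine mem_two.2 ⟨t + d * g, s, ?_⟩
    rw [add_comm 1 p]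
    linear_combination g * hcd + hst
  have h3 := Reg.cancel_pow (I := Ideal.span {y 1}) (hf.qreg.reg_one hf.mem (by decide)) 1 p h2
  rw [pow_one] at h3
  obtain ⟨s, t, h⟩ := mem_two.1 h3
  rw [smul_eq_mul]
  exact mem_sp2.2 ⟨t, s, by rw [h]; ring⟩

lemma Qd_inf (hf : Fr y) (hA : ∀ a b, F (sp y) (a + b + 1) ≤ Ideal.span {y 0 ^ a} ⊔ Ideal.span {y 1 ^ b})
    {f : B} (h : f ∈ Qd y) (hJ : f ∈ sp y) : f ∈ F (sp y) 2 ⊔ Ideal.span {y 1} := by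
  obtain ⟨c, d, rfl⟩ := mem_sp2.1 hJ
  by_cases hc : c ∈ maximalIdeal B
  · refine mem_supspan.2 ⟨y 0 * c, ?_, d, rfl⟩
    have := mulF y 0 1 (hf.max hc); rwa [pow_one] at this
  exfalso
  have hu : IsUnit c := by
    by_contra h; exact hc ((mem_maximalIdeal _).2 h)
  obtain ⟨v, hv⟩ := hu.exists_right_inv
  obtain ⟨p, hp⟩ := mem_Qd.1 h
  obtain ⟨a, ha, b, hab⟩ := mem_supspan.1 (hp p le_rfl)
  -- u^(p+1) ∈ F_(p+2) + (v)
  have h1 : y 0 ^ (p + 1) = a * v + y 1 * (v * b - y 0 ^ p * d * v) := by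
    linear_combination v * hab - y 0 ^ (p + 1) * hv
  have h2 : (a * v) ^ 3 ∈ F (sp y) (3 * p + 4 + 1 + 1) := by
    have := F_pow_mem (sp y) (Ideal.mul_mem_right v _ ha) 3
    rwa [show 3 * (p + 2) = 3 * p + 4 + 1 + 1 by ring] at this
  obtain ⟨s, t, hst⟩ := mem_two.1 (hA (3 * p + 4) 1 h2)
  have h3 : y 0 ^ (3 * p + 3) * 1 ∈ Ideal.span {y 1} ⊔ Ideal.span {y 0 ^ (1 + (3 * p + 3))} := by
    set w := v * b - y 0 ^ p * d * v
    refine mem_two.2 ⟨t + 3 * (a * v) ^ 2 * w + 3 * (a * v) * y 1 * w ^ 2 + y 1 ^ 2 * w ^ 3, s, ?_⟩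
    rw [pow_one] at hst
    have e : y 0 ^ (3 * p + 3) = (a * v + y 1 * w) ^ 3 := by rw [← h1]; ring
    rw [mul_one, e]
    linear_combination hst
  have h4 := Reg.cancel_pow (I := Ideal.span {y 1}) (hf.qreg.reg_one hf.mem (by decide)) 1 _ h3
  rw [pow_one] at h4
  have h5 : Ideal.span {y 1} ⊔ Ideal.span {y 0} ≤ maximalIdeal B :=
    sup_le ((Ideal.span_singleton_le_iff_mem _).2 (hf.mem 1)) ((Ideal.span_singleton_le_iff_mem _).2 (hf.mem 0))
  exact (Ideal.ne_top_iff_one _).1 (maximalIdeal.isMaximal B).ne_top (h5 h4)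

lemma dim2_case2 (hf : Fr y) (hA : ∀ a b, F (sp y) (a + b + 1) ≤ Ideal.span {y 0 ^ a} ⊔ Ideal.span {y 1 ^ b})
    (hQ : (sp y).colon (maximalIdeal B : Set B) ≤ Qd y ⊔ sp y) : Qd y ≤ F (sp y) 2 ⊔ Ideal.span {y 1} := by
  set u := y 0 with hu
  set v := y 1 with hv
  obtain ⟨n0, hn0⟩ := F_stable hf.fin
  have step1 : ∀ j, ∀ f ∈ F (sp y) (n0 + j + 1), ∃ h ∈ F (sp y) n0, ∃ g ∈ F (sp y) (n0 + j), f = u ^ (j + 1) * h + v * g := by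
    intro j
    have hred : ∀ n, n0 ≤ n → ∀ f ∈ F (sp y) (n + 1), ∃ a ∈ F (sp y) n, ∃ b ∈ F (sp y) n, f = y 0 * a + y 1 * b := by
      intro n hn f hf
      rw [hn0 n hn] at hf
      refine Submodule.mul_induction_on hf ?_ ?_
      · intro r hr t ht
        obtain ⟨c, d, rfl⟩ := mem_sp2.1 hr
        exact ⟨c * t, Ideal.mul_mem_left _ _ ht, d * t, Ideal.mul_mem_left _ _ ht, by ring⟩
      · rintro _ _ ⟨a, ha, b, hb, rfl⟩ ⟨a', ha', b', hb', rfl⟩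
        exact ⟨a + a', add_mem ha ha', b + b', add_mem hb hb', by ring⟩
    induction j with
    | zero =>
      intro f hf
      obtain ⟨a, ha, b, hb, rfl⟩ := hred n0 le_rfl f hf
      exact ⟨a, ha, b, hb, by ring⟩
    | succ j ih =>
      intro f hf
      obtain ⟨a, ha, b, hb, rfl⟩ := hred (n0 + j + 1) (by omega) f hf
      obtain ⟨h, hh, g, hg, rfl⟩ := ih a ha
      refine ⟨h, hh, u * g + b, add_mem ?_ hb, by ring⟩
      have := mulF y 0 1 hg; rwa [pow_one] at this
  have star : ∀ k, n0 ≤ k → 1 ≤ k → ∀ f ∈ F (sp y) (2 * k + 1), ∃ p, ∃ c1 ∈ F (sp y) (k + p + 1), ∃ c2 ∈ F (sp y) (k + p + 1),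
      f * (u * v) ^ p = u ^ (k + p) * c1 + v ^ (k + p) * c2 := by
    intro k hk hk1 f hff
    obtain ⟨h0, hh0, g, hg, rfl⟩ := step1 (2 * k - n0) f (by rwa [show n0 + (2 * k - n0) + 1 = 2 * k + 1 by omega])
    rw [show n0 + (2 * k - n0) = 2 * k by omega] at hg
    obtain ⟨s, hs⟩ : ∃ s, 2 * k - n0 + 1 = k + s := ⟨k - n0 + 1, by omega⟩
    have hs' : n0 + s = k + 1 := by omega
    have hh := mulF y 0 s hh0
    rw [hs'] at hh
    set h := u ^ s * h0 with hhdef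
    have e0 : u ^ (2 * k - n0 + 1) * h0 + v * g = u ^ k * h + v * g := by rw [hs, hhdef]; ring
    rw [e0]
    obtain ⟨k, rfl⟩ : ∃ m, k = m + 1 := ⟨k - 1, by omega⟩
    -- g in the socle
    have hgm : ∀ m ∈ maximalIdeal B, g * m ∈ Ideal.span {y 0 ^ (k+1)} ⊔ Ideal.span {y 1 ^ (k+1)} := by
      intro m hm
      refine hA (k+1) (k+1) ?_
      have := F_mul_mem (sp y) hg (hf.max hm)
      rwa [show 2 * (k + 1) + 1 = k + 1 + (k + 1) + 1 by ring] at this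
    have r0 : ∀ b, Reg u (Ideal.span {v ^ b}) := fun b => by
      have := reg01 hf 1 b 0 1 (by decide); rwa [pow_one] at this
    have r1 : ∀ b, Reg v (Ideal.span {u ^ b}) := fun b => by
      have := reg01 hf 1 b 1 0 (by decide); rwa [pow_one] at this
    have hg1 : g ∈ Ideal.span {v ^ (k + 1)} ⊔ Ideal.span {u ^ k} := by
      refine Reg.cancel_pow (r0 _) k 1 ?_
      rw [pow_one, mul_comm, sup_comm]
      exact hgm _ (hf.mem 0)
    obtain ⟨β, g1, hg1⟩ := mem_two.1 hg1
    have hg2 : v * g1 ∈ Ideal.span {v ^ (k + 1)} ⊔ Ideal.span {u ^ 1} := by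
      refine Reg.cancel_pow (r0 _) 1 k ?_
      obtain ⟨s, t, hst⟩ := mem_two.1 (hgm _ (hf.mem 1))
      refine mem_two.2 ⟨t - v * β, s, ?_⟩
      rw [add_comm 1 k]
      rw [hg1] at hst
      linear_combination hst
    have hg3 : g1 ∈ Ideal.span {u ^ 1} ⊔ Ideal.span {v ^ k} := by
      refine Reg.cancel_pow (r1 _) k 1 ?_
      rwa [pow_one v, sup_comm]
    obtain ⟨α, w, hw⟩ := mem_two.1 hg3
    have hg4 : g = w * (u * v) ^ k + u ^ (k + 1) * α + v ^ (k + 1) * β := by rw [hg1, hw]; ring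
    have hwc : w ∈ (sp y).colon (maximalIdeal B : Set B) := by
      rw [Submodule.mem_colon]
      intro m hm
      rw [smul_eq_mul]
      have h1 : v ^ k * (w * m) ∈ Ideal.span {v ^ (k + 1)} ⊔ Ideal.span {u ^ 1} := by
        refine Reg.cancel_pow (r0 _) 1 k ?_
        obtain ⟨s, t, hst⟩ := mem_two.1 (hgm m hm)
        refine mem_two.2 ⟨t - β * m, s - α * m, ?_⟩
        rw [hg4] at hst
        rw [add_comm 1 k]
        linear_combination hst
      have h2 : w * m ∈ Ideal.span {u ^ 1} ⊔ Ideal.span {v ^ 1} := by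
        refine Reg.cancel_pow (r1 _) 1 k ?_
        rwa [sup_comm, add_comm 1 k]
      rw [pow_one, pow_one] at h2
      obtain ⟨s, t, e⟩ := mem_two.1 h2
      exact mem_sp2.2 ⟨s, t, e⟩
    obtain ⟨q, hq, j, hj, rfl⟩ := Submodule.mem_sup.1 (hQ hwc)
    obtain ⟨c, c', rfl⟩ := mem_sp2.1 hj
    obtain ⟨p, hp⟩ := mem_Qd.1 hq
    obtain ⟨a, ha, b, hab⟩ := mem_supspan.1 (hp p le_rfl)
    change u ^ p * q = a + v * b at hab
    set α1 := v ^ p * (α + v ^ k * c) with hα1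
    set β1 := u ^ p * (β + u ^ k * c') + b * u ^ k with hβ1
    have e1 : g * (u * v) ^ p = a * u ^ k * v ^ (k + p) + u ^ (k + 1 + p) * α1 + v ^ (k + 1 + p) * β1 := by
      rw [hg4, hα1, hβ1]
      have : (u * v) ^ (k + p) * q = u ^ k * v ^ (k + p) * (a + v * b) := by rw [← hab]; ring
      linear_combination this
    have hak : a * u ^ k ∈ F (sp y) (k + 1 + p + 1) := by
      have := mulF y 0 k ha
      rwa [mul_comm, show p + 2 + k = k + 1 + p + 1 by ring] at this
    have hz : β1 * v ^ (k + 1 + p) - (- α1) * u ^ (k + 1 + p) ∈ F (sp y) (2 * (k + 1 + p)) := by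
      have e : β1 * v ^ (k + 1 + p) - (- α1) * u ^ (k + 1 + p) = g * (u * v) ^ p - v ^ (k + p) * (a * u ^ k) := by
        linear_combination -e1
      rw [e]
      refine sub_mem ?_ ?_
      · have := mulF y 0 p (mulF y 1 p hg)
        rw [show 2 * (k + 1) + p + p = 2 * (k + 1 + p) by ring] at this
        rwa [show g * (u * v) ^ p = y 0 ^ p * (y 1 ^ p * g) by ring]
      · have := mulF y 1 (k + p) hak
        rwa [show k + 1 + p + 1 + (k + p) = 2 * (k + 1 + p) by ring] at this
    have hβF : β1 ∈ F (sp y) (k + 1 + p) := Z0 hf.qreg (p := 0) (q := 1) (by decide) hf.fin _ _ _ hz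
    have hαF : - α1 ∈ F (sp y) (k + 1 + p) := by
      refine Z0 hf.qreg (p := 1) (q := 0) (by decide) hf.fin _ _ β1 ?_
      have := neg_mem hz
      rwa [neg_sub] at this
    have hαF' : α1 ∈ F (sp y) (k + 1 + p) := by
      have := neg_mem hαF
      rwa [neg_neg] at this
    refine ⟨p, v ^ p * h + v * α1, add_mem ?_ ?_, a * u ^ k + v * β1, add_mem hak ?_, ?_⟩
    · have := mulF y 1 p hh
      rwa [show k + 1 + 1 + p = k + 1 + p + 1 by ring] at this
    · have := mulF y 1 1 hαF'; rwa [pow_one] at this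
    · have := mulF y 1 1 hβF; rwa [pow_one] at this
    · linear_combination v * e1
  -- conclusion
  intro f hfQ
  obtain ⟨p0, hp0⟩ := mem_Qd.1 hfQ
  obtain ⟨P, hP1, hP2⟩ : ∃ P, p0 ≤ P + 1 ∧ n0 ≤ P + 1 := ⟨p0 + n0, by omega, by omega⟩
  obtain ⟨a, ha, b, hab⟩ := mem_supspan.1 (hp0 _ hP1)
  change u ^ (P + 1) * f = a + v * b at hab
  obtain ⟨p, c1, hc1, c2, hc2, e⟩ := star (P + 1) hP2 (by omega) (v ^ P * a) (by
    have := mulF y 1 P ha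
    rwa [show P + 1 + 2 + P = 2 * (P + 1) + 1 by ring] at this)
  have h1 : u ^ (P + 1 + p) * c1 ∈ Ideal.span {v ^ (P + p)} := by
    refine Ideal.mem_span_singleton.2 ⟨a * u ^ p - v * c2, ?_⟩
    linear_combination -e
  obtain ⟨c', rfl⟩ := Ideal.mem_span_singleton.1 (reg01 hf (P + 1 + p) (P + p) 0 1 (by decide) _ h1)
  have hc' : c' ∈ F (sp y) 2 := by
    refine F_cancel_X hf.qreg 1 (P + p) _ _ ?_
    rwa [show 2 + (P + p) = P + 1 + p + 1 by ring]
  have h2 : v ^ (P + p) * (a * u ^ p - v * c2 - u ^ (P + 1 + p) * c') = 0 := by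
    linear_combination e
  have h3 := pow_eq_zero' hf 1 _ h2
  have h4 : u ^ (P + 1 + p) * (f - c') ∈ Ideal.span {v ^ 1} := by
    refine Ideal.mem_span_singleton.2 ⟨u ^ p * b + c2, ?_⟩
    linear_combination u ^ p * hab + h3
  obtain ⟨d, hd⟩ := Ideal.mem_span_singleton.1 (reg01 hf (P + 1 + p) 1 0 1 (by decide) _ h4)
  refine mem_supspan.2 ⟨c', hc', d, ?_⟩
  rw [pow_one] at hd
  linear_combination hd

lemma dim2 (hf : Fr y) (hA : ∀ a b, F (sp y) (a + b + 1) ≤ Ideal.span {y 0 ^ a} ⊔ Ideal.span {y 1 ^ b})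
    (hT : TT y) (hfin : ln (sp y) ≠ ⊤) : Good y 0 1 := by
  refine dim2_case1 hf hA ?_
  have hJQ : sp y ≤ (sp y).colon (maximalIdeal B : Set B) := by
    intro f hf
    rw [Submodule.mem_colon]
    intro g _
    exact Ideal.mul_mem_right _ _ hf
  have hle : Qd y ⊔ sp y ≤ (sp y).colon (maximalIdeal B : Set B) := sup_le (Qd_mul hf hA) hJQ
  have hFQ : F (sp y) 2 ⊔ sp y ≤ Qd y ⊔ sp y := by
    refine sup_le_sup_right (fun f hf => mem_Qd_of (p := 0) ?_) _
    simpa using Ideal.mem_sup_left hf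
  by_cases hc : (sp y).colon (maximalIdeal B : Set B) ≤ Qd y ⊔ sp y
  · exact dim2_case2 hf hA hc
  have hfin2 : ∀ K, sp y ≤ K → ln K ≠ ⊤ := fun K hK => ne_top_of_le_ne_top hfin (ln_anti hK)
  have h1 : ln ((sp y).colon (maximalIdeal B : Set B)) < ln (Qd y ⊔ sp y) := by
    by_contra h
    push Not at h
    exact hc (ln_eq_of_le hle h (hfin2 _ le_sup_right)).ge
  have h2 : F (sp y) 2 ⊔ sp y = Qd y ⊔ sp y := by
    refine ln_eq_of_le hFQ (hT.trans ?_) (hfin2 _ le_sup_right)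
    exact Order.add_one_le_of_lt h1
  intro f hfQ
  have h3 : f ∈ F (sp y) 2 ⊔ sp y := by rw [h2]; exact Ideal.mem_sup_left hfQ
  obtain ⟨f2, hf2, j, hj, rfl⟩ := Submodule.mem_sup.1 h3
  have h4 : f2 ∈ Qd y := mem_Qd_of (p := 0) (by simpa using Ideal.mem_sup_left hf2)
  have h5 : j ∈ Qd y := by
    have := sub_mem hfQ h4
    rwa [add_sub_cancel_left] at this
  exact add_mem (Ideal.mem_sup_left hf2) (Qd_inf hf hA h5 hj)

end dim2
end RN2

namespace RN2

section base
variable {S : Type*} [CommRing S] [IsLocalRing S] [IsNoetherianRing S]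

lemma ln_sup_pow (I : Ideal S) (x : S) (k : ℕ) : ln (I ⊔ Ideal.span {x ^ k}) ≤ k * ln (I ⊔ Ideal.span {x}) := by
  induction k with
  | zero =>
    have : I ⊔ Ideal.span {x ^ 0} = ⊤ := by simp
    rw [this, ln_top]; simp
  | succ k ih =>
    rw [ln_colon _ x]
    have h1 : ln (I ⊔ Ideal.span {x ^ (k + 1)} ⊔ Ideal.span {x}) ≤ ln (I ⊔ Ideal.span {x}) :=
      ln_anti (sup_le (le_sup_left.trans le_sup_left) le_sup_right)
    have h2 : ln (cdiv (I ⊔ Ideal.span {x ^ (k + 1)}) x) ≤ ln (I ⊔ Ideal.span {x ^ k}) := by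
      refine ln_anti (fun f hf => ?_)
      rw [mem_cdiv]
      obtain ⟨c, hc, d, rfl⟩ := mem_supspan.1 hf
      exact mem_supspan.2 ⟨x * c, Ideal.mul_mem_left _ _ hc, d, by ring⟩
    calc _ ≤ ln (I ⊔ Ideal.span {x}) + k * ln (I ⊔ Ideal.span {x}) := add_le_add h1 (h2.trans ih)
      _ = _ := by push_cast; ring

def qk (z : Fin 3 → S) (a b c : ℕ) : Ideal S := Ideal.span {z 0 ^ a} ⊔ Ideal.span {z 1 ^ b} ⊔ Ideal.span {z 2 ^ c}

lemma sp3 (z : Fin 3 → S) : sp z = Ideal.span {z 0} ⊔ Ideal.span {z 1} ⊔ Ideal.span {z 2} := by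
  rw [← Ideal.span_union, ← Ideal.span_union, sp]
  congr 1
  ext t
  simp only [Set.mem_range, Set.mem_union, Set.mem_singleton_iff, Fin.exists_fin_succ, Fin.exists_fin_zero]
  constructor
  · rintro (h | h | h | h)
    · exact Or.inl (Or.inl h.symm)
    · exact Or.inl (Or.inr h.symm)
    · exact Or.inr h.symm
    · exact h.elim
  · rintro ((h | h) | h)
    · exact Or.inl h.symm
    · exact Or.inr (Or.inl h.symm)
    · exact Or.inr (Or.inr (Or.inl h.symm))

lemma ln_qk (z : Fin 3 → S) (k : ℕ) : ln (qk z k k k) ≤ (k ^ 3 : ℕ) * ln (sp z) := by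
  unfold qk
  have h1 := ln_sup_pow (Ideal.span {z 0 ^ k} ⊔ Ideal.span {z 1 ^ k}) (z 2) k
  have h2 := ln_sup_pow (Ideal.span {z 0 ^ k} ⊔ Ideal.span {z 2}) (z 1) k
  have h3 := ln_sup_pow (Ideal.span {z 1} ⊔ Ideal.span {z 2}) (z 0) k
  rw [sup_right_comm] at h2
  have e3 : Ideal.span {z 1} ⊔ Ideal.span {z 2} ⊔ Ideal.span {z 0 ^ k} = Ideal.span {z 0 ^ k} ⊔ Ideal.span {z 2} ⊔ Ideal.span {z 1} := by
    rw [sup_comm, ← sup_assoc, sup_right_comm]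
  have e4 : Ideal.span {z 1} ⊔ Ideal.span {z 2} ⊔ Ideal.span {z 0} = sp z := by
    rw [sp3, sup_comm, ← sup_assoc]
  rw [e3, e4] at h3
  calc _ ≤ _ := h1
    _ ≤ (k : ℕ∞) * (k * (k * ln (sp z))) := by gcongr; exact h2.trans (by gcongr)
    _ = _ := by push_cast; ring

lemma cdiv_F_pow {D : ℕ} {z : Fin D → S} (hz : QReg z) (i : Fin D) (n k : ℕ) :
    cdiv (F (sp z) (n + k)) (z i ^ k) = F (sp z) n := by
  ext f
  rw [mem_cdiv]
  exact ⟨F_cancel_X hz i k n f, mulF z i k⟩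

lemma base_ineq {z : Fin 3 → S} (hz : Fr z) (k : ℕ) (h3 : ln (F (sp z) (3 * k)) ≠ ⊤) :
    ln (F (sp z) (3 * k)) + 3 * ln (F (sp z) k) ≤ ln (F (sp z) (3 * k) ⊔ qk z k k k) + 3 * ln (F (sp z) (2 * k)) := by
  set F3 := F (sp z) (3 * k)
  set F2 := F (sp z) (2 * k)
  set F1 := F (sp z) k
  set X1 := Ideal.span {z 0 ^ k} with hX1
  set X2 := Ideal.span {z 1 ^ k} with hX2
  set X3 := Ideal.span {z 2 ^ k} with hX3
  have hle : F3 ≤ F2 := F_anti _ (by omega)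
  have hle' : F2 ≤ F1 := F_anti _ (by omega)
  have fin : ∀ K, F3 ≤ K → ∃ m : ℕ, ln K = m := fun K hK => by
    obtain ⟨m, hm⟩ := ENat.ne_top_iff_exists.1 (ne_top_of_le_ne_top h3 (ln_anti hK))
    exact ⟨m, hm.symm⟩
  have mulm : ∀ i, ∀ f ∈ F2, z i ^ k * f ∈ F3 := fun i f hf => by
    have := mulF z i k hf
    rwa [show 2 * k + k = 3 * k by ring] at this
  have c1 : cdiv F3 (z 0 ^ k) = F2 := by
    have := cdiv_F_pow hz.qreg 0 (2 * k) k
    rwa [show 2 * k + k = 3 * k by ring] at this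
  have c1' : cdiv F2 (z 0 ^ k) = F1 := by
    have := cdiv_F_pow hz.qreg 0 k k
    rwa [show k + k = 2 * k by ring] at this
  have E1 := ln_colon F3 (z 0 ^ k)
  rw [c1, ← hX1] at E1
  have E2 := ln_colon (F3 ⊔ X1) (z 1 ^ k)
  rw [← hX2] at E2
  have E3 := ln_colon (F3 ⊔ X1 ⊔ X2) (z 2 ^ k)
  rw [← hX3] at E3
  have E4 := ln_colon F2 (z 0 ^ k)
  rw [c1', ← hX1] at E4
  have E5 := ln_colon (F2 ⊔ X1) (z 1 ^ k)
  rw [← hX2] at E5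
  have d2 : F2 ⊔ X1 ≤ cdiv (F3 ⊔ X1) (z 1 ^ k) := by
    intro f hf
    obtain ⟨a, ha, b, rfl⟩ := mem_supspan.1 hf
    rw [mem_cdiv]
    exact mem_supspan.2 ⟨_, mulm 1 a ha, z 1 ^ k * b, by ring⟩
  have d3 : F2 ⊔ X1 ⊔ X2 ≤ cdiv (F3 ⊔ X1 ⊔ X2) (z 2 ^ k) := by
    intro f hf
    obtain ⟨a', ha', b', rfl⟩ := mem_supspan.1 hf
    obtain ⟨a, ha, b, rfl⟩ := mem_supspan.1 ha'
    rw [mem_cdiv]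
    exact mem_supspan.2 ⟨_, mem_supspan.2 ⟨_, mulm 2 a ha, z 2 ^ k * b, rfl⟩, z 2 ^ k * b', by ring⟩
  have d5 : cdiv (F2 ⊔ X1) (z 1 ^ k) ≤ F1 := by
    intro f hf
    rw [mem_cdiv] at hf
    obtain ⟨a, ha, b, hab⟩ := mem_supspan.1 hf
    refine Z0 hz.qreg (p := 0) (q := 1) (by decide) hz.fin k f b ?_
    have : f * z 1 ^ k - b * z 0 ^ k = a := by linear_combination hab
    rwa [this]
  have g2 := ln_anti d2
  have g3 := ln_anti d3
  have g5 := ln_anti d5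
  have e6 : F3 ⊔ qk z k k k = F3 ⊔ X1 ⊔ X2 ⊔ X3 := by unfold qk; simp only [← sup_assoc, X1, X2, X3]
  rw [e6]
  obtain ⟨n3, hn3⟩ := fin F3 le_rfl
  obtain ⟨n2, hn2⟩ := fin F2 hle
  obtain ⟨n1, hn1⟩ := fin F1 (hle.trans hle')
  obtain ⟨a1, ha1⟩ := fin (F3 ⊔ X1) le_sup_left
  obtain ⟨a2, ha2⟩ := fin (F3 ⊔ X1 ⊔ X2) (le_sup_left.trans le_sup_left)
  obtain ⟨a3, ha3⟩ := fin (F3 ⊔ X1 ⊔ X2 ⊔ X3) (le_sup_left.trans (le_sup_left.trans le_sup_left))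
  obtain ⟨b1, hb1⟩ := fin (F2 ⊔ X1) (hle.trans le_sup_left)
  obtain ⟨b2, hb2⟩ := fin (F2 ⊔ X1 ⊔ X2) (hle.trans (le_sup_left.trans le_sup_left))
  obtain ⟨c2, hc2⟩ := fin _ (hle.trans (le_sup_left.trans d2))
  obtain ⟨c3, hc3⟩ := fin _ (hle.trans ((le_sup_left.trans le_sup_left).trans d3))
  have h5' : ln (cdiv (F2 ⊔ X1) (z 1 ^ k)) ≠ ⊤ := by
    intro h; rw [h, add_top, hb1] at E5; exact ENat.coe_ne_top _ E5
  obtain ⟨c5, hc5⟩ := ENat.ne_top_iff_exists.1 h5'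
  rw [← hc5] at E5 g5
  rw [hn3, hn1, ha3, hn2]
  rw [hn3, ha1, hn2] at E1
  rw [ha1, ha2, hc2] at E2
  rw [ha2, ha3, hc3] at E3
  rw [hn2, hb1, hn1] at E4
  rw [hb1, hb2] at E5
  rw [hc2, hb1] at g2
  rw [hc3, hb2] at g3
  rw [hn1] at g5
  norm_cast at *
  omega

lemma six_choose (m : ℕ) : (6 : ℤ) * ((m + 3).choose 3 : ℕ) = (m + 1) * (m + 2) * (m + 3) := by
  have h := Nat.ascFactorial_eq_factorial_mul_choose m 3
  have e : (m + 1).ascFactorial 3 = (m + 1) * (m + 2) * (m + 3) := by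
    simp [Nat.ascFactorial]; ring
  rw [e] at h
  have h' : (m + 1) * (m + 2) * (m + 3) = 6 * (m + 3).choose 3 := by
    rw [h]; simp [Nat.factorial]
  exact_mod_cast h'.symm

lemma two_choose (m : ℕ) : (2 : ℤ) * ((m + 2).choose 2 : ℕ) = (m + 1) * (m + 2) := by
  have h := Nat.ascFactorial_eq_factorial_mul_choose m 2
  have e : (m + 1).ascFactorial 2 = (m + 1) * (m + 2) := by
    simp [Nat.ascFactorial]; ring
  rw [e] at h
  have h' : (m + 1) * (m + 2) = 2 * (m + 2).choose 2 := by
    rw [h]; simp [Nat.factorial]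
  exact_mod_cast h'.symm

lemma hilb3 {z : Fin 3 → S} (h : Hilb z) : ∃ e0 e1 e2 : ℤ, ∃ N : ℕ, ∀ n, N ≤ n → ∃ L : ℕ, ln (F (sp z) n) = L ∧
    6 * (L : ℤ) = e0 * (n * (n + 1) * (n + 2)) - 3 * e1 * (n * (n + 1)) + 6 * e2 * n := by
  obtain ⟨e, he, N, hN⟩ := h
  refine ⟨e 0, e 1, e 2, N + 1, fun n hn => ?_⟩
  obtain ⟨m, rfl⟩ : ∃ m, n = m + 1 := ⟨n - 1, by omega⟩
  obtain ⟨L, hL, hL'⟩ := hN m (by omega)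
  refine ⟨L, hL, ?_⟩
  simp only [Finset.sum_range_succ, Finset.sum_range_zero] at hL'
  simp only [show m + 3 - 1 = m + 2 by omega, show m + 3 - 2 = m + 1 by omega, Nat.sub_zero, show 3 - 1 = 2 by omega,
    show 3 - 2 = 1 by omega, Nat.choose_one_right, he] at hL'
  have h6 := six_choose m
  have h2 := two_choose m
  rw [hL']
  push_cast
  push_cast at h6 h2
  linear_combination e 0 * h6 - 3 * e 1 * h2

lemma e_le {z : Fin 3 → S} (hz : Fr z) {e0 e1 e2 : ℤ} {N : ℕ} (hN : ∀ n : ℕ, N ≤ n → ∃ L : ℕ, ln (F (sp z) n) = L ∧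
    6 * (L : ℤ) = e0 * (n * (n + 1) * (n + 2)) - 3 * e1 * (n * (n + 1)) + 6 * e2 * n) :
    ∃ e : ℕ, ln (sp z) = e ∧ (e : ℤ) ≤ e0 := by
  obtain ⟨k0, hk0⟩ := hz.fin
  have hfin : ln (sp z) ≠ ⊤ := by
    obtain ⟨L, hL, -⟩ := hN (1 + N + k0) (by omega)
    refine ne_top_of_le_ne_top (ENat.coe_ne_top L) ?_
    rw [← hL]
    refine ln_anti ?_
    refine (hk0 (1 + N)).trans ?_
    exact Ideal.pow_le_self (by omega)
  obtain ⟨e, he⟩ := ENat.ne_top_iff_exists.1 hfin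
  refine ⟨e, he.symm, ?_⟩
  by_contra hc
  push Not at hc
  have key : ∀ n : ℕ, N ≤ n → (e : ℤ) * ((n + 1) * (n + 2) * (n + 3)) ≤
      e0 * ((n + 1 + k0) * ((n + 1 + k0) + 1) * ((n + 1 + k0) + 2)) - 3 * e1 * ((n + 1 + k0) * ((n + 1 + k0) + 1)) + 6 * e2 * (n + 1 + k0) := by
    intro n hn
    obtain ⟨L, hL, hL'⟩ := hN (n + 1 + k0) (by omega)
    have h1 := ln_anti (hk0 (n + 1))
    rw [hL, ln_pow 3 S z hz.qreg hz.mem n, ← he] at h1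
    have h2 : (n + 3).choose 3 * e ≤ L := by exact_mod_cast h1
    have h3 : (((n + 3).choose 3 : ℕ) : ℤ) * e ≤ L := by exact_mod_cast h2
    have h6 := six_choose n
    push_cast at hL'
    rw [← hL']
    nlinarith
  -- set w = n+1
  set k : ℤ := (k0 : ℤ) with hk
  set P := e0 * (3 * k + 3) - 3 * e1 with hP
  set Q := e0 * (3 * k ^ 2 + 6 * k + 2) - 3 * e1 * (2 * k + 1) + 6 * e2 with hQ
  set T := e0 * (k * (k + 1) * (k + 2)) - 3 * e1 * (k * (k + 1)) + 6 * e2 * k with hT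
  have key2 := key (N + (|P| + |Q| + |T|).toNat) (by omega)
  have hpos : 0 ≤ |P| + |Q| + |T| := by positivity
  push_cast at key2
  rw [Int.toNat_of_nonneg hpos] at key2
  set w : ℤ := N + (|P| + |Q| + |T|) + 1 with hw
  have hw1 : 1 ≤ w := by
    have : (0 : ℤ) ≤ N := by positivity
    omega
  have hwC : |P| + |Q| + |T| + 1 ≤ w := by
    have : (0 : ℤ) ≤ N := by positivity
    omega
  have h1 : (e : ℤ) * (w * (w + 1) * (w + 2)) ≤ e0 * w ^ 3 + (P * w ^ 2 + Q * w + T) := by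
    have e1' : (e : ℤ) * (w * (w + 1) * (w + 2)) = (e : ℤ) * ((N + (|P| + |Q| + |T|) + 1) * (N + (|P| + |Q| + |T|) + 2) * (N + (|P| + |Q| + |T|) + 3)) := by
      rw [hw]; ring
    rw [e1']
    refine key2.trans (le_of_eq ?_)
    rw [hP, hQ, hT]; ring
  have h2 : (e0 + 1) * w ^ 3 ≤ e * (w * (w + 1) * (w + 2)) := by
    have : (e0 + 1) * w ^ 3 ≤ e * w ^ 3 := by
      apply mul_le_mul_of_nonneg_right <;> [omega; positivity]
    have h0 : (0 : ℤ) ≤ e := by positivity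
    have : (e : ℤ) * w ^ 3 ≤ e * (w * (w + 1) * (w + 2)) := by
      apply mul_le_mul_of_nonneg_left _ h0
      nlinarith
    linarith
  have h3 : P * w ^ 2 + Q * w + T ≤ (|P| + |Q| + |T|) * w ^ 2 := by
    have a1 := le_abs_self P
    have a2 := le_abs_self Q
    have a3 := le_abs_self T
    have b2 := abs_nonneg Q
    have b3 := abs_nonneg T
    have : w ≤ w ^ 2 := by nlinarith
    have : 1 ≤ w ^ 2 := by nlinarith
    nlinarith
  have h4 : (|P| + |Q| + |T| + 1) * w ^ 2 ≤ w * w ^ 2 := by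
    apply mul_le_mul_of_nonneg_right hwC; positivity
  nlinarith

lemma base_A0 {z : Fin 3 → S} (hz : Fr z) (hH : Hilb z) : ln (sp z) ≠ ⊤ ∧ ∃ K, ∀ k, K ≤ k → F (sp z) (3 * k) ≤ qk z k k k := by
  obtain ⟨e0, e1, e2, N, hN⟩ := hilb3 hH
  obtain ⟨e, he, hee⟩ := e_le hz hN
  refine ⟨by rw [he]; exact ENat.coe_ne_top _, N, fun k hk => ?_⟩
  obtain ⟨L1, hL1, hL1'⟩ := hN k hk
  obtain ⟨L2, hL2, hL2'⟩ := hN (2 * k) (by omega)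
  obtain ⟨L3, hL3, hL3'⟩ := hN (3 * k) (by omega)
  have h1 := base_ineq hz k (by rw [hL3]; exact ENat.coe_ne_top _)
  have h2 := ln_qk z k
  rw [he] at h2
  have hq : ln (qk z k k k) ≠ ⊤ := by
    intro hc; rw [hc, top_le_iff] at h2
    exact ENat.coe_ne_top (k ^ 3 * e) (by exact_mod_cast h2)
  obtain ⟨q, hq'⟩ := ENat.ne_top_iff_exists.1 hq
  obtain ⟨s, hs⟩ := ENat.ne_top_iff_exists.1 (ne_top_of_le_ne_top hq (ln_anti (le_sup_right : _ ≤ F (sp z) (3 * k) ⊔ qk z k k k)))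
  rw [hL1, hL2, hL3, ← hs] at h1
  rw [← hq'] at h2
  have h3 : (L3 : ℤ) + 3 * L1 ≤ s + 3 * L2 := by exact_mod_cast h1
  have h4 : (q : ℤ) ≤ k ^ 3 * e := by exact_mod_cast h2
  have h5 : (k : ℤ) ^ 3 * e ≤ k ^ 3 * e0 := mul_le_mul_of_nonneg_left hee (by positivity)
  push_cast at hL2' hL3'
  have h6 : (6 : ℤ) * (k ^ 3 * e0) = 6 * (L3 + 3 * L1 - 3 * L2) := by linear_combination 3 * hL2' - 3 * hL1' - hL3'
  have h7 : (q : ℤ) ≤ s := by omega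
  have h8 := ln_eq_of_le (le_sup_right : _ ≤ F (sp z) (3 * k) ⊔ qk z k k k) (by rw [← hq', ← hs]; exact_mod_cast h7) hq
  rw [h8]
  exact le_sup_left

lemma reg3 {z : Fin 3 → S} (hz : Fr z) (i j l : Fin 3) (hij : i ≠ j) (hil : i ≠ l) (hlj : l ≠ j) (b c : ℕ) :
    Reg (z i) (Ideal.span {z j ^ b} ⊔ Ideal.span {z l ^ c}) := by
  have h1 := (hz.qreg.reg_two hz.mem hij hil hlj).sup_pow (hz.qreg.reg_one hz.mem hlj) c
  rw [sup_comm] at h1 ⊢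
  have h2 : Reg (z l) (⊥ : Ideal S) := fun f hf => hz.qreg.eq_zero hz.mem l hf
  have h3 : Reg (z j) (⊥ ⊔ Ideal.span {z l}) := by
    rw [bot_sup_eq]; exact hz.qreg.reg_one hz.mem hlj.symm
  have h4 := h3.sup_pow h2 c
  rw [bot_sup_eq] at h4
  exact h1.sup_pow h4 b

lemma base_A {z : Fin 3 → S} (hz : Fr z) (hH : Hilb z) (a b c : ℕ) : F (sp z) (a + b + c) ≤ qk z a b c := by
  obtain ⟨-, K, hK⟩ := base_A0 hz hH
  intro f hf
  have h0 := hK (a + b + c + K) (by omega) (by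
    have := mulF z 2 (a + b + K) (mulF z 1 (a + c + K) (mulF z 0 (b + c + K) hf))
    rwa [show a + b + c + (b + c + K) + (a + c + K) + (a + b + K) = 3 * (a + b + c + K) by ring] at this)
  set k := a + b + c + K with hk
  unfold qk at h0 ⊢
  have e1 : k = c + (a + b + K) := by omega
  have h1 : z 1 ^ (a + c + K) * (z 0 ^ (b + c + K) * f) ∈ Ideal.span {z 0 ^ k} ⊔ Ideal.span {z 1 ^ k} ⊔ Ideal.span {z 2 ^ c} := by
    refine Reg.cancel_pow (reg3 hz 2 0 1 (by decide) (by decide) (by decide) k k) c (a + b + K) ?_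
    rwa [← e1]
  rw [sup_right_comm] at h1
  have e2 : k = b + (a + c + K) := by omega
  have h2 : z 0 ^ (b + c + K) * f ∈ Ideal.span {z 0 ^ k} ⊔ Ideal.span {z 2 ^ c} ⊔ Ideal.span {z 1 ^ b} := by
    refine Reg.cancel_pow (reg3 hz 1 0 2 (by decide) (by decide) (by decide) k c) b (a + c + K) ?_
    rwa [← e2]
  have e3 : k = a + (b + c + K) := by omega
  rw [sup_assoc, sup_comm] at h2
  have h3 : f ∈ Ideal.span {z 2 ^ c} ⊔ Ideal.span {z 1 ^ b} ⊔ Ideal.span {z 0 ^ a} := by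
    refine Reg.cancel_pow (reg3 hz 0 2 1 (by decide) (by decide) (by decide) c b) a (b + c + K) ?_
    rwa [← e3]
  rw [sup_comm, sup_comm (Ideal.span {z 2 ^ c}), ← sup_assoc] at h3
  exact h3

lemma base3 {z : Fin 3 → S} (hz : Fr z) (hH : Hilb z) (hT : TT z) (hs : Star (D := 2) z) {B : Type*} [CommRing B] [IsLocalRing B]
    [IsNoetherianRing B] (φ : S →+* B) (hφ : Function.Surjective φ) (hk : RingHom.ker φ = Ideal.span {z (Fin.last 2)}) :
    Good (cut (D := 2) z φ) 0 1 := by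
  have hfr := fr_cut (D := 2) φ (by omega) hφ hk hs hz
  have h0 : φ (z (Fin.last 2)) = 0 := by
    rw [← RingHom.mem_ker, hk]; exact Ideal.mem_span_singleton_self _
  refine dim2 hfr ?_ (TT_cut φ hφ hk hT) ?_
  · intro a b g hg
    obtain ⟨f, rfl⟩ := hφ g
    obtain ⟨q, hq⟩ := star_cut φ hφ hk hs hg
    obtain ⟨α, hα, t, ht⟩ := hq q le_rfl 0
    have h1 := base_A hz hH (a + q) b 1 (by rwa [show a + q + b + 1 = a + b + 1 + q by ring])
    unfold qk at h1
    obtain ⟨r, hr, s, rfl⟩ := mem_supspan.1 h1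
    obtain ⟨c, d, rfl⟩ := mem_two.1 hr
    have h2 := congrArg φ ht
    have h02 : φ (z 2) = 0 := h0
    simp only [map_add, map_mul, map_pow, h0, h02, pow_one, zero_mul, add_zero] at h2
    have h3 : cut (D := 2) z φ 0 ^ q * φ f ∈ Ideal.span {cut (D := 2) z φ 1 ^ b} ⊔ Ideal.span {cut (D := 2) z φ 0 ^ (a + q)} := by
      refine mem_two.2 ⟨φ d, φ c, ?_⟩
      rw [add_comm]
      exact h2
    rw [sup_comm]
    refine Reg.cancel_pow ?_ a q h3
    have := reg01 hfr 1 b 0 1 (by decide)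
    rwa [pow_one] at this
  · rw [← ln_comap φ hφ, ← sp_cut φ hk, comap_map_eq φ hφ hk]
    exact ne_top_of_le_ne_top (base_A0 hz hH).1 (ln_anti le_sup_left)

lemma base_step {z : Fin 3 → S} (hz : Fr z) (hH : Hilb z) (hT : TT z) (hs : Star (D := 2) z) :
    Good z (Fin.castSucc (0 : Fin 2)) (Fin.castSucc (1 : Fin 2)) := by
  haveI := isLocalRing_quot (z (Fin.last 2)) (hz.mem _)
  have hk : RingHom.ker (Ideal.Quotient.mk (Ideal.span {z (Fin.last 2)})) = Ideal.span {z (Fin.last 2)} := Ideal.mk_ker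
  have hsur := Ideal.Quotient.mk_surjective (I := Ideal.span {z (Fin.last 2)})
  have hB := base3 hz hH hT hs _ hsur hk
  exact good_lift (D := 2) _ (by omega) hsur hk hs hz (by decide) hB

end base
end RN2

namespace RN2
universe u

lemma cut_step {S : Type u} [CommRing S] [IsLocalRing S] [IsNoetherianRing S] {D : ℕ} (hD : 2 ≤ D) {z : Fin (D + 1) → S}
    {p q : Fin D} (hpq : p ≠ q)
    (ih : ∀ (B : Type u) [CommRing B] [IsLocalRing B] [IsNoetherianRing B] (x : Fin D → B), Fr x → Hilb x → TT x → Good x p q)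
    (h3 : 3 ≤ D) (hz : Fr z) (hH : Hilb z) (hT : TT z) (hs : Star z) :
    Good z p.castSucc q.castSucc := by
  haveI := isLocalRing_quot (z (Fin.last D)) (hz.mem _)
  have hk : RingHom.ker (Ideal.Quotient.mk (Ideal.span {z (Fin.last D)})) = Ideal.span {z (Fin.last D)} := Ideal.mk_ker
  have hsur := Ideal.Quotient.mk_surjective (I := Ideal.span {z (Fin.last D)})
  have hB := ih (S ⧸ Ideal.span {z (Fin.last D)}) _ (fr_cut _ (by omega) hsur hk hs hz) (hilb_cut _ (by omega) hsur hk hs hz hH) (TT_cut _ hsur hk hT)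
  exact good_lift _ (by omega) hsur hk hs hz hpq hB

theorem main_ind (D : ℕ) : ∀ (A : Type u) [CommRing A] [IsLocalRing A] [IsNoetherianRing A] (x : Fin (D + 3) → A),
    Fr x → Hilb x → TT x → Good x 0 1 := by
  induction D with
  | zero =>
    intro A _ _ _ x hx hH hT
    have h := base_step (fr_zS (D := 2) hx) (hilb_zS (D := 2) hH) (TT_zS (D := 2) hT) (star_zS (D := 2) hx.qreg)
    exact good_desc (D := 2) h
  | succ D ih =>
    intro A _ _ _ x hx hH hT
    have h := cut_step (D := D + 3) (by omega) (p := 0) (q := 1) (by simp) ih (by omega) (fr_zS (D := D + 3) hx) (hilb_zS (D := D + 3) hH) (TT_zS (D := D + 3) hT) (star_zS (D := D + 3) hx.qreg)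
    exact good_desc (D := D + 3) h

end RN2

namespace RN2

section pig
lemma asc_ratio (N k : ℕ) (D : ℕ) : (1 - (D * k : ℝ) / (N + k + 1)) * ((N + k + 1).ascFactorial D : ℝ) ≤ ((N + 1).ascFactorial D : ℝ) := by
  induction D with
  | zero => simp
  | succ D ih =>
    rw [Nat.ascFactorial_succ, Nat.ascFactorial_succ]
    push_cast
    have hpos : (0 : ℝ) < N + k + 1 := by positivity
    set A : ℝ := ((N + k + 1).ascFactorial D : ℝ)
    have hA : 0 ≤ A := by positivity
    set B : ℝ := ((N + 1).ascFactorial D : ℝ)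
    have h1 : (N + 1 + D : ℝ) * ((1 - (D * k : ℝ) / (N + k + 1)) * A) ≤ (N + 1 + D) * B :=
      mul_le_mul_of_nonneg_left ih (by positivity)
    refine le_trans ?_ h1
    have e1 : (1 - (((D : ℝ) + 1) * k) / (N + k + 1)) = (1 - (D * k : ℝ) / (N + k + 1)) - k / (N + k + 1) := by
      field_simp; ring
    rw [e1]
    set q : ℝ := (D * k : ℝ) / (N + k + 1)
    have hq : 0 ≤ q := by positivity
    have h2 : (k : ℝ) ≤ k / (N + k + 1) * (N + k + 1 + D) := by
      rw [div_mul_eq_mul_div, le_div_iff₀ hpos]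
      have : (0:ℝ) ≤ k * D := by positivity
      nlinarith
    have h3 : (1 - q - k / (N + k + 1)) * ((N + k + 1 + D : ℝ)) ≤ (N + 1 + D) * (1 - q) := by
      have : 0 ≤ q * k := by positivity
      nlinarith
    nlinarith [mul_le_mul_of_nonneg_right h3 hA]

lemma choose_asym (e k D : ℕ) : ∃ N, e * (N + k + D).choose D < (e + 1) * (N + D).choose D := by
  refine ⟨D * k * (e + 1), ?_⟩
  set N := D * k * (e + 1) with hN
  have h1 := asc_ratio N k D
  rw [Nat.ascFactorial_eq_factorial_mul_choose, Nat.ascFactorial_eq_factorial_mul_choose] at h1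
  push_cast at h1
  set a : ℝ := ((N + k + D).choose D : ℝ) with ha
  set b : ℝ := ((N + D).choose D : ℝ) with hb
  have hapos : 0 < a := by
    rw [ha]; exact_mod_cast Nat.choose_pos (by omega)
  have hf : (0 : ℝ) < (D.factorial : ℝ) := by exact_mod_cast Nat.factorial_pos D
  have h2 : (1 - (D * k : ℝ) / (N + k + 1)) * a ≤ b := by
    by_contra hc
    push Not at hc
    nlinarith
  have h3 : (D * k : ℝ) / (N + k + 1) * (e + 1) < 1 := by
    rw [div_mul_eq_mul_div, div_lt_one (by positivity)]
    rw [hN]; push_cast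
    have : (0:ℝ) ≤ k := by positivity
    linarith
  have h4 : (e : ℝ) * a < (e + 1) * b := by
    have : (e + 1 : ℝ) * ((1 - (D * k : ℝ) / (N + k + 1)) * a) ≤ (e + 1) * b := mul_le_mul_of_nonneg_left h2 (by positivity)
    nlinarith [mul_lt_mul_of_pos_right h3 hapos]
  rw [ha, hb] at h4
  exact_mod_cast h4

/-- monomials of degree at most `N` -/
noncomputable def mons (D N : ℕ) : Finset (Fin D →₀ ℕ) := (Finset.range (N + 1)).biUnion fun i => Finset.finsuppAntidiag Finset.univ i

lemma mem_mons {D N : ℕ} {a : Fin D →₀ ℕ} : a ∈ mons D N ↔ a.degree ≤ N := by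
  simp [mons, Finsupp.degree_eq_sum]

lemma card_mons (D N : ℕ) : (mons D N).card = (N + D).choose D := by
  rw [mons, Finset.card_biUnion]
  · simp only [Finset.card_finsuppAntidiag_nat_eq_multichoose, Finset.card_univ, Fintype.card_fin]
    have := Nat.sum_range_multichoose N D
    exact this
  · intro i _ j _ hij
    rw [Function.onFun, Finset.disjoint_left]
    intro a ha hb
    simp only [Finset.mem_finsuppAntidiag] at ha hb
    exact hij (ha.1.symm.trans hb.1)

variable {A : Type*} [CommRing A]

lemma exists_rel (I : Ideal A) {ι : Type*} [DecidableEq ι] (u : ι → A) (v : ι → ℝ) (s : Finset ι)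
    (h : ln I < s.card) : ∃ j ∈ s, ∃ c : ι → A, (∀ k, k ≠ j → c k ≠ 0 → v j ≤ v k) ∧ c j = 1 ∧ ∑ k ∈ s, c k * u k ∈ I := by
  have key : ∀ s : Finset ι, (∃ j ∈ s, ∃ c : ι → A, (∀ k, k ≠ j → c k ≠ 0 → v j ≤ v k) ∧ c j = 1 ∧ ∑ k ∈ s, c k * u k ∈ I) ∨
      s.card + ln (I ⊔ Ideal.span (u '' s)) ≤ ln I := by
    intro s
    induction s using Finset.induction_on_min_value v with
    | empty => right; simp
    | insert a s ha hmin ih =>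
      rcases ih with ⟨j, hj, c, hc, hcj, hs⟩ | ih
      · left
        refine ⟨j, Finset.mem_insert_of_mem hj, fun k => if k = a then 0 else c k, ?_, ?_, ?_⟩
        · intro k hk hk'
          by_cases hka : k = a
          · simp [hka] at hk'
          · simp only [hka, if_false] at hk'; exact hc k hk hk'
        · have : j ≠ a := by rintro rfl; exact ha hj
          simp [this, hcj]
        · rw [Finset.sum_insert ha]
          simp only [if_true, zero_mul, zero_add]
          rw [Finset.sum_congr rfl (g := fun k => c k * u k)]
          · exact hs
          · intro k hk; rw [if_neg (by rintro rfl; exact ha hk)]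
      · by_cases hu : u a ∈ I ⊔ Ideal.span (u '' s)
        · left
          obtain ⟨p, hp, q, hq, hpq⟩ := Submodule.mem_sup.1 hu
          rw [Ideal.span, Submodule.mem_span_image_finset_iff_exists_fun] at hq
          obtain ⟨c', hc'⟩ := hq
          obtain ⟨c, hc⟩ : ∃ c : ι → A, ∑ k ∈ s, c k * u k = q := by
            refine ⟨fun k => if h : k ∈ s then c' ⟨k, h⟩ else 0, ?_⟩
            rw [← hc', ← Finset.sum_coe_sort]
            refine Finset.sum_congr rfl fun k _ => ?_
            simp
          refine ⟨a, Finset.mem_insert_self _ _, fun k => if k = a then 1 else if k ∈ s then - c k else 0, ?_, by simp, ?_⟩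
          · intro k hk hk'
            by_cases hks : k ∈ s
            · exact hmin k hks
            · simp [hk, hks] at hk'
          · rw [Finset.sum_insert ha]
            simp only [if_true, one_mul]
            rw [Finset.sum_congr rfl (g := fun k => - (c k * u k)), Finset.sum_neg_distrib, ← hpq]
            · have : p + q + -∑ k ∈ s, c k * u k = p := by
                rw [← hc]; simp
              rw [this]; exact hp
            · intro k hk; rw [if_neg (by rintro rfl; exact ha hk), if_pos hk]; ring
        · right
          refine le_trans ?_ ih
          rw [Finset.card_insert_of_notMem ha, ln_colon (I ⊔ Ideal.span (u '' s)) (u a)]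
          have h1 : 1 ≤ ln (cdiv (I ⊔ Ideal.span (u '' s)) (u a)) := by
            rw [ENat.one_le_iff_ne_zero]
            intro h0
            rw [Module.length_eq_zero_iff, Submodule.Quotient.subsingleton_iff] at h0
            apply hu
            have : (1 : A) ∈ cdiv (I ⊔ Ideal.span (u '' s)) (u a) := by rw [h0]; trivial
            rw [mem_cdiv, mul_one] at this
            exact this
          have h2 : I ⊔ Ideal.span (u '' ↑(insert a s)) = I ⊔ Ideal.span (u '' s) ⊔ Ideal.span {u a} := by
            rw [Finset.coe_insert, Set.image_insert_eq, Set.insert_eq, Ideal.span_union, sup_comm (Ideal.span {u a}), sup_assoc]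
          rw [h2]
          push_cast
          rw [add_assoc, add_comm 1, ]
          gcongr
  rcases key s with h1 | h1
  · exact h1
  · exact absurd ((le_self_add).trans h1) (not_le.2 h)

end pig
end RN2

namespace RN2

section VV
variable {A : Type*} [CommRing A]

lemma cl_le_cl (J : Ideal A) (b b' c c' : ℕ) [NeZero b] [NeZero b'] (h : c * b' ≤ c' * b) : cl J b' c' ≤ cl J b c := by
  haveI : NeZero (b * b') := ⟨mul_ne_zero (NeZero.ne b) (NeZero.ne b')⟩
  haveI : NeZero (b' * b) := ⟨mul_ne_zero (NeZero.ne b') (NeZero.ne b)⟩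
  rw [← cl_scale J b (s := b') c, ← cl_scale J b' (s := b) c']
  have : ∀ (p q : ℕ) [NeZero p] [NeZero q], p = q → ∀ c, cl J p c = cl J q c := by
    intro p q _ _ h c; subst h; rfl
  rw [this (b' * b) (b * b') (mul_comm _ _)]
  exact cl_anti J _ h

/-- asymptotic order larger than `w` -/
def VG (J : Ideal A) (w : ℝ) : Ideal A where
  carrier := {f | ∃ b c : ℕ, w * (b + 1) < c ∧ f ∈ cl J (b + 1) c}
  zero_mem' := by
    obtain ⟨c, hc⟩ := exists_nat_gt (w * ((0 : ℕ) + 1))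
    exact ⟨0, c, hc, Ideal.zero_mem _⟩
  add_mem' := by
    rintro f g ⟨b, c, h, hf⟩ ⟨b', c', h', hg⟩
    rcases le_total (c * (b' + 1)) (c' * (b + 1)) with hle | hle
    · exact ⟨b, c, h, Ideal.add_mem _ hf (cl_le_cl J _ _ _ _ hle hg)⟩
    · exact ⟨b', c', h', Ideal.add_mem _ (cl_le_cl J _ _ _ _ hle hf) hg⟩
  smul_mem' := by
    rintro r f ⟨b, c, h, hf⟩
    exact ⟨b, c, h, Ideal.mul_mem_left _ _ hf⟩

lemma mem_VG {J : Ideal A} {w : ℝ} {f : A} : f ∈ VG J w ↔ ∃ b c : ℕ, w * (b + 1) < c ∧ f ∈ cl J (b + 1) c := Iff.rfl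

/-- asymptotic order at least `w` -/
def VE (J : Ideal A) (w : ℝ) : Ideal A := ⨅ (b : ℕ), ⨅ (c : ℕ), ⨅ (_ : (c : ℝ) < w * (b + 1)), cl J (b + 1) c

lemma mem_VE {J : Ideal A} {w : ℝ} {f : A} : f ∈ VE J w ↔ ∀ b c : ℕ, (c : ℝ) < w * (b + 1) → f ∈ cl J (b + 1) c := by
  simp only [VE, Submodule.mem_iInf]

lemma cl_le_VE (J : Ideal A) (b c : ℕ) : cl J (b + 1) c ≤ VE J ((c : ℝ) / (b + 1)) := by
  intro f hf
  rw [mem_VE]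
  intro b' c' h
  refine cl_le_cl J _ _ _ _ ?_ hf
  rw [div_mul_eq_mul_div, lt_div_iff₀ (by positivity)] at h
  have h' : ((c' * (b + 1) : ℕ) : ℝ) ≤ ((c * (b' + 1) : ℕ) : ℝ) := by push_cast; exact h.le
  exact_mod_cast h'

lemma VE_le_VG (J : Ideal A) {w w' : ℝ} (h0 : 0 ≤ w) (h : w < w') : VE J w' ≤ VG J w := by
  intro f hf
  rw [mem_VE] at hf
  obtain ⟨q, hq1, hq2⟩ := exists_rat_btwn h
  have hq0 : 0 < q := by exact_mod_cast h0.trans_lt hq1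
  have hq : (q : ℝ) = (q.num.toNat : ℝ) / q.den := by
    have h1 : ((q.num.toNat : ℤ)) = q.num := Int.toNat_of_nonneg (Rat.num_nonneg.2 hq0.le)
    have h2 : (q.num.toNat : ℝ) = (q.num : ℝ) := by exact_mod_cast congrArg (Int.cast (R := ℝ)) h1
    rw [h2]; exact_mod_cast (Rat.num_div_den q).symm
  have hd : ((q.den - 1 : ℕ) : ℝ) + 1 = q.den := by
    have := q.den_pos
    have h : q.den - 1 + 1 = q.den := by omega
    exact_mod_cast h
  have hdp : (0 : ℝ) < q.den := by exact_mod_cast q.den_pos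
  refine ⟨q.den - 1, q.num.toNat, ?_, hf _ _ ?_⟩
  · rw [hd]; rw [hq, lt_div_iff₀ hdp] at hq1; exact hq1
  · rw [hd]; rw [hq, div_lt_iff₀ hdp] at hq2; exact hq2

lemma VE_zero (J : Ideal A) : VE J 0 = ⊤ := by
  rw [eq_top_iff]; intro f _
  rw [mem_VE]; intro b c h
  rw [zero_mul] at h
  exact absurd h (not_lt.2 (Nat.cast_nonneg c))

lemma VE_mul (J : Ideal A) {i : ℕ} {τ : ℝ} {g f : A} (hg : g ∈ F J i) (hf : f ∈ VE J τ) : g * f ∈ VE J (i + τ) := by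
  rw [mem_VE] at hf ⊢
  intro b c h
  have h1 : g ∈ cl J (b + 1) ((b + 1) * i) := by rwa [cl_mul_eq_F]
  rcases le_total c ((b + 1) * i) with hc | hc
  · exact Ideal.mul_mem_right _ _ (cl_anti J _ hc h1)
  · have := cl_mul_mem J (b + 1) h1 (hf b (c - (b + 1) * i) (by rw [Nat.cast_sub hc]; push_cast; linarith))
    rwa [Nat.add_sub_cancel' hc] at this

lemma F_le_VE (J : Ideal A) (i : ℕ) : F J i ≤ VE J i := by
  have := cl_le_VE J 0 i
  simpa using this

lemma VE_pow (J : Ideal A) {τ : ℝ} {f : A} (h0 : 0 ≤ τ) (hf : f ∈ VE J τ) (j : ℕ) : f ^ j ∈ VE J (j * τ) := by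
  rcases Nat.eq_zero_or_pos j with rfl | hj
  · simp [VE_zero]
  rw [mem_VE] at hf ⊢
  intro b c h
  haveI : NeZero j := ⟨hj.ne'⟩
  haveI : NeZero ((b + 1) * j) := ⟨by positivity⟩
  have e1 : (b + 1) * j = ((b + 1) * j - 1) + 1 := by
    have : 0 < (b + 1) * j := by positivity
    omega
  have h1 := hf ((b + 1) * j - 1) c (by
    have h2 : (((b + 1) * j - 1 : ℕ) : ℝ) + 1 = (b + 1) * j := by exact_mod_cast e1.symm
    rw [h2]; linarith)
  have h2 := cl_pow_mem J _ h1 j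
  refine cl_le_cl J _ _ _ _ ?_ h2
  rw [← e1]; nlinarith

lemma VG_root (J : Ideal A) {τ : ℝ} {f : A} (j : ℕ) (hj : 0 < j) (hf : f ^ j ∈ VG J (j * τ)) : f ∈ VG J τ := by
  obtain ⟨b, c, h, hf⟩ := hf
  haveI : NeZero j := ⟨hj.ne'⟩
  have e1 : (b + 1) * j = ((b + 1) * j - 1) + 1 := by
    have : 0 < (b + 1) * j := by positivity
    omega
  refine ⟨(b + 1) * j - 1, c, ?_, ?_⟩
  · have h2 : (((b + 1) * j - 1 : ℕ) : ℝ) + 1 = (b + 1) * j := by exact_mod_cast e1.symm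
    rw [h2]; linarith
  · refine cl_root J _ hj ?_
    refine cl_le_cl J _ _ _ _ ?_ hf
    rw [← e1]; nlinarith

lemma VG_anti (J : Ideal A) {w w' : ℝ} (h : w ≤ w') : VG J w' ≤ VG J w := by
  rintro f ⟨b, c, h1, hf⟩
  refine ⟨b, c, lt_of_le_of_lt ?_ h1, hf⟩
  gcongr

lemma exists_val (J : Ideal A) {f : A} {b1 c1 : ℕ} (h : f ∉ cl J (b1 + 1) c1) : ∃ ρ : ℝ, 0 ≤ ρ ∧ ρ ≤ (c1 : ℝ) / (b1 + 1) ∧ f ∈ VE J ρ ∧ f ∉ VG J ρ := by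
  set S : Set ℝ := {r | ∃ b c : ℕ, r = (c : ℝ) / (b + 1) ∧ f ∈ cl J (b + 1) c} with hS
  have h0 : (0 : ℝ) ∈ S := ⟨0, 0, by simp, by rw [cl_zero]; trivial⟩
  have hub : ∀ r ∈ S, r ≤ (c1 : ℝ) / (b1 + 1) := by
    rintro r ⟨b, c, rfl, hf⟩
    by_contra hc
    push Not at hc
    apply h
    refine cl_le_cl J _ _ _ _ ?_ hf
    rw [div_lt_div_iff₀ (by positivity) (by positivity)] at hc
    have : ((c1 * (b + 1) : ℕ) : ℝ) ≤ ((c * (b1 + 1) : ℕ) : ℝ) := by push_cast; exact hc.le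
    exact_mod_cast this
  have hbdd : BddAbove S := ⟨_, hub⟩
  refine ⟨sSup S, le_csSup hbdd h0, csSup_le ⟨0, h0⟩ hub, ?_, ?_⟩
  · rw [mem_VE]
    intro b c hbc
    rw [← div_lt_iff₀ (by positivity)] at hbc
    obtain ⟨r, ⟨b', c', rfl, hf⟩, hr⟩ := exists_lt_of_lt_csSup ⟨0, h0⟩ hbc
    refine cl_le_cl J _ _ _ _ ?_ hf
    rw [div_lt_div_iff₀ (by positivity) (by positivity)] at hr
    have : ((c * (b' + 1) : ℕ) : ℝ) ≤ ((c' * (b + 1) : ℕ) : ℝ) := by push_cast; exact hr.le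
    exact_mod_cast this
  · rintro ⟨b, c, h1, hf⟩
    have h2 := le_csSup hbdd (⟨b, c, rfl, hf⟩ : (c : ℝ) / (b + 1) ∈ S)
    rw [div_le_iff₀ (by positivity)] at h2
    linarith

variable [IsLocalRing A] [IsNoetherianRing A] {D : ℕ} {x : Fin D → A}

lemma VG_cancel (hx : QReg x) {i : ℕ} {P : MvPolynomial (Fin D) A} (hP : P.IsHomogeneous i) (hp : Prim P) {τ : ℝ} (h0 : 0 ≤ τ)
    {f : A} (h : MvPolynomial.eval x P * f ∈ VG (sp x) (i + τ)) : f ∈ VG (sp x) τ := by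
  obtain ⟨b, c, h1, hf⟩ := h
  have h2 : i * (b + 1) ≤ c := by
    have : ((i * (b + 1) : ℕ) : ℝ) ≤ c := by
      push_cast
      have : 0 ≤ τ * (b + 1) := by positivity
      nlinarith
    exact_mod_cast this
  refine ⟨b, c - i * (b + 1), ?_, ?_⟩
  · rw [Nat.cast_sub h2]; push_cast; linarith
  · refine cl_cancel (b + 1) hx hP hp _ f ?_
    rwa [Nat.sub_add_cancel h2]

lemma pig (hx : QReg x) (hm : ∀ i, x i ∈ maximalIdeal A) (hmax : maximalIdeal A ≤ F (sp x) 1) {e : ℕ} (he : ln (sp x) = e)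
    (f : Fin (e + 1) → A) (τ : Fin (e + 1) → ℝ) (hτ : ∀ j, 0 ≤ τ j) (hf : ∀ j, f j ∈ VE (sp x) (τ j)) :
    ∃ w : ℝ, ∃ P : Fin (e + 1) → MvPolynomial (Fin D) A, ∃ i : Fin (e + 1) → ℕ, (∀ j, (P j).IsHomogeneous (i j)) ∧
      (∀ j, P j = 0 ∨ (Prim (P j) ∧ i j + τ j = w)) ∧ (∃ j, Prim (P j)) ∧
      ∑ j, MvPolynomial.eval x (P j) * f j ∈ VG (sp x) w := by
  classical
  obtain ⟨k, hk⟩ := exists_nat_gt (∑ j, τ j)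
  have hk' : ∀ j, τ j < k := fun j => lt_of_le_of_lt (Finset.single_le_sum (fun j _ => hτ j) (Finset.mem_univ j)) hk
  obtain ⟨N, hN⟩ := choose_asym e k D
  set s : Finset (Fin (e + 1) × (Fin D →₀ ℕ)) := Finset.univ ×ˢ mons D N with hs
  have hln : ln (F (sp x) (N + k + 1)) < s.card := by
    refine (ln_anti (pow_le_F (sp x) (N + k + 1))).trans_lt ?_
    rw [ln_pow D A x hx hm (N + k), he, hs, Finset.card_product, card_mons, Finset.card_univ, Fintype.card_fin]
    rw [mul_comm] at hN
    exact_mod_cast hN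
  obtain ⟨⟨j0, a0⟩, hj0, c, hc, hc1, hsum⟩ := exists_rel (F (sp x) (N + k + 1))
    (fun p : Fin (e + 1) × (Fin D →₀ ℕ) => MvPolynomial.eval x (MvPolynomial.monomial p.2 1) * f p.1)
    (fun p => (p.2.degree : ℝ) + τ p.1) s hln
  set w : ℝ := (a0.degree : ℝ) + τ j0 with hw
  have hw0 : 0 ≤ w := by have := hτ j0; positivity
  have ha0 : a0 ∈ mons D N := by simpa [hs] using hj0
  -- the value-w part
  set P' : Fin (e + 1) → MvPolynomial (Fin D) A := fun j =>
    ∑ a ∈ (mons D N).filter (fun a => (a.degree : ℝ) + τ j = w), MvPolynomial.monomial a (c (j, a)) with hP'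
  have hi : ∀ j, ∃ i : ℕ, (P' j).IsHomogeneous i ∧ (P' j = 0 ∨ i + τ j = w) := by
    intro j
    by_cases hj : ∃ i : ℕ, (i : ℝ) + τ j = w
    · obtain ⟨i, hi⟩ := hj
      refine ⟨i, ?_, Or.inr hi⟩
      refine MvPolynomial.IsHomogeneous.sum _ _ _ fun a ha => ?_
      refine MvPolynomial.isHomogeneous_monomial _ ?_
      have h1 := (Finset.mem_filter.1 ha).2
      have h2 : (a.degree : ℝ) = i := by linarith
      exact_mod_cast h2
    · have : P' j = 0 := by
        rw [hP']
        refine Finset.sum_eq_zero fun a ha => ?_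
        exact absurd ⟨_, (Finset.mem_filter.1 ha).2⟩ hj
      exact ⟨0, by rw [this]; exact MvPolynomial.isHomogeneous_zero _ _ _, Or.inl this⟩
  choose i hi1 hi2 using hi
  have hbig : ∀ p ∈ s, (p.2.degree : ℝ) + τ p.1 ≠ w →
      c p * (MvPolynomial.eval x (MvPolynomial.monomial p.2 1) * f p.1) ∈ VG (sp x) w := by
    rintro ⟨j, a⟩ - hne
    by_cases hcp : c (j, a) = 0
    · rw [hcp, zero_mul]; exact Ideal.zero_mem _
    have h1 := hc (j, a) (by rintro h; rw [Prod.mk.injEq] at h; rw [h.1, h.2] at hne; exact hne rfl) hcp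
    refine Ideal.mul_mem_left _ _ (VE_le_VG _ hw0 (lt_of_le_of_ne h1 (Ne.symm hne)) ?_)
    refine VE_mul _ (pow_mem_F _ _ (eval_mem_pow x _ _ ?_)) (hf j)
    exact MvPolynomial.isHomogeneous_monomial _ rfl
  have hsum' : ∑ j, MvPolynomial.eval x (P' j) * f j ∈ VG (sp x) w := by
    have e1 : ∑ j, MvPolynomial.eval x (P' j) * f j =
        ∑ p ∈ s with (p.2.degree : ℝ) + τ p.1 = w, c p * (MvPolynomial.eval x (MvPolynomial.monomial p.2 1) * f p.1) := by
      rw [Finset.sum_filter, hs, Finset.sum_product]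
      refine Finset.sum_congr rfl fun j _ => ?_
      rw [← Finset.sum_filter, hP', map_sum, Finset.sum_mul]
      refine Finset.sum_congr rfl fun a _ => ?_
      rw [MvPolynomial.eval_monomial, MvPolynomial.eval_monomial]; ring
    have e2 := Finset.sum_filter_add_sum_filter_not s (fun p => (p.2.degree : ℝ) + τ p.1 = w)
      (fun p => c p * (MvPolynomial.eval x (MvPolynomial.monomial p.2 1) * f p.1))
    rw [e1, eq_sub_of_add_eq e2]
    refine Ideal.sub_mem _ ?_ (Ideal.sum_mem _ fun p hp => hbig p (Finset.mem_filter.1 hp).1 (Finset.mem_filter.1 hp).2)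
    refine VE_le_VG _ hw0 ?_ (F_le_VE _ _ hsum)
    have h1 : (a0.degree : ℝ) ≤ N := by exact_mod_cast mem_mons.1 ha0
    have h2 := hk' j0
    push_cast; rw [hw]; linarith
  have hnp : ∀ j, ¬ Prim (P' j) → MvPolynomial.eval x (P' j) * f j ∈ VG (sp x) w := by
    intro j hj
    rcases hi2 j with h0 | h0
    · rw [h0, map_zero, zero_mul]; exact Ideal.zero_mem _
    have h1 : ∀ a, (P' j).coeff a ∈ maximalIdeal A := by
      intro a; by_contra h; exact hj ⟨a, h⟩
    have h2 := eval_mem_of_coeff x _ _ _ (hi1 j) h1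
    have h3 : MvPolynomial.eval x (P' j) ∈ F (sp x) (1 + i j) :=
      F_mul_le _ _ _ (Ideal.mul_mono hmax (pow_le_F _ _) h2)
    refine VE_le_VG _ hw0 ?_ (VE_mul _ h3 (hf j))
    push_cast; linarith
  refine ⟨w, fun j => if Prim (P' j) then P' j else 0, i, ?_, ?_, ⟨j0, ?_⟩, ?_⟩
  · intro j; dsimp only; split_ifs
    · exact hi1 j
    · exact MvPolynomial.isHomogeneous_zero _ _ _
  · intro j; dsimp only; split_ifs with h
    · right; refine ⟨h, ?_⟩
      rcases hi2 j with h0 | h0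
      · obtain ⟨a, ha⟩ := h; rw [h0] at ha; simp at ha
      · exact h0
    · left; rfl
  · have : Prim (P' j0) := by
      refine ⟨a0, ?_⟩
      rw [hP', MvPolynomial.coeff_sum, Finset.sum_eq_single a0]
      · rw [MvPolynomial.coeff_monomial, if_pos rfl, hc1]
        exact fun h => (Ideal.ne_top_iff_one _).1 (maximalIdeal.isMaximal A).ne_top h
      · intro a _ ha; rw [MvPolynomial.coeff_monomial, if_neg ha]
      · intro h; exact (h (Finset.mem_filter.2 ⟨ha0, rfl⟩)).elim
    dsimp only; rw [if_pos this]; exact this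
  · have e3 : ∀ j, MvPolynomial.eval x (if Prim (P' j) then P' j else 0) * f j =
        MvPolynomial.eval x (P' j) * f j - (if Prim (P' j) then 0 else MvPolynomial.eval x (P' j) * f j) := by
      intro j; split_ifs <;> simp
    simp only [e3, Finset.sum_sub_distrib]
    refine Ideal.sub_mem _ hsum' (Ideal.sum_mem _ fun j _ => ?_)
    split_ifs with h
    · exact Ideal.zero_mem _
    · exact hnp j h

end VV
end RN2

namespace RN2

section S12
variable {A : Type*} [CommRing A] [IsLocalRing A] [IsNoetherianRing A] {D : ℕ} {x : Fin D → A}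

lemma one_not_VG (hm : ∀ i, x i ∈ maximalIdeal A) {w : ℝ} (hw : 0 ≤ w) : (1 : A) ∉ VG (sp x) w := by
  rintro ⟨b, c, h, k, hk⟩
  have hc : 0 < c := by
    have : (0 : ℝ) < c := lt_of_le_of_lt (by positivity) h
    exact_mod_cast this
  have h1 := hk 1 ((b + 1) * (1 + k)) (by nlinarith [Nat.zero_le ((b + 1) * (1 + k))])
  rw [one_pow, pow_one] at h1
  have : sp x ≤ maximalIdeal A := by
    rw [Ideal.span_le]; rintro _ ⟨i, rfl⟩; exact hm i
  exact (Ideal.ne_top_iff_one _).1 (maximalIdeal.isMaximal A).ne_top (this h1)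

lemma coeff_pow_mem (J : Ideal A) (n W : ℕ) (p : A[X]) (hp : ∀ j, p.coeff j ∈ J ^ (W - n * j)) (M : ℕ) :
    ∀ j, (p ^ M).coeff j ∈ J ^ (W * M - n * j) := by
  induction M with
  | zero => intro j; simp
  | succ M ih =>
    intro j
    rw [pow_succ, Polynomial.coeff_mul]
    refine Ideal.sum_mem _ fun q hq => ?_
    have hq' := HasAntidiagonal.mem_antidiagonal.1 hq
    refine Ideal.pow_le_pow_right ?_ (by rw [pow_add]; exact Ideal.mul_mem_mul (ih q.1) (hp q.2) : _ ∈ J ^ ((W * M - n * q.1) + (W - n * q.2)))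
    rw [← hq', mul_add n, mul_add W, mul_one]
    omega

lemma prim_ne_zero {P : MvPolynomial (Fin D) A} (h : Prim P) : P ≠ 0 := by
  rintro rfl; obtain ⟨a, ha⟩ := h; simp at ha

lemma pig_pow (hx : QReg x) (hm : ∀ i, x i ∈ maximalIdeal A) (hmax : maximalIdeal A ≤ F (sp x) 1) {e : ℕ} (he : ln (sp x) = e)
    {f : A} {ρ : ℝ} (h0 : 0 ≤ ρ) (hE : f ∈ VE (sp x) ρ) (hG : f ∉ VG (sp x) ρ) :
    ∃ w : ℝ, ∃ P : Fin (e + 1) → MvPolynomial (Fin D) A, ∃ i : Fin (e + 1) → ℕ, (∀ j, (P j).IsHomogeneous (i j)) ∧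
      (∀ j, P j = 0 ∨ (Prim (P j) ∧ i j + (j : ℕ) * ρ = w)) ∧ (∃ j1 j2, j1 < j2 ∧ Prim (P j1) ∧ Prim (P j2)) ∧
      ∑ j, MvPolynomial.eval x (P j) * f ^ (j : ℕ) ∈ VG (sp x) w := by
  obtain ⟨w, P, i, h1, h2, ⟨j1, h3⟩, h4⟩ := pig hx hm hmax he (fun j => f ^ (j : ℕ)) (fun j => (j : ℕ) * ρ)
    (fun j => by positivity) (fun j => VE_pow _ h0 hE _)
  refine ⟨w, P, i, h1, h2, ?_, h4⟩
  suffices ∃ j2, j2 ≠ j1 ∧ Prim (P j2) by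
    obtain ⟨j2, hne, h5⟩ := this
    rcases lt_or_gt_of_ne hne with h | h
    · exact ⟨j2, j1, h, h5, h3⟩
    · exact ⟨j1, j2, h, h3, h5⟩
  by_contra hc
  push Not at hc
  rw [Finset.sum_eq_single j1] at h4
  · have hw : i j1 + (j1 : ℕ) * ρ = w := by
      rcases h2 j1 with h | h
      · exact absurd h (prim_ne_zero h3)
      · exact h.2
    rw [← hw] at h4
    have h5 := VG_cancel hx (h1 j1) h3 (by positivity) h4
    rcases Nat.eq_zero_or_pos (j1 : ℕ) with hj | hj
    · rw [hj, pow_zero] at h5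
      exact one_not_VG hm (by simp) h5
    · exact hG (VG_root _ _ hj h5)
  · intro j _ hj
    rcases h2 j with h | h
    · rw [h, map_zero, zero_mul]
    · exact absurd h.1 (hc j hj)
  · intro h; exact absurd (Finset.mem_univ _) h

lemma val_rat (hx : QReg x) (hm : ∀ i, x i ∈ maximalIdeal A) (hmax : maximalIdeal A ≤ F (sp x) 1) {e : ℕ} (he : ln (sp x) = e)
    {f : A} {ρ : ℝ} (h0 : 0 ≤ ρ) (hE : f ∈ VE (sp x) ρ) (hG : f ∉ VG (sp x) ρ) :
    ∃ l n : ℕ, 1 ≤ l ∧ l ≤ e ∧ l * ρ = n := by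
  obtain ⟨w, P, i, h1, h2, ⟨j1, j2, hlt, p1, p2⟩, -⟩ := pig_pow hx hm hmax he h0 hE hG
  have e1 := ((h2 j1).resolve_left (prim_ne_zero p1)).2
  have e2 := ((h2 j2).resolve_left (prim_ne_zero p2)).2
  have hlt' : (j1 : ℕ) < j2 := hlt
  have hl : (((j2 : ℕ) - (j1 : ℕ) : ℕ) : ℝ) = (j2 : ℕ) - (j1 : ℕ) := Nat.cast_sub hlt'.le
  have e3 : (((j2 : ℕ) - (j1 : ℕ) : ℕ) : ℝ) * ρ = i j1 - i j2 := by rw [hl]; linarith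
  have hi : i j2 ≤ i j1 := by
    have : (0 : ℝ) ≤ i j1 - i j2 := by rw [← e3]; positivity
    have : (i j2 : ℝ) ≤ i j1 := by linarith
    exact_mod_cast this
  refine ⟨j2 - j1, i j1 - i j2, by omega, by have := j2.isLt; omega, ?_⟩
  rw [e3, Nat.cast_sub hi]

lemma val_int (hx : QReg x) (hm : ∀ i, x i ∈ maximalIdeal A) (hmax : maximalIdeal A ≤ F (sp x) 1) {e : ℕ} (he : ln (sp x) = e)
    {f : A} {n : ℕ} (hE : f ∈ VE (sp x) n) (hG : f ∉ VG (sp x) n) : f ∈ F (sp x) n := by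
  classical
  obtain ⟨w, P, i, h1, h2, ⟨j1, j2, hlt, p1, p2⟩, hr⟩ := pig_pow hx hm hmax he (Nat.cast_nonneg n) hE hG
  set T : Finset (Fin (e + 1)) := Finset.univ.filter (fun j => Prim (P j)) with hT
  have hTn : T.Nonempty := ⟨j2, by simp [hT, p2]⟩
  set s := T.max' hTn with hs
  have hsP : Prim (P s) := by simpa [hT] using T.max'_mem hTn
  have hs0 : 0 < (s : ℕ) := by
    have h : j2 ≤ s := T.le_max' j2 (by simp [hT, p2])
    have h' : (j2 : ℕ) ≤ s := h
    have h'' : (j1 : ℕ) < j2 := hlt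
    omega
  have hsm : ∀ j, s < j → P j = 0 := by
    intro j hj
    rcases h2 j with h | h
    · exact h
    · exact absurd (T.le_max' j (by simp [hT, h.1])) (not_le.2 hj)
  set W : ℕ := i s + s * n with hW
  have hwW : w = W := by
    rw [← ((h2 s).resolve_left (prim_ne_zero hsP)).2, hW]; push_cast; ring
  have hiW : ∀ j, P j ≠ 0 → i j + j * n = W := by
    intro j hj
    have := ((h2 j).resolve_left hj).2
    rw [hwW] at this
    exact_mod_cast this
  set r := ∑ j, MvPolynomial.eval x (P j) * f ^ (j : ℕ) with hrdef
  obtain ⟨b, c, hbc, k, hk⟩ := hr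
  rw [hwW] at hbc
  have hbc' : W * (b + 1) < c := by exact_mod_cast hbc
  set M := (b + 1) * k + 1 with hM
  have hrM : r ^ M ∈ sp x ^ (W * M) := by
    refine hk _ _ ?_
    have : (W * (b + 1) + 1) * M ≤ c * M := Nat.mul_le_mul_right _ hbc'
    have e : (b + 1) * (W * M + k) = W * (b + 1) * M + (b + 1) * k := by ring
    rw [e]
    have e' : (W * (b + 1) + 1) * M = W * (b + 1) * M + M := by ring
    omega
  set p : A[X] := ∑ j : Fin (e + 1), Polynomial.C (MvPolynomial.eval x (P j)) * Polynomial.X ^ (j : ℕ) with hp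
  have hpc : ∀ j, p.coeff j = if h : j < e + 1 then MvPolynomial.eval x (P ⟨j, h⟩) else 0 := by
    intro j
    rw [hp, Polynomial.finsetSum_coeff]
    simp only [Polynomial.coeff_C_mul, Polynomial.coeff_X_pow]
    split_ifs with h
    · rw [Finset.sum_eq_single ⟨j, h⟩]
      · simp
      · intro q _ hq
        rw [if_neg, mul_zero]
        rintro rfl; exact hq rfl
      · intro h; exact absurd (Finset.mem_univ _) h
    · refine Finset.sum_eq_zero fun q _ => ?_
      rw [if_neg, mul_zero]
      rintro rfl; exact h q.isLt
  have hpdeg : p.natDegree ≤ s := by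
    rw [Polynomial.natDegree_le_iff_coeff_eq_zero]
    intro j hj
    rw [hpc]; split_ifs with h
    · rw [hsm ⟨j, h⟩ hj, map_zero]
    · rfl
  have hpmem : ∀ j, p.coeff j ∈ sp x ^ (W - n * j) := by
    intro j
    rw [hpc]; split_ifs with h
    · by_cases h0 : P ⟨j, h⟩ = 0
      · rw [h0, map_zero]; exact Ideal.zero_mem _
      · have := hiW _ h0
        have h3 : W - n * j = i ⟨j, h⟩ := by
          simp only at this; rw [mul_comm n]; omega
        rw [h3]; exact eval_mem_pow x _ _ (h1 _)
    · exact Ideal.zero_mem _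
  have hpow := coeff_pow_mem (sp x) n W p hpmem M
  have hev : (p ^ M).eval f = r ^ M := by
    rw [Polynomial.eval_pow, hp, Polynomial.eval_finsetSum]; simp [hrdef]
  have hdeg : (p ^ M).natDegree ≤ s * M := by
    refine Polynomial.natDegree_pow_le.trans ?_
    rw [mul_comm]; exact Nat.mul_le_mul_right _ hpdeg
  rw [Polynomial.eval_eq_sum_range' (Nat.lt_succ_of_le hdeg), Finset.sum_range_succ] at hev
  have htop : (p ^ M).coeff (s * M) = MvPolynomial.eval x (P s ^ M) := by
    rw [mul_comm, Polynomial.coeff_pow_of_natDegree_le hpdeg, map_pow, hpc, dif_pos s.isLt]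
  rw [htop] at hev
  have hsM : 0 < (s : ℕ) * M := by positivity
  refine mem_F_of_eqn hx ((h1 s).pow M) (hsP.pow M) (n := n) hsM
    (fun j => if j = 0 then r ^ M - (p ^ M).coeff 0 else - (p ^ M).coeff j) ?_ ?_
  · intro j hj
    have e1 : i s * M + n * (s * M - j) = W * M - n * j := by
      have : n * j ≤ n * (s * M) := Nat.mul_le_mul_left _ hj.le
      rw [Nat.mul_sub, hW, add_mul, show (s : ℕ) * n * M = n * (s * M) by ring]
      omega
    rw [e1]
    split_ifs with h
    · subst h
      refine Ideal.sub_mem _ ?_ (hpow 0)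
      simpa using hrM
    · exact Ideal.neg_mem_iff _ |>.2 (hpow j)
  · have e2 : MvPolynomial.eval x (P s ^ M) * f ^ ((s : ℕ) * M) = r ^ M - ∑ j ∈ Finset.range (s * M), (p ^ M).coeff j * f ^ j := by
      rw [← hev]; ring
    rw [e2]
    obtain ⟨q, hq⟩ : ∃ q, (s : ℕ) * M = q + 1 := ⟨s * M - 1, by omega⟩
    rw [hq, Finset.sum_range_succ', Finset.sum_range_succ']
    simp only [if_true, pow_zero, mul_one, Nat.succ_ne_zero, if_false, Nat.add_eq_zero_iff, one_ne_zero, and_false, neg_mul, Finset.sum_neg_distrib]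
    ring

lemma denom (hx : QReg x) (hm : ∀ i, x i ∈ maximalIdeal A) (hmax : maximalIdeal A ≤ F (sp x) 1) {e : ℕ} (he : ln (sp x) = e) :
    ∃ b0 : ℕ, ∀ (f : A) (c : ℕ), f ∈ VG (sp x) ((c : ℝ) / ((b0 : ℝ) + 1)) → f ∈ cl (sp x) (b0 + 1) (c + 1) := by
  obtain ⟨b0, hb0⟩ : ∃ b0, e.factorial = b0 + 1 := ⟨e.factorial - 1, by have := Nat.factorial_pos e; omega⟩
  refine ⟨b0, fun f c hf => ?_⟩
  by_contra hc
  obtain ⟨ρ, h0, hle, hE, hG⟩ := exists_val _ hc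
  have hlt : (c : ℝ) / (b0 + 1) < ρ := by
    by_contra h; push Not at h; exact hG (VG_anti _ h hf)
  obtain ⟨l, n, hl1, hle', hln⟩ := val_rat hx hm hmax he h0 hE hG
  obtain ⟨q, hq⟩ : l ∣ b0 + 1 := by rw [← hb0]; exact Nat.dvd_factorial hl1 hle'
  have hqr : ((b0 : ℝ) + 1) = l * q := by exact_mod_cast hq
  have e1 : ((b0 : ℝ) + 1) * ρ = (q * n : ℕ) := by
    rw [hqr, Nat.cast_mul, ← hln]; ring
  have hpos : (0 : ℝ) < b0 + 1 := by positivity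
  rw [div_lt_iff₀ hpos] at hlt
  rw [le_div_iff₀ hpos] at hle
  have a1 : c < q * n := by
    have : (c : ℝ) < (q * n : ℕ) := by rw [← e1]; linarith
    exact_mod_cast this
  have a2 : q * n ≤ c + 1 := by
    have : ((q * n : ℕ) : ℝ) ≤ (c + 1 : ℕ) := by rw [← e1]; linarith
    exact_mod_cast this
  have a3 : q * n = c + 1 := by omega
  rw [a3] at e1
  apply hc
  rw [mem_cl_iff_pow]
  have e2 : (((b0 + 1 : ℕ) : ℝ)) * ρ = ((c + 1 : ℕ) : ℝ) := by rw [← e1]; push_cast; ring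
  refine val_int hx hm hmax he ?_ ?_
  · rw [← e2]; exact VE_pow _ h0 hE _
  · intro h
    rw [← e2] at h
    exact hG (VG_root _ _ (by omega) h)

end S12
end RN2

namespace RN2

section T1
variable {k : Type*} [Field k] {D : ℕ}

/-- semilinear functional on a field -/
lemma exists_lam (p n : ℕ) [ExpChar k p] {d0 : k} (h : d0 ≠ 0) :
    ∃ l : k →+ k, (∀ c d, l (c ^ p ^ n * d) = c * l d) ∧ l d0 ≠ 0 := by
  letI m : Module k k := Module.compHom k (iterateFrobenius k p n)
  have hm : ∀ c d : k, @HSMul.hSMul k k k (@instHSMul k k m.toSMul) c d = c ^ p ^ n * d := by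
    intro c d
    change iterateFrobenius k p n c * d = _
    rw [iterateFrobenius_def]
  have h1 : ¬ ∀ φ : @LinearMap k k _ _ (RingHom.id k) k k _ _ m Semiring.toModule, φ d0 = 0 := by
    intro h2
    exact h ((@Module.forall_dual_apply_eq_zero_iff k _ k _ m inferInstance d0).1 h2)
  push Not at h1
  obtain ⟨φ, hφ⟩ := h1
  refine ⟨φ.toAddMonoidHom, fun c d => ?_, hφ⟩
  have := @LinearMap.map_smul k k k _ _ _ m Semiring.toModule φ c d
  rw [hm] at this
  exact this

open Classical in
noncomputable def phi (q : ℕ) (l : k →+ k) (β : Fin D →₀ ℕ) : MvPolynomial (Fin D) k →+ MvPolynomial (Fin D) k :=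
  (Finsupp.liftAddHom (fun w => if h : ∃ γ, w = q • γ + β then ((MvPolynomial.monomial h.choose).toAddMonoidHom).comp l else 0)).comp
    (AddMonoidAlgebra.coeffAddEquiv).toAddMonoidHom

open Classical in
lemma phi_monomial {q : ℕ} (hq : 0 < q) (l : k →+ k) (β γ : Fin D →₀ ℕ) (d : k) :
    phi q l β (MvPolynomial.monomial (q • γ + β) d) = MvPolynomial.monomial γ (l d) := by
  have h : ∃ γ', q • γ + β = q • γ' + β := ⟨γ, rfl⟩
  have hc : h.choose = γ := by
    have := h.choose_spec
    have h2 := add_right_cancel this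
    ext i
    have h3 := DFunLike.congr_fun h2 i
    simp only [Finsupp.smul_apply, smul_eq_mul] at h3
    exact (Nat.eq_of_mul_eq_mul_left hq h3).symm
  have e : phi q l β (MvPolynomial.monomial (q • γ + β) d) =
      Finsupp.liftAddHom (fun w => if h : ∃ γ, w = q • γ + β then ((MvPolynomial.monomial h.choose).toAddMonoidHom).comp l else 0)
        (Finsupp.single (q • γ + β) d) := rfl
  rw [e, Finsupp.liftAddHom_apply_single, dif_pos h, hc]
  rfl

open Classical in
lemma phi_monomial' (q : ℕ) (l : k →+ k) (β w : Fin D →₀ ℕ) (d : k) (hw : ¬ ∃ γ, w = q • γ + β) :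
    phi q l β (MvPolynomial.monomial w d) = 0 := by
  have e : phi q l β (MvPolynomial.monomial w d) =
      Finsupp.liftAddHom (fun w => if h : ∃ γ, w = q • γ + β then ((MvPolynomial.monomial h.choose).toAddMonoidHom).comp l else 0)
        (Finsupp.single w d) := rfl
  rw [e, Finsupp.liftAddHom_apply_single, dif_neg hw]
  rfl

lemma coeff_phi {q : ℕ} (hq : 0 < q) (l : k →+ k) (β γ0 : Fin D →₀ ℕ) (P : MvPolynomial (Fin D) k) :
    (phi q l β P).coeff γ0 = l (P.coeff (q • γ0 + β)) := by
  induction P using MvPolynomial.induction_on' with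
  | add p r hp hr => rw [map_add, MvPolynomial.coeff_add, MvPolynomial.coeff_add, hp, hr, map_add]
  | monomial w d =>
    by_cases hw : ∃ γ, w = q • γ + β
    · obtain ⟨γ, rfl⟩ := hw
      rw [phi_monomial hq, MvPolynomial.coeff_monomial, MvPolynomial.coeff_monomial]
      by_cases h0 : γ = γ0
      · simp [h0]
      · rw [if_neg h0, if_neg, map_zero]
        intro h
        have : q • γ = q • γ0 := by simpa using h
        apply h0
        ext i
        have h3 := DFunLike.congr_fun this i
        simp only [Finsupp.smul_apply, smul_eq_mul] at h3
        exact Nat.eq_of_mul_eq_mul_left hq h3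
    · rw [phi_monomial' _ _ _ _ _ hw, MvPolynomial.coeff_monomial, if_neg]
      · simp
      · rintro rfl; exact hw ⟨γ0, rfl⟩

lemma phi_semi (p n : ℕ) [ExpChar k p] (l : k →+ k) (hl : ∀ c d, l (c ^ p ^ n * d) = c * l d) (β : Fin D →₀ ℕ) (hβ : ∀ i, β i < p ^ n)
    (a P : MvPolynomial (Fin D) k) : phi (p ^ n) l β (a ^ p ^ n * P) = a * phi (p ^ n) l β P := by
  haveI : ExpChar (MvPolynomial (Fin D) k) p := inferInstance
  have hq : 0 < p ^ n := pow_pos (expChar_pos k p) n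
  induction a using MvPolynomial.induction_on' with
  | add a b ha hb => rw [add_pow_expChar_pow, add_mul, map_add, ha, hb, add_mul]
  | monomial u c =>
    induction P using MvPolynomial.induction_on' with
    | add a b ha hb => rw [mul_add, map_add, ha, hb, map_add, mul_add]
    | monomial w d =>
      rw [MvPolynomial.monomial_pow, MvPolynomial.monomial_mul]
      by_cases hw : ∃ γ, w = p ^ n • γ + β
      · obtain ⟨γ, rfl⟩ := hw
        rw [← add_assoc, ← smul_add, phi_monomial hq, phi_monomial hq, hl, MvPolynomial.monomial_mul]
      · rw [phi_monomial' _ _ _ _ _ hw, mul_zero]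
        apply phi_monomial'
        rintro ⟨γ, hγ⟩
        apply hw
        refine ⟨γ - u, ?_⟩
        ext i
        have h3 := DFunLike.congr_fun hγ i
        simp only [Finsupp.smul_apply, smul_eq_mul, Finsupp.add_apply, Finsupp.tsub_apply] at h3 ⊢
        have hb := hβ i
        have : u i ≤ γ i := by
          by_contra hlt
          push Not at hlt
          have : p ^ n * (γ i + 1) ≤ p ^ n * u i := Nat.mul_le_mul_left _ hlt
          rw [mul_add] at this
          omega
        rw [Nat.mul_sub]
        have := Nat.mul_le_mul_left (p ^ n) this
        omega

lemma exists_phi (p n : ℕ) [ExpChar k p] {P : MvPolynomial (Fin D) k} (hP : P ≠ 0) :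
    ∃ φ : MvPolynomial (Fin D) k →+ MvPolynomial (Fin D) k, (∀ a b, φ (a ^ p ^ n * b) = a * φ b) ∧ φ P ≠ 0 := by
  have hq : 0 < p ^ n := pow_pos (expChar_pos k p) n
  obtain ⟨w, hw⟩ := MvPolynomial.ne_zero_iff.1 hP
  obtain ⟨l, hl, hl0⟩ := exists_lam p n hw
  let β : Fin D →₀ ℕ := w.mapRange (· % p ^ n) (Nat.zero_mod _)
  let γ : Fin D →₀ ℕ := w.mapRange (· / p ^ n) (Nat.zero_div _)
  have hw' : p ^ n • γ + β = w := by
    ext i; simp [β, γ, Nat.div_add_mod]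
  refine ⟨phi (p ^ n) l β, phi_semi p n l hl β (fun i => Nat.mod_lt _ hq), fun h => hl0 ?_⟩
  rw [← hw', ← coeff_phi hq l β γ P, h, MvPolynomial.coeff_zero]
end T1
end RN2

namespace RN2

section T2

lemma T_field {A K L B : Type*} [CommRing A] [IsDomain A] [IsIntegrallyClosed A] [Field K] [Field L] [Algebra A K] [IsFractionRing A K]
    [Algebra K L] [FiniteDimensional K L] [Algebra A L] [IsScalarTower A K L] [CommRing B] [Algebra A B] [Algebra B L] [IsScalarTower A B L]
    [Algebra.IsIntegral A B] (hinj : Function.Injective (algebraMap B L)) (p : ℕ) [ExpChar K p] {g : B} (hg : g ≠ 0) :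
    ∃ n : ℕ, ∃ T : B →+ A, (∀ (a : A) h, T (a • h) = a ^ p ^ n * T h) ∧ T g ≠ 0 := by
  let E := separableClosure K L
  haveI : IsScalarTower A E L := IsScalarTower.of_algebraMap_eq fun a => by
    rw [IsScalarTower.algebraMap_apply A K L, IsScalarTower.algebraMap_apply A K E, ← IsScalarTower.algebraMap_apply K E L]
  haveI : ExpChar E p := expChar_of_injective_algebraMap (algebraMap K E).injective p
  let n := IsPurelyInseparable.exponent E L
  let σ : L →+* E := IsPurelyInseparable.iterateFrobenius E L p (n := n) le_rfl
  have hσ : ∀ a, algebraMap E L (σ a) = a ^ p ^ n := IsPurelyInseparable.algebraMap_iterateFrobenius E p le_rfl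
  have hσA : ∀ a : A, σ (algebraMap A L a) = algebraMap A E (a ^ p ^ n) := by
    intro a
    apply (algebraMap E L).injective
    rw [hσ, ← IsScalarTower.algebraMap_apply, map_pow]
  have hσi : ∀ h : B, IsIntegral A (σ (algebraMap B L h)) := by
    intro h
    have h1 : IsIntegral A (algebraMap E L (σ (algebraMap B L h))) := by
      rw [hσ]; exact ((Algebra.IsIntegral.isIntegral (R := A) h).algebraMap).pow _
    exact (isIntegral_algebraMap_iff (algebraMap E L).injective).1 h1
  have hne : σ (algebraMap B L g) ≠ 0 := by
    intro h
    have := (map_eq_zero σ).1 h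
    exact hg (hinj (by rw [this, map_zero]))
  -- a multiplier
  obtain ⟨c, hc⟩ : ∃ c : E, Algebra.trace K E (c * σ (algebraMap B L g)) ≠ 0 := by
    obtain ⟨c, hc⟩ : ∃ c : E, Algebra.trace K E c ≠ 0 := by
      by_contra h; push Not at h
      exact Algebra.trace_ne_zero K E (LinearMap.ext h)
    exact ⟨c * (σ (algebraMap B L g))⁻¹, by rwa [mul_assoc, inv_mul_cancel₀ hne, mul_one]⟩
  obtain ⟨y, hy, hnt0⟩ : ∃ y ≠ (0 : A), IsIntegral A (y • c) := by
    have : IsAlgebraic A c := (IsFractionRing.isAlgebraic_iff A K E).2 (Algebra.IsAlgebraic.isAlgebraic c)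
    exact this.exists_integral_multiple
  have hT : ∀ h : B, ∃ t : A, algebraMap A K t = Algebra.trace K E (y • c * σ (algebraMap B L h)) := by
    intro h
    exact IsIntegrallyClosed.isIntegral_iff.1 (Algebra.isIntegral_trace (hnt0.mul (hσi h)))
  choose T hT using hT
  have inj := IsFractionRing.injective A K
  refine ⟨n, AddMonoidHom.mk' T ?_, ?_, ?_⟩
  · intro a b
    apply inj
    rw [map_add, hT, hT, hT, map_add, map_add, mul_add, map_add]
  · intro a h
    change T (a • h) = a ^ p ^ n * T h
    apply inj
    rw [map_mul, hT, hT, Algebra.smul_def a h, map_mul (algebraMap B L), ← IsScalarTower.algebraMap_apply, map_mul σ, hσA, IsScalarTower.algebraMap_apply A K E,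
      mul_left_comm, ← Algebra.smul_def, map_smul, smul_eq_mul]
  · change T g ≠ 0
    intro h
    have h2 := hT g
    rw [h, map_zero, Algebra.smul_def, IsScalarTower.algebraMap_apply A K E, mul_assoc, ← Algebra.smul_def, map_smul, smul_eq_mul] at h2
    rcases mul_eq_zero.1 h2.symm with h3 | h3
    · exact hy (inj (by rw [h3, map_zero]))
    · exact hc h3

variable {k : Type*} [Field k] {D : ℕ}

lemma func_domain {B : Type*} [CommRing B] [IsDomain B] [Algebra (MvPolynomial (Fin D) k) B] [FaithfulSMul (MvPolynomial (Fin D) k) B]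
    [Algebra.IsIntegral (MvPolynomial (Fin D) k) B] (hr : Module.rank (MvPolynomial (Fin D) k) B < Cardinal.aleph0) {g : B} (hg : g ≠ 0) :
    ∃ ψ : B →ₗ[MvPolynomial (Fin D) k] MvPolynomial (Fin D) k, ψ g ≠ 0 := by
  let A := MvPolynomial (Fin D) k
  let K := FractionRing A
  let L := FractionRing B
  letI : Algebra K L := FractionRing.liftAlgebra A L
  haveI : IsScalarTower A K L := FractionRing.isScalarTower_liftAlgebra A L
  haveI : FiniteDimensional K L := by
    rw [FiniteDimensional, ← Module.rank_lt_aleph0_iff]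
    have := Algebra.IsAlgebraic.lift_rank_of_isFractionRing A K B L
    rw [← Cardinal.lift_lt_aleph0, this, Cardinal.lift_lt_aleph0]
    exact hr
  obtain ⟨p, hp⟩ := ExpChar.exists k
  haveI : ExpChar A p := inferInstance
  haveI : ExpChar K p := expChar_of_injective_algebraMap (IsFractionRing.injective A K) p
  obtain ⟨n, T, h1, h2⟩ := T_field (A := A) (K := K) (L := L) (B := B) (IsFractionRing.injective B L) p hg
  obtain ⟨φ, h3, h4⟩ := exists_phi p n h2
  exact ⟨{ toFun := fun b => φ (T b), map_add' := fun a b => by rw [map_add, map_add], map_smul' := fun a b => by rw [h1, h3]; rfl }, h4⟩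

lemma func_reduced {G : Type*} [CommRing G] [IsReduced G] [Algebra (MvPolynomial (Fin D) k) G]
    (htf : ∀ (a : MvPolynomial (Fin D) k) (g : G), a • g = 0 → a = 0 ∨ g = 0)
    [Algebra.IsIntegral (MvPolynomial (Fin D) k) G] (hr : Module.rank (MvPolynomial (Fin D) k) G < Cardinal.aleph0) {g : G} (hg : g ≠ 0) :
    ∃ ψ : G →ₗ[MvPolynomial (Fin D) k] MvPolynomial (Fin D) k, ψ g ≠ 0 := by
  let A := MvPolynomial (Fin D) k
  let S : Submonoid G := 
    { carrier := {z | ∃ a : A, a ≠ 0 ∧ ∃ n : ℕ, z = a • g ^ n}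
      one_mem' := ⟨1, one_ne_zero, 0, by simp⟩
      mul_mem' := by
        rintro _ _ ⟨a, ha, n, rfl⟩ ⟨b, hb, m, rfl⟩
        exact ⟨a * b, mul_ne_zero ha hb, n + m, by rw [smul_mul_smul_comm, pow_add]⟩ }
  have h0 : (0 : G) ∉ S := by
    rintro ⟨a, ha, n, h⟩
    rcases htf _ _ h.symm with h | h
    · exact ha h
    · exact hg (eq_zero_of_pow_eq_zero h)
  obtain ⟨P, hP, -, hd⟩ := Ideal.exists_le_prime_disjoint (⊥ : Ideal G) S (by
    rw [Set.disjoint_left]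
    intro z hz hS
    rw [SetLike.mem_coe, Ideal.mem_bot] at hz
    exact h0 (hz ▸ hS))
  rw [Set.disjoint_left] at hd
  haveI : FaithfulSMul A (G ⧸ P) := by
    rw [faithfulSMul_iff_algebraMap_injective, injective_iff_map_eq_zero]
    intro a ha
    by_contra h
    refine hd (a := algebraMap A G a) ?_ ⟨a, h, 0, by rw [pow_zero, Algebra.algebraMap_eq_smul_one]⟩
    exact Ideal.Quotient.eq_zero_iff_mem.1 ha
  haveI : Algebra.IsIntegral A (G ⧸ P) := ⟨fun z => by
    obtain ⟨z, rfl⟩ := Ideal.Quotient.mk_surjective z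
    exact (Algebra.IsIntegral.isIntegral (R := A) z).map (Ideal.Quotient.mkₐ A P)⟩
  have hr' : Module.rank A (G ⧸ P) < Cardinal.aleph0 := 
    lt_of_le_of_lt (LinearMap.rank_le_of_surjective (Ideal.Quotient.mkₐ A P).toLinearMap Ideal.Quotient.mk_surjective) hr
  have hg' : Ideal.Quotient.mk P g ≠ 0 := by
    intro h
    exact hd (Ideal.Quotient.eq_zero_iff_mem.1 h) ⟨1, one_ne_zero, 1, by simp⟩
  obtain ⟨ψ, hψ⟩ := func_domain hr' hg'
  exact ⟨ψ.comp (Ideal.Quotient.mkₐ A P).toLinearMap, hψ⟩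
end T2
end RN2

namespace RN2

section T3
universe u v
lemma noeth_of_func {A : Type u} [CommRing A] [IsDomain A] [IsNoetherianRing A] (n : ℕ) : ∀ (M : Type v) [AddCommGroup M] [Module A M],
    (∀ m : M, m ≠ 0 → ∃ ψ : M →ₗ[A] A, ψ m ≠ 0) → Module.rank A M ≤ n → IsNoetherian A M := by
  induction n with
  | zero =>
    intro M _ _ hf hr
    have h0 : Module.rank A M = 0 := by simpa using hr
    rw [rank_eq_zero_iff] at h0
    have : Subsingleton M := by
      refine subsingleton_of_forall_eq 0 fun m => ?_
      by_contra hm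
      obtain ⟨ψ, hψ⟩ := hf m hm
      obtain ⟨a, ha, ham⟩ := h0 m
      have : a * ψ m = 0 := by rw [← smul_eq_mul, ← map_smul, ham, map_zero]
      rcases mul_eq_zero.1 this with h | h
      · exact ha h
      · exact hψ h
    infer_instance
  | succ n ih =>
    intro M _ _ hf hr
    by_cases hs : ∃ m : M, m ≠ 0
    · obtain ⟨m, hm⟩ := hs
      obtain ⟨ψ, hψ⟩ := hf m hm
      have hK : IsNoetherian A (LinearMap.ker ψ) := by
        refine ih _ ?_ ?_
        · intro z hz
          obtain ⟨χ, hχ⟩ := hf z (by simpa using hz)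
          exact ⟨χ.comp (LinearMap.ker ψ).subtype, hχ⟩
        · have h1 := rank_quotient_add_rank_of_isDomain (LinearMap.ker ψ)
          have h2 : 1 ≤ Module.rank A (M ⧸ LinearMap.ker ψ) := by
            rw [Cardinal.one_le_iff_ne_zero]
            intro h0
            rw [rank_eq_zero_iff] at h0
            obtain ⟨a, ha, ham⟩ := h0 (Submodule.Quotient.mk m)
            rw [← Submodule.Quotient.mk_smul, Submodule.Quotient.mk_eq_zero, LinearMap.mem_ker, map_smul, smul_eq_mul] at ham
            rcases mul_eq_zero.1 ham with h | h
            · exact ha h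
            · exact hψ h
          have h3 : 1 + Module.rank A (LinearMap.ker ψ) ≤ 1 + (n : Cardinal) := by
            calc _ ≤ Module.rank A (M ⧸ LinearMap.ker ψ) + Module.rank A (LinearMap.ker ψ) := by gcongr
              _ ≤ _ := by rw [h1, add_comm]; exact_mod_cast hr
          exact (Cardinal.add_le_add_iff_of_lt_aleph0 Cardinal.one_lt_aleph0).1 (by rwa [add_comm _ (1 : Cardinal), add_comm _ (1 : Cardinal)])
      haveI := hK
      exact isNoetherian_of_range_eq_ker (LinearMap.ker ψ).subtype ψ (by simp)
    · push Not at hs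
      have : Subsingleton M := subsingleton_of_forall_eq 0 hs
      infer_instance

lemma rank_of_span {A : Type u} [CommRing A] [IsDomain A] {G : Type v} [AddCommGroup G] [Module A G] {ι : Type*} (v : ι → G)
    (hsp : Submodule.span A (Set.range v) = ⊤) (e : ℕ) (hdep : ∀ s : Fin (e + 1) → ι, ¬ LinearIndependent A (fun j => v (s j))) :
    Module.rank A G ≤ e := by
  classical
  obtain ⟨s, hs, hmax⟩ := exists_maximal_linearIndepOn A v
  have hcard : Cardinal.mk s ≤ e := by
    by_contra hlt
    push Not at hlt
    have : ((e + 1 : ℕ) : Cardinal) ≤ Cardinal.mk s := by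
      rw [Nat.cast_succ, ← Cardinal.succ_natCast]; exact Order.succ_le_of_lt hlt
    have h2 : Cardinal.lift (Cardinal.mk (Fin (e + 1))) ≤ Cardinal.lift.{0} (Cardinal.mk s) := by simpa using this
    obtain ⟨f⟩ := Cardinal.lift_mk_le'.1 h2
    exact hdep (fun j => (f j : ι)) (hs.comp f f.injective)
  have hfin : s.Finite := Cardinal.lt_aleph0_iff_set_finite.1 (lt_of_le_of_lt hcard (Cardinal.natCast_lt_aleph0))
  let N := Submodule.span A (v '' s)
  have h1 := rank_quotient_add_rank_of_isDomain N
  have h2 : Module.rank A (G ⧸ N) = 0 := by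
    rw [rank_eq_zero_iff]
    intro z
    obtain ⟨g, rfl⟩ := Submodule.Quotient.mk_surjective _ z
    suffices ∃ a : A, a ≠ 0 ∧ a • g ∈ N by
      obtain ⟨a, ha, h⟩ := this
      exact ⟨a, ha, by rwa [← Submodule.Quotient.mk_smul, Submodule.Quotient.mk_eq_zero]⟩
    have hg : g ∈ Submodule.span A (Set.range v) := hsp ▸ Submodule.mem_top
    induction hg using Submodule.span_induction with
    | mem z hz =>
      obtain ⟨i, rfl⟩ := hz
      by_cases hi : i ∈ s
      · exact ⟨1, one_ne_zero, by rw [one_smul]; exact Submodule.subset_span ⟨i, hi, rfl⟩⟩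
      · exact hmax i hi
    | zero => exact ⟨1, one_ne_zero, by simp⟩
    | add z w _ _ hz hw =>
      obtain ⟨a, ha, h1⟩ := hz
      obtain ⟨b, hb, h2⟩ := hw
      refine ⟨a * b, mul_ne_zero ha hb, ?_⟩
      rw [smul_add]
      refine add_mem ?_ ?_
      · rw [mul_comm, mul_smul]; exact N.smul_mem _ h1
      · rw [mul_smul]; exact N.smul_mem _ h2
    | smul c z _ hz =>
      obtain ⟨a, ha, h1⟩ := hz
      exact ⟨a, ha, by rw [smul_comm]; exact N.smul_mem _ h1⟩
  rw [h2, zero_add] at h1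
  rw [← h1]
  haveI : Fintype s := hfin.fintype
  have h3 : Module.rank A N ≤ Cardinal.mk (v '' s) := rank_span_le _
  refine h3.trans ?_
  haveI := (hfin.image v).fintype
  have h4 : Fintype.card (v '' s) ≤ Fintype.card s := by
    exact Fintype.card_le_of_surjective (fun z : s => (⟨v z, z, z.2, rfl⟩ : v '' s)) (by rintro ⟨_, z, hz, rfl⟩; exact ⟨⟨z, hz⟩, rfl⟩)
  have h5 : Fintype.card s ≤ e := by
    rw [Cardinal.mk_fintype] at hcard; exact_mod_cast hcard
  rw [Cardinal.mk_fintype]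
  exact_mod_cast h4.trans h5

lemma lemT {k : Type*} [Field k] {D : ℕ} {G : Type*} [CommRing G] [IsReduced G] [Algebra (MvPolynomial (Fin D) k) G]
    (htf : ∀ (a : MvPolynomial (Fin D) k) (g : G), a • g = 0 → a = 0 ∨ g = 0)
    [Algebra.IsIntegral (MvPolynomial (Fin D) k) G] {ι : Type*} (v : ι → G)
    (hsp : Submodule.span (MvPolynomial (Fin D) k) (Set.range v) = ⊤) (e : ℕ)
    (hdep : ∀ s : Fin (e + 1) → ι, ¬ LinearIndependent (MvPolynomial (Fin D) k) (fun j => v (s j))) :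
    Module.Finite (MvPolynomial (Fin D) k) G := by
  have hr := rank_of_span v hsp e hdep
  haveI := noeth_of_func e G (fun m hm => func_reduced htf (lt_of_le_of_lt hr Cardinal.natCast_lt_aleph0) hm) hr
  infer_instance
end T3
end RN2

namespace RN2

section G1
variable {A : Type*} [CommRing A] [IsLocalRing A] {D : ℕ}

/-- a filtration with good properties -/
structure GF (x : Fin D → A) (b : ℕ) (C : ℕ → Ideal A) : Prop where
  hb : 0 < b
  zero : C 0 = ⊤
  anti : Antitone C
  mul : ∀ {i j f g}, f ∈ C i → g ∈ C j → f * g ∈ C (i + j)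
  max : maximalIdeal A ≤ C 1
  pw : ∀ i, sp x ^ i ≤ C (b * i)
  can : ∀ {i c f} {P : MvPolynomial (Fin D) A}, P.IsHomogeneous i → Prim P → MvPolynomial.eval x P * f ∈ C (b * i + c) → f ∈ C c

variable {x : Fin D → A} {b : ℕ} {C : ℕ → Ideal A}

def GS (h : GF x b C) : Subring A[X] where
  carrier := {p | ∀ c, p.coeff c ∈ C c}
  mul_mem' := by
    intro p q hp hq c
    rw [Polynomial.coeff_mul]
    refine Ideal.sum_mem _ fun u hu => ?_
    rw [← HasAntidiagonal.mem_antidiagonal.1 hu]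
    exact h.mul (hp _) (hq _)
  one_mem' := by
    intro c
    rw [Polynomial.coeff_one]
    split_ifs with hc
    · rw [hc, h.zero]; trivial
    · exact zero_mem _
  add_mem' := fun hp hq c => by rw [Polynomial.coeff_add]; exact add_mem (hp c) (hq c)
  zero_mem' := fun c => by rw [Polynomial.coeff_zero]; exact zero_mem _
  neg_mem' := fun hp c => by rw [Polynomial.coeff_neg]; exact neg_mem (hp c)

lemma mem_GS {h : GF x b C} {p : A[X]} : p ∈ GS h ↔ ∀ c, p.coeff c ∈ C c := Iff.rfl

def GP (h : GF x b C) : Ideal (GS h) where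
  carrier := {p | ∀ c, p.1.coeff c ∈ C (c + 1)}
  add_mem' := fun hp hq c => by
    change (_ + _ : A[X]).coeff c ∈ _
    rw [Polynomial.coeff_add]; exact add_mem (hp c) (hq c)
  zero_mem' := fun c => by
    change (0 : A[X]).coeff c ∈ _
    rw [Polynomial.coeff_zero]; exact zero_mem _
  smul_mem' := by
    intro p q hq c
    change (p.1 * q.1).coeff c ∈ _
    rw [Polynomial.coeff_mul]
    refine Ideal.sum_mem _ fun u hu => ?_
    rw [← HasAntidiagonal.mem_antidiagonal.1 hu, add_assoc]
    exact h.mul (p.2 _) (hq _)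

abbrev GG (h : GF x b C) := GS h ⧸ GP h

lemma mem_GP {h : GF x b C} {p : GS h} : p ∈ GP h ↔ ∀ c, p.1.coeff c ∈ C (c + 1) := Iff.rfl

noncomputable def gmk (h : GF x b C) (p : A[X]) (hp : p ∈ GS h) : GG h := Ideal.Quotient.mk (GP h) ⟨p, hp⟩

lemma gmk_surj (h : GF x b C) (g : GG h) : ∃ p hp, g = gmk h p hp := by
  obtain ⟨⟨p, hp⟩, rfl⟩ := Ideal.Quotient.mk_surjective g
  exact ⟨p, hp, rfl⟩

lemma gmk_eq_zero {h : GF x b C} {p : A[X]} {hp : p ∈ GS h} : gmk h p hp = 0 ↔ ∀ c, p.coeff c ∈ C (c + 1) := by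
  rw [gmk, Ideal.Quotient.eq_zero_iff_mem, mem_GP]

lemma gmk_mul {h : GF x b C} {p q : A[X]} (hp : p ∈ GS h) (hq : q ∈ GS h) : gmk h p hp * gmk h q hq = gmk h (p * q) (mul_mem hp hq) := rfl
lemma gmk_add {h : GF x b C} {p q : A[X]} (hp : p ∈ GS h) (hq : q ∈ GS h) : gmk h p hp + gmk h q hq = gmk h (p + q) (add_mem hp hq) := rfl
lemma gmk_sub {h : GF x b C} {p q : A[X]} (hp : p ∈ GS h) (hq : q ∈ GS h) : gmk h p hp - gmk h q hq = gmk h (p - q) (sub_mem hp hq) := rfl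
lemma gmk_pow {h : GF x b C} {p : A[X]} (hp : p ∈ GS h) (n : ℕ) : gmk h p hp ^ n = gmk h (p ^ n) (pow_mem hp n) := rfl
lemma gmk_congr {h : GF x b C} {p q : A[X]} (hp : p ∈ GS h) (hq : q ∈ GS h) (e : p = q) : gmk h p hp = gmk h q hq := by subst e; rfl
lemma gmk_sum {h : GF x b C} {ι : Type*} (s : Finset ι) (p : ι → A[X]) (hp : ∀ i, p i ∈ GS h) :
    ∑ i ∈ s, gmk h (p i) (hp i) = gmk h (∑ i ∈ s, p i) (sum_mem fun i _ => hp i) := by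
  rw [gmk]
  have : (⟨∑ i ∈ s, p i, sum_mem fun i _ => hp i⟩ : GS h) = ∑ i ∈ s, ⟨p i, hp i⟩ := by
    apply Subtype.ext; simp
  rw [this, map_sum]; rfl

lemma mono_mem (h : GF x b C) {f : A} {c : ℕ} (hf : f ∈ C c) : Polynomial.monomial c f ∈ GS h := by
  intro n
  rw [Polynomial.coeff_monomial]
  split_ifs with e
  · rwa [← e]
  · exact zero_mem _

/-- the evaluation into `A[X]` -/
noncomputable def Ev (x : Fin D → A) (b : ℕ) : MvPolynomial (Fin D) A →+* A[X] :=
  MvPolynomial.eval₂Hom Polynomial.C (fun i => Polynomial.monomial b (x i))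

lemma Ev_hom {i : ℕ} {P : MvPolynomial (Fin D) A} (hP : P.IsHomogeneous i) :
    Ev x b P = Polynomial.monomial (b * i) (MvPolynomial.eval x P) := by
  have e1 := MvPolynomial.eval_eq x P
  rw [e1, map_sum, Ev, MvPolynomial.coe_eval₂Hom, MvPolynomial.eval₂_eq]
  refine Finset.sum_congr rfl fun a ha => ?_
  have hd : ∑ j ∈ a.support, a j = i := by
    have := hP (MvPolynomial.mem_support_iff.1 ha)
    have h' : a.degree = i := by rwa [Finsupp.degree_eq_weight_one]
    rw [← h']; rfl
  have e2 : ∀ s : Finset (Fin D), ∏ j ∈ s, (Polynomial.monomial b (x j)) ^ a j = Polynomial.monomial (b * ∑ j ∈ s, a j) (∏ j ∈ s, x j ^ a j) := by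
    intro s
    induction s using Finset.induction_on with
    | empty => simp
    | insert j s hj ih =>
      rw [Finset.prod_insert hj, Finset.prod_insert hj, Finset.sum_insert hj, ih, Polynomial.monomial_pow, Polynomial.monomial_mul_monomial, mul_add]
  rw [e2, hd, Polynomial.C_mul_monomial]

lemma Ev_eq (P : MvPolynomial (Fin D) A) :
    Ev x b P = ∑ i ∈ Finset.range (P.totalDegree + 1), Polynomial.monomial (b * i) (MvPolynomial.eval x (MvPolynomial.homogeneousComponent i P)) := by
  conv_lhs => rw [← MvPolynomial.sum_homogeneousComponent P, map_sum]
  exact Finset.sum_congr rfl fun i _ => Ev_hom (MvPolynomial.homogeneousComponent_isHomogeneous i P)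

lemma Ev_coeff_mul (hb : 0 < b) (P : MvPolynomial (Fin D) A) (i : ℕ) :
    (Ev x b P).coeff (b * i) = MvPolynomial.eval x (MvPolynomial.homogeneousComponent i P) := by
  rw [Ev_eq, Polynomial.finsetSum_coeff]
  simp_rw [Polynomial.coeff_monomial]
  by_cases hi : i < P.totalDegree + 1
  · rw [Finset.sum_eq_single i]
    · simp
    · intro j _ hj
      rw [if_neg]
      intro e; exact hj (Nat.eq_of_mul_eq_mul_left hb e)
    · intro h; exact absurd (Finset.mem_range.2 hi) h
  · rw [Finset.sum_eq_zero, MvPolynomial.homogeneousComponent_eq_zero _ _ (by omega), map_zero]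
    intro j hj
    rw [Finset.mem_range] at hj
    rw [if_neg]
    intro e; have := Nat.eq_of_mul_eq_mul_left hb e; omega

lemma Ev_coeff_ne (P : MvPolynomial (Fin D) A) (u : ℕ) (h : ∀ i, u ≠ b * i) : (Ev x b P).coeff u = 0 := by
  rw [Ev_eq, Polynomial.finsetSum_coeff]
  refine Finset.sum_eq_zero fun j _ => ?_
  rw [Polynomial.coeff_monomial, if_neg (fun e => h j e.symm)]

lemma Ev_mem (h : GF x b C) (P : MvPolynomial (Fin D) A) : Ev x b P ∈ GS h := by
  rw [Ev_eq]
  refine sum_mem fun i _ => mono_mem h (h.pw i ?_)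
  exact eval_mem_pow x _ _ (MvPolynomial.homogeneousComponent_isHomogeneous i P)

noncomputable def kG (h : GF x b C) : ResidueField A →+* GG h :=
  Ideal.Quotient.lift (maximalIdeal A) ((Ideal.Quotient.mk (GP h)).comp ((Polynomial.C).codRestrict (GS h) (fun r => by
    rw [← Polynomial.monomial_zero_left]; exact mono_mem h (by rw [h.zero]; trivial)))) (by
      intro r hr
      refine Ideal.Quotient.eq_zero_iff_mem.2 ?_
      intro c
      change (Polynomial.C r).coeff c ∈ _
      rw [Polynomial.coeff_C]
      split_ifs with e
      · rw [e]; exact h.max hr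
      · exact zero_mem _)

noncomputable instance GGalg (h : GF x b C) : Algebra (MvPolynomial (Fin D) (ResidueField A)) (GG h) :=
  (MvPolynomial.eval₂Hom (kG h) (fun i => gmk h (Polynomial.monomial b (x i)) (mono_mem h (by
    have := h.pw 1 (by rw [pow_one]; exact mem_sp x i); rwa [mul_one] at this)))).toAlgebra

lemma algebraMap_map (h : GF x b C) (P : MvPolynomial (Fin D) A) :
    algebraMap (MvPolynomial (Fin D) (ResidueField A)) (GG h) (MvPolynomial.map (residue A) P) = gmk h (Ev x b P) (Ev_mem h P) := by
  induction P using MvPolynomial.induction_on with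
  | C a =>
    rw [MvPolynomial.map_C]
    change MvPolynomial.eval₂ _ _ _ = _
    rw [MvPolynomial.eval₂_C]
    have : Ev x b (MvPolynomial.C a) = Polynomial.C a := by rw [Ev, MvPolynomial.coe_eval₂Hom, MvPolynomial.eval₂_C]
    rw [gmk_congr _ (this ▸ Ev_mem h _) this]
    rfl
  | add p q hp hq => rw [map_add, map_add, hp, hq, gmk_add]; exact gmk_congr _ _ (map_add _ _ _).symm
  | mul_X p i hp =>
    rw [map_mul, map_mul, hp, MvPolynomial.map_X]
    have e1 : algebraMap (MvPolynomial (Fin D) (ResidueField A)) (GG h) (MvPolynomial.X i) = gmk h (Polynomial.monomial b (x i)) (mono_mem h (by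
      have := h.pw 1 (by rw [pow_one]; exact mem_sp x i); rwa [mul_one] at this)) := MvPolynomial.eval₂_X _ _ _
    rw [e1, gmk_mul]
    refine gmk_congr _ _ ?_
    rw [map_mul, Ev, MvPolynomial.coe_eval₂Hom, MvPolynomial.eval₂_X]

lemma smul_gmk (h : GF x b C) (P : MvPolynomial (Fin D) A) {p : A[X]} (hp : p ∈ GS h) :
    (MvPolynomial.map (residue A) P) • gmk h p hp = gmk h (Ev x b P * p) (mul_mem (Ev_mem h P) hp) := by
  rw [Algebra.smul_def, algebraMap_map, gmk_mul]

/-- lifts with coefficients zero or unit -/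
lemma exists_lift0 (P : MvPolynomial (Fin D) (ResidueField A)) : ∃ Q : MvPolynomial (Fin D) A, MvPolynomial.map (residue A) Q = P ∧
    ∀ a, Q.coeff a = 0 ∨ Q.coeff a ∉ maximalIdeal A := by
  classical
  obtain ⟨s, hs⟩ := (residue_surjective (R := A)).hasRightInverse
  refine ⟨∑ a ∈ P.support, MvPolynomial.monomial a (s (P.coeff a)), ?_, fun a => ?_⟩
  · rw [map_sum]
    simp_rw [MvPolynomial.map_monomial, hs (_)]
    exact P.support_sum_monomial_coeff
  · rw [MvPolynomial.coeff_sum]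
    simp_rw [MvPolynomial.coeff_monomial]
    rw [Finset.sum_ite_eq']
    split_ifs with ha
    · right
      rw [← residue_eq_zero_iff, hs]
      exact MvPolynomial.mem_support_iff.1 ha
    · left; rfl

end G1
end RN2

namespace RN2

section G2
variable {A : Type*} [CommRing A] [IsLocalRing A] {D : ℕ} {x : Fin D → A} {b : ℕ} {C : ℕ → Ideal A}

lemma low {p : A[X]} (hn : ¬ ∀ c, p.coeff c ∈ C (c + 1)) : ∃ c0, p.coeff c0 ∉ C (c0 + 1) ∧ ∀ c < c0, p.coeff c ∈ C (c + 1) := by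
  classical
  push Not at hn
  refine ⟨Nat.find hn, Nat.find_spec hn, fun c hc => ?_⟩
  have := Nat.find_min hn hc
  push Not at this
  exact this

lemma coeff_low (h : GF x b C) {p q : A[X]} (hp : p ∈ GS h) (hq : q ∈ GS h) (c d : ℕ) (h1 : ∀ u < c, p.coeff u ∈ C (u + 1)) (h2 : ∀ u < d, q.coeff u ∈ C (u + 1))
    (h3 : (p * q).coeff (c + d) ∈ C (c + d + 1)) : p.coeff c * q.coeff d ∈ C (c + d + 1) := by
  rw [Polynomial.coeff_mul, ← Finset.add_sum_erase _ _ (HasAntidiagonal.mem_antidiagonal.2 rfl : ((c, d) : ℕ × ℕ) ∈ HasAntidiagonal.antidiagonal (c + d))] at h3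
  refine (Ideal.add_mem_iff_left _ ?_).1 h3
  refine Ideal.sum_mem _ fun u hu => ?_
  rw [Finset.mem_erase, HasAntidiagonal.mem_antidiagonal] at hu
  obtain ⟨hne, hs⟩ := hu
  rcases lt_trichotomy u.1 c with hl | hl | hl
  · have := h.mul (h1 _ hl) (hq u.2)
    rwa [show u.1 + 1 + u.2 = c + d + 1 by omega] at this
  · exfalso; apply hne; ext <;> simp <;> omega
  · have := h.mul (hp u.1) (h2 u.2 (by omega))
    rwa [show u.1 + (u.2 + 1) = c + d + 1 by omega] at this

lemma GG_tf (h : GF x b C) (P : MvPolynomial (Fin D) (ResidueField A)) (g : GG h) (hz : P • g = 0) : P = 0 ∨ g = 0 := by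
  by_contra hcon
  push Not at hcon
  obtain ⟨hP, hg⟩ := hcon
  obtain ⟨Q, rfl, hQ⟩ := exists_lift0 P
  obtain ⟨p, hp, rfl⟩ := gmk_surj h g
  rw [smul_gmk, gmk_eq_zero] at hz
  obtain ⟨d, hd, hd'⟩ := low (mt gmk_eq_zero.2 hg)
  have hQ0 : ∃ i, MvPolynomial.homogeneousComponent i Q ≠ 0 := by
    by_contra hc
    push Not at hc
    apply hP
    rw [← MvPolynomial.sum_homogeneousComponent Q, Finset.sum_eq_zero (fun i _ => hc i), map_zero]
  classical
  let i := Nat.find hQ0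
  have hi := Nat.find_spec hQ0
  have hi' : ∀ j < i, MvPolynomial.homogeneousComponent j Q = 0 := fun j hj => by
    have := Nat.find_min hQ0 hj; push Not at this; exact this
  have hprim : Prim (MvPolynomial.homogeneousComponent i Q) := by
    obtain ⟨a, ha⟩ := MvPolynomial.ne_zero_iff.1 hi
    refine ⟨a, ?_⟩
    rw [MvPolynomial.coeff_homogeneousComponent] at ha ⊢
    split_ifs at ha ⊢ with hh
    · exact (hQ a).resolve_left ha
    · exact absurd rfl ha
  have key := coeff_low h (Ev_mem h Q) hp (b * i) d ?_ hd' (hz _)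
  · rw [Ev_coeff_mul h.hb, add_assoc] at key
    exact hd (h.can (MvPolynomial.homogeneousComponent_isHomogeneous i Q) hprim key)
  · intro u hu
    by_cases hex : ∃ j, u = b * j
    · obtain ⟨j, rfl⟩ := hex
      rw [Ev_coeff_mul h.hb, hi' j (Nat.lt_of_mul_lt_mul_left hu), map_zero]; exact zero_mem _
    · push Not at hex
      rw [Ev_coeff_ne _ _ hex]; exact zero_mem _

lemma GG_red (h : GF x b C) (hred : ∀ c f, f ∈ C c → f * f ∈ C (c + c + 1) → f ∈ C (c + 1)) : IsReduced (GG h) := by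
  rw [isReduced_iff_pow_one_lt 2 one_lt_two]
  intro g hg
  obtain ⟨p, hp, rfl⟩ := gmk_surj h g
  by_contra hne
  obtain ⟨d, hd, hd'⟩ := low (mt gmk_eq_zero.2 hne)
  rw [pow_two, gmk_mul, gmk_eq_zero] at hg
  exact hd (hred d _ (hp d) (coeff_low h hp hp d d hd' hd' (hg _)))

noncomputable def vv (h : GF x b C) (i : {z : A × ℕ // z.1 ∈ C z.2}) : GG h := gmk h (Polynomial.monomial i.1.2 i.1.1) (mono_mem h i.2)

lemma gmk_eq_sum (h : GF x b C) (p : A[X]) (hp : p ∈ GS h) : gmk h p hp = ∑ i ∈ Finset.range (p.natDegree + 1), vv h ⟨(p.coeff i, i), hp i⟩ := by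
  have := gmk_sum (h := h) (Finset.range (p.natDegree + 1)) (fun i => Polynomial.monomial i (p.coeff i)) (fun i => mono_mem h (hp i))
  unfold vv
  rw [this]
  exact gmk_congr _ _ (by conv_lhs => rw [p.as_sum_range])

lemma GG_span (h : GF x b C) : Submodule.span (MvPolynomial (Fin D) (ResidueField A)) (Set.range (vv h)) = ⊤ := by
  rw [eq_top_iff]
  rintro g -
  obtain ⟨p, hp, rfl⟩ := gmk_surj h g
  rw [gmk_eq_sum]
  exact sum_mem fun i _ => Submodule.subset_span ⟨_, rfl⟩

lemma isInt_of_eqn {S G : Type*} [CommRing S] [CommRing G] [Algebra S G] (y : G) (s : ℕ) (a : ℕ → S)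
    (h : y ^ s = ∑ i ∈ Finset.range s, algebraMap S G (a i) * y ^ i) : IsIntegral S y := by
  refine ⟨Polynomial.X ^ s - ∑ i ∈ Finset.range s, Polynomial.C (a i) * Polynomial.X ^ i, Polynomial.monic_X_pow_sub ?_, ?_⟩
  · refine lt_of_le_of_lt (Polynomial.degree_sum_le _ _) ((Finset.sup_lt_iff (WithBot.bot_lt_coe s)).2 fun i hi => ?_)
    refine lt_of_le_of_lt (Polynomial.degree_C_mul_X_pow_le _ _) ?_
    exact WithBot.coe_lt_coe.2 (Finset.mem_range.1 hi)
  · rw [Polynomial.eval₂_sub, Polynomial.eval₂_finsetSum, Polynomial.eval₂_X_pow, h, sub_eq_zero]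
    refine Finset.sum_congr rfl fun i _ => ?_
    rw [Polynomial.eval₂_mul, Polynomial.eval₂_C, Polynomial.eval₂_X_pow]

lemma GG_int (h : GF x b C) (hnt0 : ∀ c f, f ∈ C c → ∃ s, ∃ q : ℕ → A, (∀ i < s, q i ∈ sp x ^ (c * (s - i))) ∧
    (f ^ b) ^ s = ∑ i ∈ Finset.range s, q i * (f ^ b) ^ i) : Algebra.IsIntegral (MvPolynomial (Fin D) (ResidueField A)) (GG h) := by
  refine ⟨fun g => ?_⟩
  obtain ⟨p, hp, rfl⟩ := gmk_surj h g
  rw [gmk_eq_sum]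
  refine IsIntegral.sum _ fun i _ => ?_
  have key : ∀ (f : A) (c : ℕ) (hf : f ∈ C c), IsIntegral (MvPolynomial (Fin D) (ResidueField A)) (vv h ⟨(f, c), hf⟩) := by
    intro f c hf
    refine IsIntegral.of_pow h.hb ?_
    obtain ⟨s, q, h1, h2⟩ := hnt0 c f hf
    have : ∀ i, ∃ P : MvPolynomial (Fin D) A, i < s → (P.IsHomogeneous (c * (s - i)) ∧ MvPolynomial.eval x P = q i) := by
      intro i
      by_cases hi : i < s
      · obtain ⟨P, hP⟩ := exists_form' x _ _ (h1 i hi)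
        exact ⟨P, fun _ => hP⟩
      · exact ⟨0, fun h => absurd h hi⟩
    choose P hP using this
    refine isInt_of_eqn _ s (fun i => MvPolynomial.map (residue A) (P i)) ?_
    unfold vv
    simp_rw [algebraMap_map, gmk_pow, gmk_mul]
    rw [gmk_sum (h := h) (Finset.range s) (fun i => Ev x b (P i) * ((Polynomial.monomial c f) ^ b) ^ i) (fun i => mul_mem (Ev_mem h _) (pow_mem (pow_mem (mono_mem h hf) _) _))]
    refine gmk_congr _ _ ?_
    rw [Polynomial.monomial_pow, Polynomial.monomial_pow, h2, map_sum]
    refine Finset.sum_congr rfl fun i hi => ?_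
    have hi := Finset.mem_range.1 hi
    rw [Ev_hom (hP i hi).1, (hP i hi).2, Polynomial.monomial_pow, Polynomial.monomial_mul_monomial]
    congr 2
    obtain ⟨l, rfl⟩ := Nat.exists_eq_add_of_lt hi
    rw [show i + l + 1 - i = l + 1 by omega]; ring
  exact key _ _ _

lemma GG_dep (h : GF x b C) (e : ℕ) (hdep : ∀ (f : Fin (e + 1) → A) (c : Fin (e + 1) → ℕ), (∀ j, f j ∈ C (c j)) →
      ∃ w : ℕ, ∃ P : Fin (e + 1) → MvPolynomial (Fin D) A, ∃ i : Fin (e + 1) → ℕ, (∀ j, (P j).IsHomogeneous (i j)) ∧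
      (∀ j, P j = 0 ∨ (b * i j + c j = w)) ∧ (∃ j, Prim (P j)) ∧ ∑ j, MvPolynomial.eval x (P j) * f j ∈ C (w + 1))
    (s : Fin (e + 1) → {z : A × ℕ // z.1 ∈ C z.2}) : ¬ LinearIndependent (MvPolynomial (Fin D) (ResidueField A)) (fun j => vv h (s j)) := by
  obtain ⟨w, P, i, h1, h2, ⟨j0, h3⟩, h4⟩ := hdep (fun j => (s j).1.1) (fun j => (s j).1.2) (fun j => (s j).2)
  rw [Fintype.not_linearIndependent_iff]
  refine ⟨fun j => MvPolynomial.map (residue A) (P j), ?_, j0, ?_⟩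
  · unfold vv
    simp_rw [smul_gmk]
    rw [gmk_sum (h := h) Finset.univ (fun j => Ev x b (P j) * Polynomial.monomial (s j).1.2 (s j).1.1) (fun j => mul_mem (Ev_mem h _) (mono_mem h (s j).2)), gmk_eq_zero]
    have : ∑ j, Ev x b (P j) * Polynomial.monomial (s j).1.2 (s j).1.1 = Polynomial.monomial w (∑ j, MvPolynomial.eval x (P j) * (s j).1.1) := by
      rw [map_sum]
      refine Finset.sum_congr rfl fun j _ => ?_
      rcases h2 j with h0 | h0
      · rw [h0]; simp
      · rw [Ev_hom (h1 j), Polynomial.monomial_mul_monomial, h0]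
    rw [this]
    intro c
    rw [Polynomial.coeff_monomial]
    split_ifs with e
    · rw [← e]; exact h4
    · exact zero_mem _
  · obtain ⟨a, ha⟩ := h3
    intro h0
    apply ha
    rw [← residue_eq_zero_iff, ← MvPolynomial.coeff_map]
    dsimp only at h0
    rw [h0, MvPolynomial.coeff_zero]

lemma coeff_JC (h : GF x b C) (P : MvPolynomial (Fin D) A) {p : A[X]} (hp : p ∈ GS h) {c : ℕ} (hd : p.natDegree ≤ c) :
    (Ev x b P * p).coeff (c + b) ∈ sp x * C c := by
  rw [Polynomial.coeff_mul]
  refine Ideal.sum_mem _ fun u hu => ?_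
  have hs := HasAntidiagonal.mem_antidiagonal.1 hu
  by_cases hu2 : c < u.2
  · rw [Polynomial.coeff_eq_zero_of_natDegree_lt (lt_of_le_of_lt hd hu2), mul_zero]; exact zero_mem _
  · by_cases hex : ∃ j, u.1 = b * j
    · obtain ⟨j, hj⟩ := hex
      have hj1 : ∃ l, j = l + 1 := by
        rcases j with _ | l
        · have := h.hb; simp at hj; omega
        · exact ⟨l, rfl⟩
      obtain ⟨l, rfl⟩ := hj1
      rw [hj, Ev_coeff_mul h.hb]
      have h1 := eval_mem_pow x _ _ (MvPolynomial.homogeneousComponent_isHomogeneous (l + 1) P)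
      have h2 := Ideal.mul_mem_mul h1 (hp u.2)
      rw [pow_succ', mul_assoc] at h2
      refine Ideal.mul_mono_right ?_ h2
      rw [Ideal.mul_le]
      intro r hr t ht
      have := h.mul (h.pw l hr) ht
      rwa [show b * l + u.2 = c by rw [mul_add] at hj; omega] at this
    · push Not at hex
      rw [Ev_coeff_ne _ _ hex, zero_mul]; exact zero_mem _

lemma GF_fin (h : GF x b C) [Module.Finite (MvPolynomial (Fin D) (ResidueField A)) (GG h)] :
    ∃ c0, ∀ c, c0 ≤ c → C (c + b) ≤ sp x * C c ⊔ C (c + b + 1) := by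
  obtain ⟨n, s, hs⟩ := Module.Finite.exists_fin (R := MvPolynomial (Fin D) (ResidueField A)) (M := GG h)
  choose p hp hsp using fun i => gmk_surj h (s i)
  refine ⟨∑ i, (p i).natDegree, fun c hc f hf => ?_⟩
  have hmem : gmk h (Polynomial.monomial (c + b) f) (mono_mem h hf) ∈ Submodule.span (MvPolynomial (Fin D) (ResidueField A)) (Set.range s) := by rw [hs]; trivial
  rw [Submodule.mem_span_range_iff_exists_fun] at hmem
  obtain ⟨a, ha⟩ := hmem
  choose Q hQ _ using fun i => exists_lift0 (a i)
  have e1 : ∑ i, a i • s i = gmk h (∑ i, Ev x b (Q i) * p i) (sum_mem fun i _ => mul_mem (Ev_mem h _) (hp i)) := by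
    rw [← gmk_sum (h := h) Finset.univ (fun i => Ev x b (Q i) * p i) (fun i => mul_mem (Ev_mem h _) (hp i))]
    refine Finset.sum_congr rfl fun i _ => ?_
    rw [← smul_gmk h (Q i) (hp i), hQ, ← hsp]
  rw [e1, eq_comm, ← sub_eq_zero, gmk_sub, gmk_eq_zero] at ha
  have h2 := ha (c + b)
  rw [Polynomial.coeff_sub, Polynomial.coeff_monomial, if_pos rfl, Polynomial.finsetSum_coeff] at h2
  rw [← sub_add_cancel f (∑ i, (Ev x b (Q i) * p i).coeff (c + b))]
  refine add_mem (Ideal.mem_sup_right h2) (Ideal.mem_sup_left (Ideal.sum_mem _ fun i _ => coeff_JC h _ (hp i) ?_))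
  exact (Finset.single_le_sum (f := fun i => (p i).natDegree) (fun i _ => Nat.zero_le _) (Finset.mem_univ i)).trans hc
end G2
end RN2

namespace RN2

section G3
variable {A : Type*} [CommRing A] [IsLocalRing A] [IsNoetherianRing A] {D : ℕ} {x : Fin D → A}

lemma GF_cl (hx : QReg x) (hmax : maximalIdeal A ≤ F (sp x) 1) (b0 : ℕ) : GF x (b0 + 1) (cl (sp x) (b0 + 1)) where
  hb := by omega
  zero := cl_zero _ _
  anti := cl_anti _ _
  mul := fun hf hg => cl_mul_mem _ _ hf hg
  max := by
    refine hmax.trans ?_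
    rw [← cl_mul_eq_F _ (b0 + 1)]
    exact cl_anti _ _ (by omega)
  pw := fun i => pow_le_cl _ _ i
  can := fun {i c f P} hP hp h => cl_cancel (b0 + 1) hx hP hp c f (by rwa [show c + i * (b0 + 1) = (b0 + 1) * i + c by ring])

lemma step (hx : QReg x) (hm : ∀ i, x i ∈ maximalIdeal A) (hmax : maximalIdeal A ≤ F (sp x) 1) {e : ℕ} (he : ln (sp x) = e) :
    ∃ b0 c0 : ℕ, ∀ c, c0 ≤ c → cl (sp x) (b0 + 1) (c + (b0 + 1)) ≤ sp x * cl (sp x) (b0 + 1) c ⊔ cl (sp x) (b0 + 1) (c + (b0 + 1) + 1) := by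
  obtain ⟨b0, hb0⟩ := denom hx hm hmax he
  have hpos : (0 : ℝ) < (b0 : ℝ) + 1 := by positivity
  have h := GF_cl hx hmax b0
  refine ⟨b0, ?_⟩
  haveI : IsReduced (GG h) := GG_red h (by
    intro c f hf hff
    refine hb0 f c (VG_root (sp x) 2 (by norm_num) ?_)
    refine mem_VG.2 ⟨b0, c + c + 1, ?_, by rwa [pow_two]⟩
    push_cast
    rw [mul_assoc, div_mul_cancel₀ _ hpos.ne']; linarith)
  haveI : Algebra.IsIntegral (MvPolynomial (Fin D) (ResidueField A)) (GG h) := GG_int h (by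
    intro c f hf
    exact F_integral (sp x) ((mem_cl_iff_pow _ _ _ _).1 hf))
  haveI := lemT (GG_tf h) (vv h) (GG_span h) e (GG_dep h e (by
    intro f c hf
    obtain ⟨w, P, i, h1, h2, ⟨j0, h3⟩, h4⟩ := pig hx hm hmax he f (fun j => (c j : ℝ) / ((b0 : ℝ) + 1)) (fun j => by positivity)
      (fun j => cl_le_VE _ _ _ (hf j))
    have hw : ∀ j, P j = 0 ∨ w = ((((b0 + 1) * i j + c j : ℕ)) : ℝ) / ((b0 : ℝ) + 1) := by
      intro j
      rcases h2 j with h | ⟨_, h⟩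
      · exact Or.inl h
      · right; rw [← h]; push_cast; field_simp
    have hw0 := (hw j0).resolve_left (prim_ne_zero h3)
    refine ⟨(b0 + 1) * i j0 + c j0, P, i, h1, fun j => ?_, ⟨j0, h3⟩, hb0 _ _ (by rw [← hw0]; exact h4)⟩
    rcases hw j with h | h
    · exact Or.inl h
    · right
      rw [hw0, div_left_inj' hpos.ne'] at h
      exact_mod_cast h.symm))
  exact GF_fin h

lemma mem_of_sup_pow (K : Ideal A) (f : A) (h : ∀ a, f ∈ K ⊔ maximalIdeal A ^ a) : f ∈ K := by
  have h1 := Ideal.iInf_pow_smul_eq_bot_of_isLocalRing (M := A ⧸ K) (maximalIdeal A) (maximalIdeal.isMaximal A).ne_top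
  rw [← Ideal.Quotient.eq_zero_iff_mem]
  have : (Ideal.Quotient.mk K f) ∈ (⨅ i : ℕ, maximalIdeal A ^ i • (⊤ : Submodule A (A ⧸ K))) := by
    rw [Submodule.mem_iInf]
    intro i
    obtain ⟨u, hu, v, hv, rfl⟩ := Submodule.mem_sup.1 (h i)
    rw [map_add, Ideal.Quotient.eq_zero_iff_mem.2 hu, zero_add]
    have : Ideal.Quotient.mk K v = v • (1 : A ⧸ K) := by rw [Algebra.smul_def, mul_one]; rfl
    rw [this]
    exact Submodule.smul_mem_smul hv trivial
  rw [h1] at this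
  exact this

lemma FIN_of_W (hx : QReg x) (hm : ∀ i, x i ∈ maximalIdeal A) (hmax : maximalIdeal A ≤ F (sp x) 1) {e : ℕ} (he : ln (sp x) = e)
    (hW : ∀ a, ∃ n, F (sp x) n ≤ maximalIdeal A ^ a) : FIN (sp x) := by
  obtain ⟨b0, c0, h⟩ := step hx hm hmax he
  have h1 : ∀ j c, c0 ≤ c → cl (sp x) (b0 + 1) (c + (b0 + 1)) ≤ sp x * cl (sp x) (b0 + 1) c ⊔ cl (sp x) (b0 + 1) (c + (b0 + 1) + j) := by
    intro j
    induction j with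
    | zero => intro c _; exact le_sup_right
    | succ j ih =>
      intro c hc
      refine (ih c hc).trans (sup_le le_sup_left ?_)
      rw [show c + (b0 + 1) + j = (c + j) + (b0 + 1) by omega]
      refine (h (c + j) (by omega)).trans (sup_le_sup (Ideal.mul_mono_right (cl_anti _ _ (by omega))) (cl_anti _ _ (by omega)))
  have h2 : ∀ c, c0 ≤ c → cl (sp x) (b0 + 1) (c + (b0 + 1)) ≤ sp x * cl (sp x) (b0 + 1) c := by
    intro c hc f hf
    refine mem_of_sup_pow _ _ fun a => ?_
    obtain ⟨n, hn⟩ := hW a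
    refine (sup_le_sup_left ?_ _ : sp x * cl (sp x) (b0 + 1) c ⊔ _ ≤ _) (h1 ((b0 + 1) * n) c hc hf)
    refine le_trans ?_ hn
    rw [← cl_mul_eq_F _ (b0 + 1)]
    exact cl_anti _ _ (by omega)
  have h3 : ∀ r, cl (sp x) (b0 + 1) (c0 + (b0 + 1) * r) ≤ sp x ^ r := by
    intro r
    induction r with
    | zero => simp
    | succ r ih =>
      rw [show c0 + (b0 + 1) * (r + 1) = (c0 + (b0 + 1) * r) + (b0 + 1) by ring, pow_succ']
      exact (h2 _ (by omega)).trans (Ideal.mul_mono_right ih)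
  refine ⟨c0, fun n => le_trans ?_ (h3 n)⟩
  rw [← cl_mul_eq_F _ (b0 + 1)]
  refine cl_anti _ _ ?_
  nlinarith
end G3
end RN2

namespace RN2
section W1
lemma noeth_adic {A B : Type*} [CommRing A] [IsNoetherianRing A] [CommRing B] [Algebra A B] {n : ℕ} (a : Fin n → B)
    (K : Ideal B) (hK : K = Ideal.span (Set.range a)) [hc : IsAdicComplete K B]
    (hs : Function.Surjective ((Ideal.Quotient.mk K).comp (algebraMap A B))) : IsNoetherianRing B := by
  letI : UniformSpace A := ⊥
  haveI : DiscreteUniformity A := inferInstance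
  letI : WithIdeal B := ⟨K⟩
  have hA : IsAdic K := rfl
  obtain ⟨h1, h2⟩ := hA.isAdicComplete_iff.1 hc
  haveI : IsLinearTopology B B := IsLinearTopology.mk_of_hasBasis (p := fun _ => True) (s := fun n : ℕ => K ^ n) B hA.hasBasis_nhds_zero
  haveI : ContinuousSMul A B := ⟨by
    have : (fun p : A × B => p.1 • p.2) = fun p : A × B => algebraMap A B p.1 * p.2 := by
      funext p; rw [Algebra.smul_def]
    rw [this]
    exact ((continuous_of_discreteTopology).comp continuous_fst).mul continuous_snd⟩
  have ha : MvPowerSeries.HasEval a := ⟨fun i => by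
    rw [IsTopologicallyNilpotent, hA.hasBasis_nhds_zero.tendsto_right_iff]
    intro j _
    filter_upwards [Filter.eventually_ge_atTop j] with m hm
    exact Ideal.pow_le_pow_right hm (Ideal.pow_mem_pow (hK ▸ Ideal.subset_span ⟨i, rfl⟩) m), by simp⟩
  let f : MvPowerSeries (Fin n) A →ₐ[A] B := MvPowerSeries.aeval ha
  have hX : ∀ i, f (MvPowerSeries.X i) = a i := fun i => by
    rw [← MvPolynomial.coe_X]
    rw [MvPowerSeries.aeval_coe, MvPolynomial.aeval_X]
  have hmap : (Ideal.span (Set.range MvPowerSeries.X) : Ideal (MvPowerSeries (Fin n) A)).map (f : MvPowerSeries (Fin n) A →+* B) = K := by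
    rw [Ideal.map_span, ← Set.range_comp, hK]
    congr 2
    funext i
    exact hX i
  have hsurj : Function.Surjective (f : MvPowerSeries (Fin n) A →+* B) := by
    haveI : IsHausdorff ((Ideal.span (Set.range MvPowerSeries.X) : Ideal (MvPowerSeries (Fin n) A)).map (f : MvPowerSeries (Fin n) A →+* B)) B := by
      rw [hmap]; infer_instance
    refine surjective_of_mk_map_comp_surjective (I := (Ideal.span (Set.range MvPowerSeries.X) : Ideal (MvPowerSeries (Fin n) A))) (f : MvPowerSeries (Fin n) A →+* B) ?_
    rw [hmap]
    intro y
    obtain ⟨r, hr⟩ := hs y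
    exact ⟨algebraMap A _ r, by rw [← hr]; simp⟩
  exact isNoetherianRing_of_surjective _ _ _ hsurj

lemma noeth_compl (A : Type*) [CommRing A] [IsLocalRing A] [IsNoetherianRing A] : IsNoetherianRing (AdicCompletion (maximalIdeal A) A) := by
  obtain ⟨n, a, ha⟩ := Submodule.fg_iff_exists_fin_generating_family.1 ((maximalIdeal A).fg_of_isNoetherianRing)
  haveI := AdicCompletion.isAdicComplete_self _ ((maximalIdeal A).fg_of_isNoetherianRing)
  refine noeth_adic (A := A) (fun i => algebraMap A _ (a i)) ((maximalIdeal A).map (algebraMap A _)) ?_ ?_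
  · refine (congrArg (Ideal.map (algebraMap A (AdicCompletion (maximalIdeal A) A))) ha.symm).trans ?_
    change Ideal.map _ (Ideal.span _) = _
    rw [Ideal.map_span, ← Set.range_comp]; rfl
  · intro y
    obtain ⟨y, rfl⟩ := Ideal.Quotient.mk_surjective y
    obtain ⟨z, hz⟩ := Ideal.Quotient.mk_surjective (AdicCompletion.evalₐ (maximalIdeal A) 1 y)
    refine ⟨z, ?_⟩
    rw [RingHom.comp_apply, Ideal.Quotient.eq, ← AdicCompletion.maximalIdeal_eq_map, AdicCompletion.mem_maximalIdeal_iff_eval_one_eq_zero]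
    have := AdicCompletion.factor_evalₐ_eq_eval (I := maximalIdeal A) (n := 1) (algebraMap A _ z - y) (by simp)
    rw [AdicCompletion.eval_apply] at this
    rw [← this, map_sub, hz.symm]
    simp

end W1
end RN2

namespace RN2
section W2
lemma nzd_order {C : Type*} [CommRing C] [IsNoetherianRing C] (P : Ideal C) (hP : P ≠ ⊤) (z : C) (hz : ∀ w, z * w = 0 → w = 0) :
    ∃ k, ∀ j i, z ^ j ∈ P ^ i → i ≤ j * k := by
  obtain ⟨k, hk⟩ := Ideal.exists_pow_inf_eq_pow_smul P (Ideal.span {z} : Submodule C C)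
  refine ⟨k, fun j => ?_⟩
  induction j with
  | zero =>
    intro i hi
    by_contra h
    rw [pow_zero, ← Ideal.eq_top_iff_one] at hi
    exact hP (top_le_iff.1 (hi ▸ Ideal.pow_le_self (by omega)))
  | succ j ih =>
    intro i hi
    by_cases hik : i < k
    · nlinarith
    push Not at hik
    have h1 : z ^ (j + 1) ∈ (P ^ i • ⊤ ⊓ Ideal.span {z} : Submodule C C) := by
      refine ⟨by simpa using hi, ?_⟩
      rw [pow_succ']
      exact Ideal.mul_mem_right _ _ (Ideal.mem_span_singleton_self z)
    rw [hk i hik] at h1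
    have h2 : (P ^ (i - k) • (P ^ k • ⊤ ⊓ Ideal.span {z}) : Submodule C C) ≤ Ideal.span {z} * P ^ (i - k) := by
      rw [mul_comm]
      exact Submodule.smul_mono le_rfl inf_le_right
    obtain ⟨w, hw, hw2⟩ := Ideal.mem_span_singleton_mul.1 (h2 h1)
    have h3 : z ^ j = w := by
      have := hz (z ^ j - w) (by rw [mul_sub, hw2, pow_succ']; ring)
      exact sub_eq_zero.1 this
    have := ih (i - k) (h3 ▸ hw)
    rw [add_mul, one_mul]; omega

lemma red_order {B : Type*} [CommRing B] [IsLocalRing B] [IsNoetherianRing B] [IsReduced B] (z : B) (hz : z ≠ 0) :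
    ∃ k, ∀ j i, z ^ j ∈ maximalIdeal B ^ i → i ≤ j * k := by
  let K : Ideal B := LinearMap.ker (LinearMap.mulLeft B z)
  have hK : ∀ w, w ∈ K ↔ z * w = 0 := fun w => by simp [K]
  have hKm : K ≤ maximalIdeal B := le_maximalIdeal fun h => hz (by
    have := (hK 1).1 (h ▸ trivial)
    simpa using this)
  obtain ⟨k, hk⟩ := nzd_order ((maximalIdeal B).map (Ideal.Quotient.mk K)) (by
    intro h
    have := congrArg (Ideal.comap (Ideal.Quotient.mk K)) h
    rw [Ideal.comap_map_of_surjective _ Ideal.Quotient.mk_surjective, Ideal.comap_top] at this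
    rw [← RingHom.ker_eq_comap_bot, Ideal.mk_ker, sup_eq_left.2 hKm] at this
    exact (maximalIdeal.isMaximal B).ne_top this) (Ideal.Quotient.mk K z) (by
    intro w hw
    obtain ⟨w, rfl⟩ := Ideal.Quotient.mk_surjective w
    rw [← map_mul, Ideal.Quotient.eq_zero_iff_mem, hK] at hw
    rw [Ideal.Quotient.eq_zero_iff_mem, hK]
    have : (z * w) ^ 2 = 0 := by
      rw [show (z * w) ^ 2 = (z * (z * w)) * w by ring, hw, zero_mul]
    exact pow_eq_zero_iff (two_ne_zero) |>.1 this)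
  refine ⟨k, fun j i h => hk j i ?_⟩
  rw [← map_pow, ← Ideal.map_pow]
  exact Ideal.mem_map_of_mem _ h

variable {A : Type*} [CommRing A] [IsLocalRing A] [IsNoetherianRing A]

lemma artin_quot (a : ℕ) : IsArtinianRing (A ⧸ maximalIdeal A ^ a) := by
  by_cases h : maximalIdeal A ^ a = ⊤
  · haveI : Subsingleton (A ⧸ maximalIdeal A ^ a) := Ideal.Quotient.subsingleton_iff.2 h
    infer_instance
  haveI : Nontrivial (A ⧸ maximalIdeal A ^ a) := Ideal.Quotient.nontrivial_iff.2 h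
  haveI : IsLocalRing (A ⧸ maximalIdeal A ^ a) := IsLocalRing.of_surjective' (Ideal.Quotient.mk _) Ideal.Quotient.mk_surjective
  rw [isArtinianRing_iff_isNilpotent_maximalIdeal]
  refine ⟨a, ?_⟩
  have : maximalIdeal (A ⧸ maximalIdeal A ^ a) ≤ (maximalIdeal A).map (Ideal.Quotient.mk _) := by
    intro w hw
    obtain ⟨w, rfl⟩ := Ideal.Quotient.mk_surjective w
    refine Ideal.mem_map_of_mem _ ?_
    by_contra hu
    rw [mem_maximalIdeal, mem_nonunits_iff, not_not] at hu
    exact hw (hu.map _)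
  rw [Ideal.zero_eq_bot, ← le_bot_iff]
  refine (Ideal.pow_right_mono this a).trans ?_
  rw [← Ideal.map_pow, Ideal.map_quotient_self]

lemma stab (G : ℕ → Ideal A) (hG : Antitone G) (a : ℕ) : ∃ N, ∀ n, N ≤ n → G N ⊔ maximalIdeal A ^ a = G n ⊔ maximalIdeal A ^ a := by
  haveI := artin_quot (A := A) a
  obtain ⟨N, hN⟩ := IsArtinian.monotone_stabilizes (R := A ⧸ maximalIdeal A ^ a) (M := A ⧸ maximalIdeal A ^ a)
    ⟨fun n => OrderDual.toDual ((G n).map (Ideal.Quotient.mk (maximalIdeal A ^ a))), fun i j h => Ideal.map_mono (hG h)⟩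
  refine ⟨N, fun n hn => ?_⟩
  have := congrArg (fun K => Ideal.comap (Ideal.Quotient.mk (maximalIdeal A ^ a)) (OrderDual.ofDual K)) (hN n hn)
  replace this : Ideal.comap (Ideal.Quotient.mk (maximalIdeal A ^ a)) ((G N).map (Ideal.Quotient.mk (maximalIdeal A ^ a)))
    = Ideal.comap (Ideal.Quotient.mk (maximalIdeal A ^ a)) ((G n).map (Ideal.Quotient.mk (maximalIdeal A ^ a))) := this
  rwa [Ideal.comap_map_of_surjective _ Ideal.Quotient.mk_surjective, Ideal.comap_map_of_surjective _ Ideal.Quotient.mk_surjective, ← RingHom.ker_eq_comap_bot, Ideal.mk_ker] at this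

lemma mem_of_eval (z : AdicCompletion (maximalIdeal A) A) (i : ℕ) (h : AdicCompletion.evalₐ (maximalIdeal A) i z = 0) :
    z ∈ maximalIdeal (AdicCompletion (maximalIdeal A) A) ^ i := by
  have := AdicCompletion.factor_evalₐ_eq_eval (I := maximalIdeal A) (n := i) z (by simp)
  rw [h, map_zero] at this
  have h2 : z ∈ LinearMap.ker (AdicCompletion.eval (maximalIdeal A) A i) := this.symm
  rw [← AdicCompletion.pow_smul_top_eq_ker_eval ((maximalIdeal A).fg_of_isNoetherianRing), Ideal.smul_top_eq_map] at h2
  rw [AdicCompletion.maximalIdeal_eq_map, ← Ideal.map_pow]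
  exact h2

lemma WW (hR : IsReduced (AdicCompletion (maximalIdeal A) A)) (J : Ideal A) (hJ : J ≤ maximalIdeal A) (a : ℕ) :
    ∃ n, F J n ≤ maximalIdeal A ^ a := by
  by_contra hcon
  push Not at hcon
  haveI := noeth_compl A
  choose N hN using stab (F J) (F_anti J)
  have hst : ∀ b n, N b ≤ n → F J (N b) ≤ F J n ⊔ maximalIdeal A ^ b := fun b n hn => by
    rw [← hN b n hn]; exact le_sup_left
  have hst' : ∀ b n, F J (N b) ≤ F J n ⊔ maximalIdeal A ^ b := fun b n => by
    rcases le_total (N b) n with h | h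
    · exact hst b n h
    · exact (F_anti J h).trans le_sup_left
  have hstep : ∀ (b : ℕ) (u : A), u ∈ F J (N b) ⊔ maximalIdeal A ^ b → ∃ v, v ∈ F J (N (b+1)) ∧ v - u ∈ maximalIdeal A ^ b := by
    intro b u hu
    have : u ∈ F J (N (b + 1)) ⊔ maximalIdeal A ^ b := (sup_le (hst' b _) le_sup_right : F J (N b) ⊔ maximalIdeal A ^ b ≤ _) hu
    obtain ⟨p, hp, q, hq, rfl⟩ := Submodule.mem_sup.1 this
    exact ⟨p, hp, by simpa using hq⟩
  choose! g hg1 hg2 using hstep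
  obtain ⟨u0, hu0, hu0'⟩ := SetLike.not_le_iff_exists.1 (hcon (N a))
  let u : ℕ → A := fun n => Nat.rec u0 (fun i v => g (a + i) v) n
  have hu1 : ∀ n, u n ∈ F J (N (a + n)) := by
    intro n
    induction n with
    | zero => exact hu0
    | succ n ih => exact hg1 (a + n) (u n) (Ideal.mem_sup_left ih)
  have hu2 : ∀ n, u (n + 1) - u n ∈ maximalIdeal A ^ (a + n) := fun n => hg2 (a + n) (u n) (Ideal.mem_sup_left (hu1 n))
  have hu3 : ∀ n, u n - u0 ∈ maximalIdeal A ^ a := by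
    intro n
    induction n with
    | zero => simp [u]
    | succ n ih =>
      have := Ideal.add_mem _ (Ideal.pow_le_pow_right (by omega) (hu2 n) : u (n + 1) - u n ∈ maximalIdeal A ^ a) ih
      simpa using this
  let s : AdicCompletion.AdicCauchySequence (maximalIdeal A) A := AdicCompletion.AdicCauchySequence.mk (maximalIdeal A) A u (by
    intro n
    rw [SModEq.comm, SModEq.sub_mem]
    simpa using Ideal.pow_le_pow_right (by omega) (hu2 n))
  let z := AdicCompletion.mk (maximalIdeal A) A s
  have hz : ∀ n, AdicCompletion.evalₐ (maximalIdeal A) n z = Ideal.Quotient.mk _ (u n) := fun n => AdicCompletion.evalₐ_mk _ n s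
  have hz0 : z ≠ 0 := by
    intro h0
    have := hz a
    rw [h0, map_zero, eq_comm, Ideal.Quotient.eq_zero_iff_mem] at this
    exact hu0' (by have := Ideal.sub_mem _ this (hu3 a); simpa using this)
  obtain ⟨k, hk⟩ := red_order z hz0
  obtain ⟨c, hc⟩ := F_unif J (k + 1)
  have := hk (c + 1) (k * c + k + 1) (mem_of_eval _ _ (by
    rw [map_pow, hz, ← map_pow, Ideal.Quotient.eq_zero_iff_mem]
    set i := k * c + k + 1 with hi
    have h1 : u i ∈ F J (k + 1) ⊔ maximalIdeal A ^ (a + i) := hst' _ _ (hu1 i)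
    have h2 : u i ∈ F J (k + 1) ⊔ maximalIdeal A ^ i := (sup_le_sup_left (Ideal.pow_le_pow_right (by omega)) _ : _ ≤ F J (k + 1) ⊔ maximalIdeal A ^ i) h1
    obtain ⟨p, hp, q, hq, hpq⟩ := Submodule.mem_sup.1 h2
    have h3 : p ^ (c + 1) ∈ maximalIdeal A ^ i := Ideal.pow_right_mono hJ i (hc i (c + 1) (by rw [hi]; apply le_of_eq; ring) (Ideal.pow_mem_pow hp _))
    rw [← Ideal.Quotient.eq_zero_iff_mem] at h3 hq ⊢
    rw [← hpq, map_pow, map_add, hq, add_zero, ← map_pow, h3]))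
  nlinarith
end W2
end RN2

namespace RN2
section CM1
variable {A : Type*} [CommRing A]

def RS : (D : ℕ) → (Fin D → A) → Prop
  | 0, _ => True
  | D + 1, x => Reg (x 0) (sp (Fin.tail x)) ∧ RS D (Fin.tail x)

lemma sp_succ {D : ℕ} (x : Fin (D + 1) → A) : sp x = sp (Fin.tail x) ⊔ Ideal.span {x 0} := by
  refine le_antisymm (Ideal.span_le.2 ?_) (sup_le (Ideal.span_le.2 ?_) (Ideal.span_le.2 ?_))
  · rintro _ ⟨i, rfl⟩
    refine Fin.cases ?_ (fun j => ?_) i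
    · exact Ideal.mem_sup_right (Ideal.mem_span_singleton_self _)
    · exact Ideal.mem_sup_left (mem_sp (Fin.tail x) j)
  · rintro _ ⟨i, rfl⟩
    exact mem_sp x i.succ
  · rintro _ rfl
    exact mem_sp x 0

lemma reg_pow {D : ℕ} {y : Fin D → A} (hy : QReg y) {z : A} (hz : Reg z (sp y)) (n : ℕ) : Reg z (sp y ^ n) := by
  induction n with
  | zero => intro f _; simp
  | succ n ih =>
    intro f hf
    have h1 : f ∈ sp y ^ n := ih f (Ideal.pow_le_pow_right (by omega) hf)
    obtain ⟨P, hP, rfl⟩ := exists_form' y n f h1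
    have h2 := hy n (MvPolynomial.C z * P) (by simpa using (MvPolynomial.isHomogeneous_C _ z).mul hP) (by simpa using hf)
    have := eval_mem_of_coeff y (sp y) n P hP (fun a => hz _ (by simpa using h2 a))
    rwa [← pow_succ'] at this

lemma VV {b : Ideal A} {z : A} (hz : ∀ n, Reg z (b ^ n)) (n : ℕ) : ∀ f : ℕ → A, (∀ i ≤ n, f i ∈ b ^ (n - i)) →
    ∑ i ∈ Finset.range (n + 1), f i * z ^ i ∈ (b ⊔ Ideal.span {z}) ^ (n + 1) → ∀ i ≤ n, f i ∈ (b ⊔ Ideal.span {z}) * b ^ (n - i) := by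
  have hzJ : z ∈ b ⊔ Ideal.span {z} := Ideal.mem_sup_right (Ideal.mem_span_singleton_self z)
  induction n with
  | zero =>
    intro f hf hs i hi
    obtain rfl : i = 0 := by omega
    simpa using hs
  | succ n ih =>
    intro f hf hs
    obtain ⟨c, hc, e⟩ := mem_sup_span_pow b z _ _ hs
    -- reduce to the zero case
    have key : ∀ g : ℕ → A, (∀ i ≤ n + 1, g i ∈ b ^ (n + 1 - i)) → ∑ i ∈ Finset.range (n + 2), g i * z ^ i = 0 →
        ∀ i ≤ n + 1, g i ∈ (b ⊔ Ideal.span {z}) * b ^ (n + 1 - i) := by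
      intro g hg h0
      rw [Finset.sum_range_succ'] at h0
      set h := ∑ i ∈ Finset.range (n + 1), g (i + 1) * z ^ i with hh
      have e1 : z * h + g 0 = 0 := by
        rw [← h0, hh, Finset.mul_sum]
        congr 1
        · exact Finset.sum_congr rfl fun i _ => by ring
        · simp
      have hb : h ∈ b ^ (n + 1) := hz (n + 1) h (by
        rw [eq_neg_of_add_eq_zero_left e1]
        exact neg_mem (by simpa using hg 0 (by omega)))
      have h2 := ih (fun i => g (i + 1)) (fun i hi => by
        have := hg (i + 1) (by omega)
        rwa [show n + 1 - (i + 1) = n - i by omega] at this) (Ideal.pow_right_mono le_sup_left _ hb)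
      intro i hi
      rcases i with _ | i
      · rw [eq_neg_of_add_eq_zero_right e1]
        exact neg_mem (Ideal.mul_mem_mul hzJ hb)
      · have := h2 i (by omega)
        rwa [show n + 1 - (i + 1) = n - i by omega]
    let q : ℕ → A := fun i => if i = n + 1 then c (n + 1) + c (n + 2) * z else c i
    have hq : ∀ i ≤ n + 1, q i ∈ (b ⊔ Ideal.span {z}) * b ^ (n + 1 - i) := by
      intro i hi
      by_cases h : i = n + 1
      · subst h
        simp only [q, if_true]
        rw [Nat.sub_self, pow_zero, Ideal.one_eq_top, Ideal.mul_top]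
        refine Ideal.add_mem _ (Ideal.mem_sup_left ?_) (Ideal.mul_mem_left _ _ hzJ)
        have := hc (n + 1) (by omega)
        rwa [show n + 1 + 1 - (n + 1) = 1 by omega, pow_one] at this
      · simp only [q, if_neg h]
        have := hc i (by omega)
        rw [show n + 1 + 1 - i = (n + 1 - i) + 1 by omega, pow_succ'] at this
        exact Ideal.mul_mono_left le_sup_left this
    have hfin := key (fun i => f i - q i) (fun i hi => Ideal.sub_mem _ (hf i hi) ((Ideal.mul_le_right : (b ⊔ Ideal.span {z}) * b ^ (n + 1 - i) ≤ b ^ (n + 1 - i)) (hq i hi))) (by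
      simp only [sub_mul]
      rw [Finset.sum_sub_distrib, e, Finset.sum_range_succ _ (n + 2), Finset.sum_range_succ _ (n + 1), Finset.sum_range_succ _ (n + 1)]
      have : ∑ i ∈ Finset.range (n + 1), q i * z ^ i = ∑ i ∈ Finset.range (n + 1), c i * z ^ i :=
        Finset.sum_congr rfl fun i hi => by
          have := Finset.mem_range.1 hi
          simp only [q, if_neg (show i ≠ n + 1 by omega)]
      rw [this]
      simp only [q, if_true]
      ring)
    intro i hi
    have := Ideal.add_mem _ (hfin i hi) (hq i hi)
    simpa using this

lemma QReg_of_RS (D : ℕ) : ∀ x : Fin D → A, RS D x → QReg x := by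
  induction D with
  | zero =>
    intro x _ n P hP h a
    have e : sp x = ⊥ := by simp [sp]
    rw [e] at h ⊢
    rw [MvPolynomial.eq_C_of_isEmpty P] at h ⊢
    rw [MvPolynomial.eval_C, ← Ideal.zero_eq_bot, zero_pow (by omega), Ideal.zero_eq_bot, Ideal.mem_bot] at h
    rw [h]; simp
  | succ D ih =>
    rintro x ⟨h0, h1⟩ n P hP h a
    set y := Fin.tail x with hy
    have hyq := ih y h1
    have hx : x = Fin.cons (x 0) y := (Fin.cons_self_tail x).symm
    have hd : (MvPolynomial.finSuccEquiv A D P).natDegree < n + 1 := by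
      rw [MvPolynomial.natDegree_finSuccEquiv]
      have := MvPolynomial.degreeOf_le_totalDegree P 0
      have := hP.totalDegree_le
      omega
    have hev : MvPolynomial.eval x P = ∑ i ∈ Finset.range (n + 1), MvPolynomial.eval y ((MvPolynomial.finSuccEquiv A D P).coeff i) * x 0 ^ i := by
      conv_lhs => rw [hx]
      rw [MvPolynomial.eval_eq_eval_mv_eval', Polynomial.eval_eq_sum_range' (n := n + 1) (lt_of_le_of_lt Polynomial.natDegree_map_le hd)]
      simp
    have hhom : ∀ i ≤ n, ((MvPolynomial.finSuccEquiv A D P).coeff i).IsHomogeneous (n - i) := fun i hi =>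
      hP.finSuccEquiv_coeff_isHomogeneous i (n - i) (by omega)
    rw [hev, sp_succ x] at h
    have hV := VV (fun n => reg_pow hyq h0 n) n _ (fun i hi => eval_mem_pow y _ _ (hhom i hi)) h
    have ha : a = Finsupp.cons (a 0) (Finsupp.tail a) := (Finsupp.cons_tail a).symm
    rw [ha, ← MvPolynomial.finSuccEquiv_coeff_coeff]
    by_cases hi : a 0 ≤ n
    · have h2 := hV (a 0) hi
      rw [Ideal.sup_mul] at h2
      obtain ⟨u, hu, v, hv, e⟩ := Submodule.mem_sup.1 h2
      obtain ⟨w, hw, rfl⟩ := Ideal.mem_span_singleton_mul.1 hv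
      obtain ⟨Q, hQ, rfl⟩ := exists_form' y _ w hw
      have h3 := hyq _ ((MvPolynomial.finSuccEquiv A D P).coeff (a 0) - MvPolynomial.C (x 0) * Q)
        ((hhom _ hi).sub (by simpa using (MvPolynomial.isHomogeneous_C _ (x 0)).mul hQ))
        (by rw [map_sub, ← e, pow_succ']; simpa using hu) (Finsupp.tail a)
      rw [MvPolynomial.coeff_sub, MvPolynomial.coeff_C_mul] at h3
      rw [sp_succ x]
      have := Ideal.add_mem _ (Ideal.mem_sup_left h3 : _ ∈ sp (Fin.tail x) ⊔ Ideal.span {x 0})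
        (Ideal.mem_sup_right (Ideal.mul_mem_right (MvPolynomial.coeff (Finsupp.tail a) Q) _ (Ideal.mem_span_singleton_self (x 0))))
      simpa using this
    · rw [Polynomial.coeff_eq_zero_of_natDegree_lt (by omega)]
      simp
end CM1
end RN2

namespace RN2
section CM2
variable {A : Type*} [CommRing A] [IsLocalRing A] [IsNoetherianRing A]

def Dp : ℕ → Ideal A → Prop
  | 0, _ => True
  | n + 1, a => ∃ r ∈ maximalIdeal A, Reg r a ∧ Dp n (a ⊔ Ideal.span {r})

lemma mem_sup_sp {a : Ideal A} {r f : A} : f ∈ a ⊔ Ideal.span {r} ↔ ∃ α ∈ a, ∃ g, f = α + r * g := by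
  rw [Submodule.mem_sup]
  constructor
  · rintro ⟨α, hα, y, hy, rfl⟩
    obtain ⟨g, rfl⟩ := Ideal.mem_span_singleton'.1 hy
    exact ⟨α, hα, g, by ring⟩
  · rintro ⟨α, hα, g, rfl⟩
    exact ⟨α, hα, r * g, Ideal.mul_mem_right _ _ (Ideal.mem_span_singleton_self r), rfl⟩

lemma nak {a N : Ideal A} {r : A} (hr : r ∈ maximalIdeal A) (h : ∀ f ∈ N, ∃ α ∈ a, ∃ g ∈ N, f = α + r * g) : N ≤ a := by
  refine Submodule.le_of_le_smul_of_le_jacobson_bot (I := maximalIdeal A) (IsNoetherian.noetherian N) ?_ ?_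
  · rw [IsLocalRing.jacobson_eq_maximalIdeal ⊥ bot_ne_top]
  · intro f hf
    obtain ⟨α, hα, g, hg, rfl⟩ := h f hf
    exact Ideal.add_mem _ (Ideal.mem_sup_left hα) (Ideal.mem_sup_right (Ideal.mul_mem_mul hr hg))

lemma swap1 {a : Ideal A} {r c : A} (hrm : r ∈ maximalIdeal A) (hr : Reg r a) (hc : Reg c (a ⊔ Ideal.span {r})) : Reg c a := by
  intro f hf
  refine (nak (a := a) (N := Submodule.comap (LinearMap.mulLeft A c) a) hrm ?_) (show f ∈ _ from hf)
  intro f hf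
  have hf : c * f ∈ a := hf
  obtain ⟨α, hα, g, rfl⟩ := mem_sup_sp.1 (hc f (Ideal.mem_sup_left hf))
  refine ⟨α, hα, g, ?_, rfl⟩
  show c * g ∈ a
  apply hr
  have : r * (c * g) = c * (α + r * g) - c * α := by ring
  rw [this]
  exact Ideal.sub_mem _ hf (Ideal.mul_mem_left _ _ hα)

lemma swap2 {a : Ideal A} {r c : A} (hr : Reg r a) (hc : Reg c (a ⊔ Ideal.span {r})) : Reg r (a ⊔ Ideal.span {c}) := by
  intro f hf
  obtain ⟨α, hα, g, e⟩ := mem_sup_sp.1 hf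
  have hg : g ∈ a ⊔ Ideal.span {r} := hc g (mem_sup_sp.2 ⟨-α, a.neg_mem hα, f, by rw [e]; ring⟩)
  obtain ⟨β, hβ, h, rfl⟩ := mem_sup_sp.1 hg
  have := hr (f - c * h) (by
    have : r * (f - c * h) = α + c * β := by rw [mul_sub, e]; ring
    rw [this]
    exact a.add_mem hα (Ideal.mul_mem_left _ _ hβ))
  exact mem_sup_sp.2 ⟨_, this, h, by ring⟩

def Soc (a : Ideal A) : Prop := ∀ w, (∀ b ∈ maximalIdeal A, b * w ∈ a) → w ∈ a

lemma soc_step {a : Ideal A} {r s c : A} (hr : Reg r a) (hrm : r ∈ maximalIdeal A) (hs : Soc (a ⊔ Ideal.span {r}))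
    (hc : Reg c a) : Soc (a ⊔ Ideal.span {c}) := by
  intro w hw
  obtain ⟨α, hα, v, e⟩ := mem_sup_sp.1 (hw r hrm)
  have hv : v ∈ a ⊔ Ideal.span {r} := hs v (fun b hb => by
    obtain ⟨β, hβ, u, e2⟩ := mem_sup_sp.1 (hw b hb)
    have := hc (b * v - r * u) (by
      have : c * (b * v - r * u) = r * β - b * α := by linear_combination b * (-e) + r * e2
      rw [this]
      exact a.sub_mem (Ideal.mul_mem_left _ _ hβ) (Ideal.mul_mem_left _ _ hα))
    exact mem_sup_sp.2 ⟨_, this, u, by ring⟩)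
  obtain ⟨β, hβ, v', rfl⟩ := mem_sup_sp.1 hv
  have := hr (w - c * v') (by
    have : r * (w - c * v') = α + c * β := by linear_combination e
    rw [this]
    exact a.add_mem hα (Ideal.mul_mem_left _ _ hβ))
  exact mem_sup_sp.2 ⟨_, this, v', by ring⟩

lemma soc_of_reg {a : Ideal A} {r : A} (hr : Reg r a) (hrm : r ∈ maximalIdeal A) : Soc a :=
  fun w hw => hr w (hw r hrm)

lemma mem_ass {a P : Ideal A} (h : IsAssociatedPrime P (A ⧸ a)) : ∃ w, w ∉ a ∧ ∀ b, b ∈ P ↔ b * w ∈ a := by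
  obtain ⟨hp, x, hx⟩ := isAssociatedPrime_iff.1 h
  obtain ⟨w, rfl⟩ := Ideal.Quotient.mk_surjective x
  have key : ∀ b, b ∈ P ↔ b * w ∈ a := by
    intro b
    rw [hx, Submodule.mem_colon_singleton, Submodule.mem_bot, ← Ideal.Quotient.eq_zero_iff_mem, map_mul]
    rfl
  refine ⟨w, fun hw => hp.ne_top ((Ideal.eq_top_iff_one _).2 ((key 1).2 (by simpa using hw))), key⟩

lemma not_reg {a : Ideal A} {c : A} (h : ¬ Reg c a) : ∃ P : Ideal A, IsAssociatedPrime P (A ⧸ a) ∧ c ∈ P := by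
  unfold Reg at h
  push Not at h
  obtain ⟨f, hf, hf'⟩ := h
  obtain ⟨P, hP, hle⟩ := exists_le_isAssociatedPrime_of_isNoetherianRing A (Ideal.Quotient.mk a f)
    (fun h => hf' (Ideal.Quotient.eq_zero_iff_mem.1 h))
  refine ⟨P, hP, hle ?_⟩
  rw [Submodule.mem_colon_singleton, Submodule.mem_bot]
  exact Ideal.Quotient.eq_zero_iff_mem.2 hf

lemma avoid {a b : Ideal A} (ha : Soc a) (hb : Soc b) : ∃ c ∈ maximalIdeal A, Reg c a ∧ Reg c b := by
  by_contra hcon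
  push Not at hcon
  have hfin : (associatedPrimes A (A ⧸ a) ∪ associatedPrimes A (A ⧸ b)).Finite :=
    (associatedPrimes.finite A (A ⧸ a)).union (associatedPrimes.finite A (A ⧸ b))
  obtain ⟨P, hP, hle⟩ := ((maximalIdeal A).subset_union_prime_finite hfin (f := id) ⊥ ⊥ (fun _ h _ _ => by
    rcases h with h | h
    · exact h.1
    · exact h.1)).1 (by
    intro c hc
    by_cases h1 : Reg c a
    · obtain ⟨P, hP, hcP⟩ := not_reg (hcon c hc h1)
      exact Set.mem_biUnion (Or.inr hP) hcP
    · obtain ⟨P, hP, hcP⟩ := not_reg h1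
      exact Set.mem_biUnion (Or.inl hP) hcP)
  rcases hP with hP | hP
  · obtain ⟨w, hw, hw2⟩ := mem_ass hP
    exact hw (ha w fun b hb => (hw2 b).1 (hle hb))
  · obtain ⟨w, hw, hw2⟩ := mem_ass hP
    exact hw (hb w fun b hb => (hw2 b).1 (hle hb))

lemma exch (n : ℕ) : ∀ (a : Ideal A) (c : A), c ∈ maximalIdeal A → Reg c a → Dp (n + 1) a → Dp n (a ⊔ Ideal.span {c}) := by
  induction n with
  | zero => intro _ _ _ _ _; trivial
  | succ n ih =>
    rintro a x hxm hx ⟨r, hrm, hr, hd⟩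
    have hs : Soc (a ⊔ Ideal.span {r}) := by
      obtain ⟨r', hrm', hr', _⟩ := hd
      exact soc_of_reg hr' hrm'
    obtain ⟨c, hcm, hc1, hc2⟩ := avoid (soc_step (s := 0) hr hrm hs hx) hs
    have d1 : Dp (n + 1) (a ⊔ Ideal.span {c}) := by
      refine ⟨r, hrm, swap2 hr hc2, ?_⟩
      rw [sup_right_comm]
      exact ih _ _ hcm hc2 hd
    refine ⟨c, hcm, hc1, ?_⟩
    rw [sup_right_comm]
    exact ih _ _ hxm (swap2 hx hc1) d1

end CM2
end RN2

namespace RN2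
section CM3
variable {A : Type*} [CommRing A] [IsLocalRing A] [IsNoetherianRing A]

def Ch : ℕ → Ideal A → Prop
  | 0, P => P.IsPrime
  | n + 1, P => P.IsPrime ∧ ∃ P' : Ideal A, P < P' ∧ Ch n P'

lemma Ch.prime {n : ℕ} {P : Ideal A} (h : Ch n P) : P.IsPrime := by
  cases n with
  | zero => exact h
  | succ n => exact h.1

lemma assdim (n : ℕ) : ∀ (a P : Ideal A), P.IsPrime → (∃ w, w ∉ a ∧ ∀ b ∈ P, b * w ∈ a) → Dp n a → Ch n P := by
  induction n with
  | zero => intro _ _ h _ _; exact h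
  | succ n ih =>
    rintro a P hP ⟨w, hw, hPw⟩ ⟨r, hrm, hr, hd⟩
    refine ⟨hP, ?_⟩
    have hrP : r ∉ P := fun h => hw (hr w (hPw r h))
    have h1 : ∃ w', (∀ b ∈ P, b * w' ∈ a) ∧ w' ∉ a ⊔ Ideal.span {r} := by
      by_contra hcon
      push Not at hcon
      have := nak (a := a) (N := a.colon (P : Set A)) hrm (fun f hf => by
        have hf' : ∀ b ∈ P, b * f ∈ a := fun b hb => by
          have := Submodule.mem_colon.1 hf b hb
          rwa [smul_eq_mul, mul_comm] at this
        obtain ⟨α, hα, g, rfl⟩ := mem_sup_sp.1 (hcon f hf')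
        refine ⟨α, hα, g, Submodule.mem_colon.2 fun b hb => ?_, rfl⟩
        apply hr
        have : r * (g • b) = b * (α + r * g) - b * α := by rw [smul_eq_mul]; ring
        rw [this]
        exact a.sub_mem (hf' b hb) (Ideal.mul_mem_left _ _ hα))
      exact hw (this (Submodule.mem_colon.2 fun b hb => by
        have := hPw b hb
        rwa [mul_comm] at this))
    obtain ⟨w', hw', hn⟩ := h1
    obtain ⟨P', hP', hle⟩ := exists_le_isAssociatedPrime_of_isNoetherianRing A (Ideal.Quotient.mk (a ⊔ Ideal.span {r}) w')
      (fun h => hn (Ideal.Quotient.eq_zero_iff_mem.1 h))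
    have hmem : ∀ b, b * w' ∈ a ⊔ Ideal.span {r} → b ∈ P' := fun b hb => hle (by
      rw [Submodule.mem_colon_singleton, Submodule.mem_bot]
      exact Ideal.Quotient.eq_zero_iff_mem.2 hb)
    have hrP' : r ∈ P' := hmem r (Ideal.mul_mem_right _ _ (Ideal.mem_sup_right (Ideal.mem_span_singleton_self r)))
    refine ⟨P', lt_of_le_of_ne (fun b hb => hmem b (Ideal.mem_sup_left (hw' b hb))) (fun h => hrP (h ▸ hrP')), ?_⟩
    obtain ⟨v, hv, hv2⟩ := mem_ass hP'
    exact ih _ _ hP'.1 ⟨v, hv, fun b hb => (hv2 b).1 hb⟩ hd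

lemma ch_height (Q : Ideal A) (n : ℕ) : ∀ P : Ideal A, Q ≤ P → Ch n P →
    (P.map (Ideal.Quotient.mk Q)).height + n ≤ ((maximalIdeal A).map (Ideal.Quotient.mk Q)).height := by
  induction n with
  | zero =>
    intro P hQ h
    simpa using Ideal.height_mono (Ideal.map_mono (IsLocalRing.le_maximalIdeal (Ch.prime h).ne_top))
  | succ n ih =>
    rintro P hQ ⟨hP, P', hlt, h⟩
    have hQ' := hQ.trans hlt.le
    have := Ch.prime h
    have p1 : (P.map (Ideal.Quotient.mk Q)).IsPrime := Ideal.isPrime_map_quotientMk_of_isPrime hQ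
    have p2 : (P'.map (Ideal.Quotient.mk Q)).IsPrime := Ideal.isPrime_map_quotientMk_of_isPrime hQ'
    have hl : P.map (Ideal.Quotient.mk Q) < P'.map (Ideal.Quotient.mk Q) := by
      refine lt_of_le_of_ne (Ideal.map_mono hlt.le) fun e => hlt.ne ?_
      rw [← Ideal.comap_map_mk hQ, e, Ideal.comap_map_mk hQ']
    have h1 := Ideal.height_add_one_le_of_lt_of_isPrime hl
    refine le_trans ?_ (ih P' hQ' h)
    push_cast
    rw [add_comm (n : ℕ∞), ← add_assoc]
    gcongr

lemma ch_le {n k : ℕ} {P : Ideal A} (h : Ch n P) (y : Fin k → A) (hy : ∀ i, y i ∈ maximalIdeal A)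
    (hr : maximalIdeal A ≤ (P ⊔ sp y).radical) : n ≤ k := by
  have hP := Ch.prime h
  have hPm := IsLocalRing.le_maximalIdeal hP.ne_top
  have hle : P ⊔ sp y ≤ maximalIdeal A := sup_le hPm (Ideal.span_le.2 (by rintro _ ⟨i, rfl⟩; exact hy i))
  have h2 : (maximalIdeal A).map (Ideal.Quotient.mk P) ∈ ((sp y).map (Ideal.Quotient.mk P)).minimalPrimes := by
    refine ⟨⟨Ideal.isPrime_map_quotientMk_of_isPrime hPm, Ideal.map_mono (le_sup_right.trans hle)⟩, fun Q hQ _ => ?_⟩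
    have hQ1 := hQ.1
    rw [Ideal.map_le_iff_le_comap]
    refine hr.trans ((Ideal.IsPrime.radical_le_iff (Ideal.comap_isPrime (Ideal.Quotient.mk P) Q)).2 (sup_le ?_ ?_))
    · intro b hb
      rw [Ideal.mem_comap, Ideal.Quotient.eq_zero_iff_mem.2 hb]
      exact Q.zero_mem
    · exact Ideal.map_le_iff_le_comap.1 hQ.2
  have e : (sp y).map (Ideal.Quotient.mk P) = Ideal.span (Set.range fun i => Ideal.Quotient.mk P (y i)) := by
    rw [sp, Ideal.map_span, ← Set.range_comp]; rfl
  rw [e] at h2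
  have h3 := Ideal.height_le_card_of_mem_minimalPrimes_span (Set.finite_range _) h2
  have h4 := ch_height P n P le_rfl h
  have h5 : (n : ℕ∞) ≤ ((Set.range fun i => Ideal.Quotient.mk P (y i)).ncard : ℕ∞) :=
    le_trans (le_trans le_add_self h4) h3
  have h6 : (Set.range fun i => Ideal.Quotient.mk P (y i)).ncard ≤ k := by
    rw [← Set.image_univ]
    refine (Set.ncard_image_le Set.finite_univ).trans ?_
    simp [Set.ncard_univ]
  exact (Nat.cast_le.1 h5).trans h6

lemma cm_ind (D : ℕ) : ∀ (n : ℕ) (x : Fin D → A) (y : Fin n → A), (∀ i, x i ∈ maximalIdeal A) → (∀ i, y i ∈ maximalIdeal A) →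
    maximalIdeal A ≤ (sp x ⊔ sp y).radical → Dp (D + n) (⊥ : Ideal A) → RS D x ∧ Dp n (sp x) := by
  induction D with
  | zero =>
    intro n x y hx hy hr hd
    refine ⟨trivial, ?_⟩
    have : sp x = ⊥ := by simp [sp]
    rw [this]
    simpa using hd
  | succ D ih =>
    intro n x y hx hy hr hd
    have e1 : sp (Fin.cons (x 0) y : Fin (n + 1) → A) = sp y ⊔ Ideal.span {x 0} := by
      rw [sp_succ, Fin.tail_cons, Fin.cons_zero]
    obtain ⟨h1, h2⟩ := ih (n + 1) (Fin.tail x) (Fin.cons (x 0) y) (fun i => hx _)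
      (fun i => by refine Fin.cases ?_ ?_ i <;> simp [hx, hy])
      (by rw [e1, ← sup_assoc, sup_right_comm, ← sp_succ]; exact hr)
      (by rwa [show D + (n + 1) = D + 1 + n by ring])
    have h3 : Reg (x 0) (sp (Fin.tail x)) := by
      by_contra hcon
      obtain ⟨P, hP, hxP⟩ := not_reg hcon
      obtain ⟨w, hw, hw2⟩ := mem_ass hP
      have hc := assdim (n + 1) _ P hP.1 ⟨w, hw, fun b hb => (hw2 b).1 hb⟩ h2
      have hle : sp x ≤ P := by
        rw [sp_succ]
        refine sup_le (fun b hb => (hw2 b).2 (Ideal.mul_mem_right _ _ hb)) ?_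
        rw [Ideal.span_singleton_le_iff_mem]
        exact hxP
      have := ch_le hc y hy (hr.trans (Ideal.radical_mono (sup_le_sup_right hle _)))
      omega
    refine ⟨⟨h3, h1⟩, ?_⟩
    rw [sp_succ]
    exact exch n _ _ (hx 0) h3 h2

end CM3
end RN2

namespace RN2
section CM4
open RingTheory.Sequence
variable {A : Type*} [CommRing A]

lemma reg_iff (r : A) (a : Ideal A) : IsSMulRegular (A ⧸ (a • (⊤ : Submodule A A))) r ↔ Reg r a := by
  rw [isSMulRegular_quotient_iff_mem_of_smul_mem]
  have : a • (⊤ : Submodule A A) = a := by simp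
  rw [this]
  rfl

lemma dp_of_list [IsLocalRing A] [IsNoetherianRing A] (rs : List A) (hm : ∀ x ∈ rs, x ∈ maximalIdeal A)
    (h : IsWeaklyRegular A rs) : Dp rs.length (⊥ : Ideal A) := by
  have key : ∀ j ≤ rs.length, Dp j (Ideal.ofList (rs.take (rs.length - j))) := by
    intro j
    induction j with
    | zero => intro _; trivial
    | succ j ih =>
      intro hj
      have hlt : rs.length - (j + 1) < rs.length := by omega
      refine ⟨rs[rs.length - (j + 1)], hm _ (List.getElem_mem _), ?_, ?_⟩
      · exact (reg_iff _ _).1 ((isWeaklyRegular_iff_Fin A rs).1 h ⟨_, hlt⟩)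
      · have := ih (by omega)
        rw [show rs.length - j = rs.length - (j + 1) + 1 by omega, List.take_succ_eq_append_getElem hlt,
          Ideal.ofList_append, Ideal.ofList_singleton] at this
        exact this
  simpa using key rs.length le_rfl

def Ls : (D : ℕ) → (Fin D → A) → List A
  | 0, _ => []
  | D + 1, x => Ls D (Fin.tail x) ++ [x 0]

lemma Ls_length (D : ℕ) : ∀ x : Fin D → A, (Ls D x).length = D := by
  induction D with
  | zero => intro x; rfl
  | succ D ih => intro x; simp [Ls, ih]

lemma Ls_span (D : ℕ) : ∀ x : Fin D → A, Ideal.ofList (Ls D x) = sp x := by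
  induction D with
  | zero => intro x; simp [Ls, sp]
  | succ D ih => intro x; rw [Ls, Ideal.ofList_append, Ideal.ofList_singleton, ih, sp_succ]

lemma Ls_reg (D : ℕ) : ∀ x : Fin D → A, RS D x → IsWeaklyRegular A (Ls D x) := by
  induction D with
  | zero => intro x _; exact IsWeaklyRegular.nil A A
  | succ D ih =>
    intro x h
    rw [Ls, isWeaklyRegular_append_iff, isWeaklyRegular_singleton_iff, reg_iff, Ls_span]
    exact ⟨ih _ h.2, h.1⟩

lemma Ls_mem (D : ℕ) : ∀ x : Fin D → A, ∀ r ∈ Ls D x, ∃ i, r = x i := by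
  induction D with
  | zero => intro x r h; simp [Ls] at h
  | succ D ih =>
    intro x r h
    rw [Ls, List.mem_append] at h
    rcases h with h | h
    · obtain ⟨i, rfl⟩ := ih _ r h
      exact ⟨i.succ, rfl⟩
    · exact ⟨0, by simpa using h⟩

lemma dp_of_cm [IsLocalRing A] [IsNoetherianRing A] {d : ℕ} (hdim : ringKrullDim A = d) (hCM : IsCMLocal A) : Dp d (⊥ : Ideal A) := by
  unfold IsCMLocal at hCM
  rw [hdim] at hCM
  have h1 : rdepth A (maximalIdeal A) A = (d : ℕ∞) := by exact_mod_cast hCM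
  unfold rdepth at h1
  have hne : Nonempty {n : ℕ∞ | ∃ rs : List A, (rs.length : ℕ∞) = n ∧ (∀ x ∈ rs, x ∈ maximalIdeal A) ∧ IsRegular A rs} :=
    ⟨⟨0, [], by simp, by simp, IsRegular.nil A A⟩⟩
  have h2 := ENat.sSup_mem_of_nonempty_of_lt_top (s := {n : ℕ∞ | ∃ rs : List A, (rs.length : ℕ∞) = n ∧ (∀ x ∈ rs, x ∈ maximalIdeal A) ∧ IsRegular A rs})
    (by rw [h1]; exact ENat.natCast_lt_top _)
  rw [h1] at h2
  obtain ⟨rs, hl, hm, hr⟩ := h2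
  have : rs.length = d := by exact_mod_cast hl
  rw [← this]
  exact dp_of_list rs hm hr.1

lemma cm_RS [IsLocalRing A] [IsNoetherianRing A] {d : ℕ} (hdim : ringKrullDim A = d) (hCM : IsCMLocal A) (x : Fin d → A)
    (hx : ∀ i, x i ∈ maximalIdeal A) (hr : maximalIdeal A ≤ (sp x).radical) : RS d x :=
  (cm_ind d 0 x Fin.elim0 hx (fun i => i.elim0) (hr.trans (Ideal.radical_mono le_sup_left)) (dp_of_cm hdim hCM)).1

end CM4
end RN2

namespace RN2
section Fin1
variable {A : Type*} [CommRing A]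

lemma intCl_le_F {I J : Ideal A} {N : ℕ} (hN : ∀ n ≥ N, I ^ (n + 1) = J * I ^ n) (n : ℕ) : intCl (I ^ n) ≤ F J n := by
  have hk : ∀ k, I ^ (N + k) ≤ J ^ k := by
    intro k
    induction k with
    | zero => simp
    | succ k ih =>
      rw [← add_assoc, hN _ (by omega), pow_succ']
      exact Ideal.mul_mono_right ih
  refine Ideal.span_le.2 ?_
  rintro f ⟨s, hs, a, ha, e⟩
  have h1 : ∀ j, f ^ j ∈ I ^ (n * (j + 1 - s)) := by
    intro j
    induction j using Nat.strong_induction_on with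
    | _ j ih =>
      rcases lt_or_ge j s with h | h
      · rw [show j + 1 - s = 0 by omega]; simp
      · have e2 : f ^ j = - ∑ i ∈ Finset.Icc 1 s, a i * f ^ (j - i) := by
          have e3 : f ^ (j - s) * (∑ i ∈ Finset.Icc 1 s, a i * f ^ (s - i)) = ∑ i ∈ Finset.Icc 1 s, a i * f ^ (j - i) := by
            rw [Finset.mul_sum]
            refine Finset.sum_congr rfl fun i hi => ?_
            rw [Finset.mem_Icc] at hi
            rw [show j - i = (j - s) + (s - i) by omega, pow_add]; ring
          have e4 : f ^ j = f ^ (j - s) * f ^ s := by rw [← pow_add]; congr 1; omega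
          rw [← e3, e4]
          linear_combination f ^ (j - s) * e
        rw [e2]
        refine Ideal.neg_mem_iff _ |>.2 (Ideal.sum_mem _ fun i hi => ?_)
        have hi' := Finset.mem_Icc.1 hi
        have h2 := ha i hi
        rw [← pow_mul] at h2
        have h3 := Ideal.mul_mem_mul h2 (ih (j - i) (by omega))
        rw [← pow_add, ← mul_add] at h3
        exact Ideal.pow_le_pow_right (Nat.mul_le_mul_left n (by omega)) h3
  refine mem_F.2 ⟨N + n * s, fun i j h => ?_⟩
  have hb : N + i ≤ n * (j + 1 - s) := by
    rcases lt_or_ge (j + 1) s with h' | h'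
    · have : n * j ≤ n * s := Nat.mul_le_mul_left n (by omega)
      have h0 : N + i ≤ 0 := by omega
      omega
    · obtain ⟨u, hu⟩ := Nat.exists_eq_add_of_le h'
      rw [hu, Nat.add_sub_cancel_left]
      have : n * j ≤ n * (s + u) := Nat.mul_le_mul_left n (by omega)
      rw [mul_add] at this
      omega
  exact hk i (Ideal.pow_le_pow_right hb (h1 j))

lemma F_le_intCl [Nontrivial A] [IsNoetherianRing A] {I J : Ideal A} (hJI : J ≤ I) (n : ℕ) : F J n ≤ intCl (I ^ n) := by
  intro f hf
  obtain ⟨s, c, hc, e⟩ := F_integral J hf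
  refine Ideal.subset_span ⟨s, ?_, fun i => - c (s - i), fun i hi => ?_, ?_⟩
  · rcases Nat.eq_zero_or_pos s with rfl | h
    · simp at e
    · exact h
  · have hi' := Finset.mem_Icc.1 hi
    have := hc (s - i) (by omega)
    rw [show s - (s - i) = i by omega, pow_mul] at this
    exact neg_mem (Ideal.pow_right_mono (Ideal.pow_right_mono hJI n) i this)
  · have : ∑ i ∈ Finset.Icc 1 s, -c (s - i) * f ^ (s - i) = - ∑ i ∈ Finset.range s, c i * f ^ i := by
      rw [← Finset.sum_neg_distrib]
      refine Finset.sum_nbij' (fun i => s - i) (fun i => s - i) ?_ ?_ ?_ ?_ ?_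
      · intro i hi; simp only [Finset.mem_Icc, Finset.mem_range] at *; omega
      · intro i hi; simp only [Finset.mem_Icc, Finset.mem_range] at *; omega
      · intro i hi; simp only [Finset.mem_Icc, Finset.mem_range] at *; omega
      · intro i hi; simp only [Finset.mem_Icc, Finset.mem_range] at *; omega
      · intro i hi; ring
    rw [this, e]; ring

lemma ln_idealQuot (N K : Ideal A) : ln K = Module.length A (idealQuot N K) + ln (N ⊔ K) := by
  refine Module.length_eq_add_of_exact (Submodule.mapQ (Submodule.comap N.subtype K) K N.subtype le_rfl)
    (Submodule.mapQ K (N ⊔ K) LinearMap.id le_sup_right) ?_ ?_ ?_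
  · rw [← LinearMap.ker_eq_bot, LinearMap.ker_eq_bot']
    intro y hy
    obtain ⟨y, rfl⟩ := Submodule.Quotient.mk_surjective _ y
    rw [Submodule.mapQ_apply, Submodule.Quotient.mk_eq_zero] at hy
    exact (Submodule.Quotient.mk_eq_zero _).2 hy
  · intro y
    obtain ⟨y, rfl⟩ := Submodule.Quotient.mk_surjective _ y
    exact ⟨Submodule.Quotient.mk y, rfl⟩
  · intro y
    obtain ⟨y, rfl⟩ := Submodule.Quotient.mk_surjective _ y
    rw [Submodule.mapQ_apply, Submodule.Quotient.mk_eq_zero, LinearMap.id_apply]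
    constructor
    · intro h
      obtain ⟨u, hu, v, hv, rfl⟩ := Submodule.mem_sup.1 h
      refine ⟨Submodule.Quotient.mk ⟨u, hu⟩, ?_⟩
      rw [Submodule.mapQ_apply, Submodule.Quotient.eq]
      have : N.subtype ⟨u, hu⟩ - (u + v) = - v := by simp
      rw [this]
      exact K.neg_mem hv
    · rintro ⟨z, hz⟩
      obtain ⟨z, rfl⟩ := Submodule.Quotient.mk_surjective _ z
      rw [Submodule.mapQ_apply, Submodule.Quotient.eq] at hz
      have : y = N.subtype z - (N.subtype z - y) := by ring
      rw [this]
      exact Submodule.sub_mem _ (Ideal.mem_sup_left z.2) (Ideal.mem_sup_right hz)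

lemma F2_inf [IsLocalRing A] [IsNoetherianRing A] {D : ℕ} {x : Fin D → A} (hx : QReg x) (hm : ∀ i, x i ∈ maximalIdeal A)
    {f : A} (hf : f ∈ F (sp x) 2) (hf' : f ∈ sp x) : f ∈ sp x * maximalIdeal A := by
  obtain ⟨P, hP, rfl⟩ := exists_form' x 1 f (by simpa using hf')
  have h1 : ∀ a, P.coeff a ∈ maximalIdeal A := by
    by_contra hcon
    push Not at hcon
    have := F_cancel hx hP hcon 1 1 (by simpa using hf)
    obtain ⟨k, hk⟩ := mem_F.1 this
    have h2 := hk 1 (1 + k) (by omega)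
    rw [one_pow, pow_one] at h2
    have : sp x ≤ maximalIdeal A := Ideal.span_le.2 (by rintro _ ⟨i, rfl⟩; exact hm i)
    exact (Ideal.ne_top_iff_one _).1 (IsLocalRing.maximalIdeal.isMaximal A).ne_top (this h2)
  have := eval_mem_of_coeff x (maximalIdeal A) 1 P hP h1
  rwa [pow_one, mul_comm] at this

lemma length_of_mlen {M : Type*} [AddCommGroup M] [Module A M] {n : ℕ} (h : mlen A M = (n : WithBot ℕ∞)) :
    Module.length A M = n := by
  unfold mlen at h
  rw [← Module.coe_length] at h
  exact_mod_cast h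

end Fin1

lemma final_aux {R : Type*} [CommRing R] [IsLocalRing R] [IsNoetherianRing R]
    (D : ℕ) (hdim : ringKrullDim R = (D + 3 : ℕ))
    (hCM : IsCMLocal R) (hAU : AnalyticallyUnramified R)
    (t : ℕ) (ht : CMTypeData R (D + 3) t)
    (I J : Ideal R) (hIm : intCl I = maximalIdeal R)
    (hJ : IsMinimalReduction (D + 3) J I)
    (L : ℕ → ℕ) (e : ℕ → ℤ) (hHilb : NormalHilbertData (D + 3) I L e)
    (he3 : e 3 = 0) (ℓ : ℕ)
    (hℓ : mlen R (idealQuot (intCl (I ^ 2)) (J * intCl I)) = (ℓ : WithBot ℕ∞))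
    (hbig : (t : ℤ) - 1 ≤ (ℓ : ℤ)) :
    ∀ n, 1 ≤ n → intCl (I ^ (n + 1)) = J ^ (n - 1) * intCl (I ^ 2) := by
  obtain ⟨hJI, ⟨x, hx⟩, N, hN⟩ := hJ
  have hx : J = sp x := hx
  subst hx
  have hF : ∀ n, intCl (I ^ n) = F (sp x) n := fun n => le_antisymm (intCl_le_F hN n) (F_le_intCl hJI n)
  have hm1 : maximalIdeal R = F (sp x) 1 := by rw [← hF, pow_one, hIm]
  have hJm : sp x ≤ maximalIdeal R := by
    rw [hm1]
    exact fun f hf => mem_F_one _ hf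
  have hmem : ∀ i, x i ∈ maximalIdeal R := fun i => hJm (mem_sp x i)
  have hrad : maximalIdeal R ≤ (sp x).radical := by
    intro f hf
    rw [hm1] at hf
    obtain ⟨k, hk⟩ := mem_F.1 hf
    exact ⟨1 + k, by simpa using hk 1 (1 + k) (by omega)⟩
  have hRS := cm_RS hdim hCM x hmem hrad
  have hq := QReg_of_RS _ x hRS
  have hL : ∀ n, ln (F (sp x) (n + 1)) = L n := fun n => by
    have := hHilb.1 n
    rw [hF] at this
    exact length_of_mlen this
  have hW := WW hAU (sp x) hJm
  obtain ⟨e0, he0⟩ : ∃ e0 : ℕ, ln (sp x) = e0 := by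
    obtain ⟨a, ha⟩ := Ideal.exists_radical_pow_le_of_fg (sp x) (IsNoetherian.noetherian _)
    obtain ⟨n, hn⟩ := hW a
    have h1 : F (sp x) (n + 1) ≤ sp x :=
      ((F_anti (sp x) (Nat.le_succ n)).trans hn).trans ((Ideal.pow_right_mono hrad a).trans ha)
    have h2 := ln_anti h1
    rw [hL] at h2
    exact ENat.ne_top_iff_exists.1 (ne_top_of_le_ne_top (ENat.natCast_ne_top _) h2) |>.imp fun _ h => h.symm
  have hfr : Fr x := ⟨hq, hmem, FIN_of_W hq hmem hm1.le he0 hW, hm1.le⟩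
  have hH : Hilb x := by
    obtain ⟨N', hN'⟩ := hHilb.2
    exact ⟨e, he3, N', fun n hn => ⟨L n, hL n, hN' n hn⟩⟩
  have hT : TT x := by
    have h1 := length_of_mlen hℓ
    rw [hF, hIm] at h1
    have e1 : Submodule.comap (F (sp x) 2).subtype (sp x * maximalIdeal R) = Submodule.comap (F (sp x) 2).subtype (sp x) := by
      ext f
      exact ⟨fun h => Ideal.mul_le_left h, fun h => F2_inf hq hmem f.2 h⟩
    have h2 := ln_idealQuot (F (sp x) 2) (sp x)
    unfold idealQuot at h1 h2
    rw [← e1, h1, he0] at h2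
    have h3 := ht (Ls _ x) (Ls_length _ x) (fun r hr => by obtain ⟨i, rfl⟩ := Ls_mem _ x r hr; exact hmem i)
      ((IsLocalRing.isRegular_iff_isWeaklyRegular_of_subset_maximalIdeal (fun r hr => by
        obtain ⟨i, rfl⟩ := Ls_mem _ x r hr; exact hmem i)).2 (Ls_reg _ x hRS))
    have e2 : Ideal.span {r | r ∈ Ls _ x} = sp x := Ls_span _ x
    rw [e2] at h3
    have h4 := length_of_mlen h3
    have h5 := ln_idealQuot ((sp x).colon (maximalIdeal R : Set R)) (sp x)
    rw [h4, he0] at h5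
    have e3 : (sp x).colon (maximalIdeal R : Set R) ⊔ sp x = (sp x).colon (maximalIdeal R : Set R) :=
      sup_eq_left.2 fun f hf => Submodule.mem_colon.2 fun b _ => Ideal.mul_mem_right _ _ hf
    rw [e3] at h5
    unfold TT
    generalize ln (F (sp x) 2 ⊔ sp x) = p at h2 ⊢
    generalize ln ((sp x).colon (maximalIdeal R : Set R)) = q at h5 ⊢
    have hp : p ≠ ⊤ := by rintro rfl; simp at h2
    have hq : q ≠ ⊤ := by rintro rfl; simp at h5
    obtain ⟨p, rfl⟩ := ENat.ne_top_iff_exists.1 hp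
    obtain ⟨q, rfl⟩ := ENat.ne_top_iff_exists.1 hq
    norm_cast at h2 h5 ⊢
    omega
  have hg := main_ind D R x hfr hH hT
  intro n hn
  rw [hF, hF]
  obtain ⟨k, rfl⟩ : ∃ k, n = k + 1 := ⟨n - 1, by omega⟩
  rw [Nat.add_sub_cancel]
  refine le_antisymm ?_ ?_
  · clear hn
    induction k with
    | zero => simp
    | succ k ih =>
      refine (hg.red (k + 1 + 1) (by omega)).trans ?_
      rw [pow_succ', mul_assoc]
      exact Ideal.mul_mono_right ih
  · exact pow_mul_F_le (sp x) k 2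

end RN2

theorem reduction_number_two_of_e3_zero
    (R : Type*) [CommRing R] [IsLocalRing R] [IsNoetherianRing R]
    (d : ℕ) (hd : 3 ≤ d) (hdim : ringKrullDim R = d)
    (hCM : IsCMLocal R) (hAU : AnalyticallyUnramified R)
    (hres : Infinite (ResidueField R))
    (t : ℕ) (ht : CMTypeData R d t)
    (I J : Ideal R) (hIm : intCl I = maximalIdeal R)
    (hJ : IsMinimalReduction d J I)
    (L : ℕ → ℕ) (e : ℕ → ℤ) (hHilb : NormalHilbertData d I L e)
    (he3 : e 3 = 0)
    -- `ℓ = λ(Ī²/JĪ)`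
    (ℓ : ℕ)
    (hℓ : mlen R (idealQuot (intCl (I ^ 2)) (J * intCl I)) = (ℓ : WithBot ℕ∞))
    (hbig : (t : ℤ) - 1 ≤ (ℓ : ℤ)) :
    ∀ n, 1 ≤ n → intCl (I ^ (n + 1)) = J ^ (n - 1) * intCl (I ^ 2) := by
  obtain ⟨D, rfl⟩ : ∃ D, d = D + 3 := ⟨d - 3, by omega⟩
  exact RN2.final_aux D hdim hCM hAU t ht I J hIm hJ L e hHilb he3 ℓ hℓ hbig
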